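/- Fix parameters α,β>0, γ,δ≥0, 0≤q<1, and let a,b,c,d be defined from them via φ±; assume ab<1 (fan region). For each N≥1 let μ_N be a stationary probability measure for the open ASEP generator on {0,1}^N, and let h_N ∈ C₀([0,1],ℝ) be the random height profile defined under μ_N by h_N(k/N) = (1/N)∑_{i=1}^k τ_i for k=0,…,N and linear interpolation in between. Then {h_N} satisfies the large deviation principle in C₀([0,1],ℝ) with the supremum norm and good rate function I^{(a,b)}: (i) I^{(a,b)} is lower semicontinuous and its sublevel sets {I^{(a,b)} ≤ t} are compact for every t≥0; (ii) for every closed set C ⊆ C₀([0,1],ℝ), limsup_{N→∞} (1/N) log μ_N(h_N ∈ C) ≤ −inf_{f∈C} I^{(a,b)}(f); (iii) for every open set U ⊆ C₀([0,1],ℝ), liminf_{N→∞} (1/N) log μ_N(h_N ∈ U) ≥ −inf_{f∈U} I^{(a,b)}(f). -/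

import Mathlib

/-- `φ₊(x,y) = (1/(2x))(1-q-x+y + √((1-q-x+y)² + 4xy))`. -/
noncomputable def phiPlus (q x y : ℝ) : ℝ :=
  (1 / (2 * x)) * (1 - q - x + y + Real.sqrt ((1 - q - x + y) ^ 2 + 4 * x * y))

/-- `φ₋(x,y) = (1/(2x))(1-q-x+y - √((1-q-x+y)² + 4xy))`. -/
noncomputable def phiMinus (q x y : ℝ) : ℝ :=
  (1 / (2 * x)) * (1 - q - x + y - Real.sqrt ((1 - q - x + y) ^ 2 + 4 * x * y))

/-- Off-diagonal jump rates of the open ASEP on `{1,…,N}` with parameters `α,β,γ,δ,q`: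
bulk right jumps at rate `1`, bulk left jumps at rate `q`, entry/exit at the left boundary at
rates `α`/`γ`, and entry/exit at the right boundary at rates `δ`/`β`. -/
noncomputable def asepJump (N : ℕ) (α β γ δ q : ℝ) (τ τ' : Fin N → Bool) : ℝ :=
  (∑ i : Fin N, ∑ j : Fin N,
    if (j : ℕ) = (i : ℕ) + 1 ∧ τ i = true ∧ τ j = false ∧
        τ' = Function.update (Function.update τ i false) j true then (1 : ℝ) else 0) +
  q * (∑ i : Fin N, ∑ j : Fin N,
    if (j : ℕ) = (i : ℕ) + 1 ∧ τ i = false ∧ τ j = true ∧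
        τ' = Function.update (Function.update τ i true) j false then (1 : ℝ) else 0) +
  α * (∑ i : Fin N,
    if (i : ℕ) = 0 ∧ τ i = false ∧ τ' = Function.update τ i true then (1 : ℝ) else 0) +
  γ * (∑ i : Fin N,
    if (i : ℕ) = 0 ∧ τ i = true ∧ τ' = Function.update τ i false then (1 : ℝ) else 0) +
  δ * (∑ i : Fin N,
    if (i : ℕ) = N - 1 ∧ τ i = false ∧ τ' = Function.update τ i true then (1 : ℝ) else 0) +
  β * (∑ i : Fin N,
    if (i : ℕ) = N - 1 ∧ τ i = true ∧ τ' = Function.update τ i false then (1 : ℝ) else 0)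

/-- The generator matrix `Q` of the open ASEP on `{0,1}^N`. -/
noncomputable def asepGen (N : ℕ) (α β γ δ q : ℝ) (τ τ' : Fin N → Bool) : ℝ :=
  if τ' = τ then -∑ σ ∈ Finset.univ.filter (fun σ => σ ≠ τ), asepJump N α β γ δ q τ σ
  else asepJump N α β γ δ q τ τ'

/-- `μ` is a stationary measure for the open ASEP generator: `∑_τ μ(τ) Q(τ,τ') = 0` for all
`τ'`. -/
noncomputable def IsStationaryASEP (N : ℕ) (α β γ δ q : ℝ) (μ : (Fin N → Bool) → ℝ) : Prop :=
  ∀ τ' : Fin N → Bool, ∑ τ : Fin N → Bool, μ τ * asepGen N α β γ δ q τ τ' = 0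

open scoped Classical

/-- The space `C₀([0,1],ℝ)` of continuous functions on `[0,1]` vanishing at `0`, with the
supremum-norm (uniform) topology. -/
abbrev C0Sp : Type := {f : C(Set.Icc (0:ℝ) 1, ℝ) // f ⟨0, Set.left_mem_Icc.mpr zero_le_one⟩ = 0}

/-- Extension of `f : C([0,1],ℝ)` to `ℝ` by clamping the argument to `[0,1]`. -/
noncomputable def extendF (f : C(Set.Icc (0:ℝ) 1, ℝ)) : ℝ → ℝ :=
  fun t => f (Set.projIcc 0 1 zero_le_one t)

/-- Evaluation of `f ∈ C₀([0,1],ℝ)` at `t ∈ [0,1]`. -/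
noncomputable def evalC0 (f : C0Sp) (t : ℝ) : ℝ := extendF f.val t

/-- The convex envelope on `[0,1]`: the largest convex function below `F` on `[0,1]`. -/
noncomputable def convEnv (F : ℝ → ℝ) : ℝ → ℝ := fun x =>
  sSup {y : ℝ | ∃ g : ℝ → ℝ, ConvexOn ℝ (Set.Icc (0:ℝ) 1) g ∧
    (∀ t ∈ Set.Icc (0:ℝ) 1, g t ≤ F t) ∧ y = g x}

/-- The entropy function `H(x) = x log x + (1-x) log(1-x)` (for `x ∈ [0,1]`;
note `Real.log 0 = 0` implements the convention `0·log 0 = 0`). -/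
noncomputable def Hent (x : ℝ) : ℝ := x * Real.log x + (1 - x) * Real.log (1 - x)

/-- `J(a,b)`. -/
noncomputable def Jfun (a b : ℝ) : ℝ :=
  if 1 < a then a / (1 + a) ^ 2 else if 1 < b then b / (1 + b) ^ 2 else 1 / 4

/-- `G_*(x) = min(max(f̃'(x), a/(1+a)), 1/(1+b))`, where `f̃` is the convex envelope of `F`. -/
noncomputable def Gstar (a b : ℝ) (F : ℝ → ℝ) (x : ℝ) : ℝ :=
  min (max (deriv (convEnv F) x) (a / (1 + a))) (1 / (1 + b))

/-- The rate function `I^{(a,b)} : C₀([0,1],ℝ) → [0,∞]` of Theorem 1.2.  A function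
`f : [0,1] → ℝ` with `f(0)=0` is absolutely continuous with `0 ≤ f' ≤ 1` a.e. if and only if
it is nondecreasing and 1-Lipschitz, in which case `f'` (defined a.e.) is `deriv f`. -/
noncomputable def rateI (a b : ℝ) (f : C0Sp) : EReal :=
  if MonotoneOn (extendF f.val) (Set.Icc (0:ℝ) 1) ∧
      LipschitzOnWith 1 (extendF f.val) (Set.Icc (0:ℝ) 1) then
    (((∫ x in (0:ℝ)..1, Hent (deriv (extendF f.val) x)) +
      (∫ x in (0:ℝ)..1,
        (deriv (convEnv (extendF f.val)) x * Real.log (Gstar a b (extendF f.val) x) +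
          (1 - deriv (convEnv (extendF f.val)) x) *
            Real.log (1 - Gstar a b (extendF f.val) x))) -
      Real.log (Jfun a b) : ℝ) : EReal)
  else ⊤

/-- The finite-dimensional rate function
`I^{(a,b)}_{θ₁,…,θ_{d+1}}(x) = inf{ I^{(a,b)}(f) : f ∈ C₀([0,1],ℝ), f(θ_j) = x_j ∀j }`. -/
noncomputable def rateFd (a b : ℝ) (k : ℕ) (θ : Fin (k+1) → ℝ) (x : Fin (k+1) → ℝ) : EReal :=
  ⨅ f : {f : C0Sp // ∀ j, evalC0 f (θ j) = x j}, rateI a b f.val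

/-- The logarithm with values in `EReal`, with `log x = -∞` for `x ≤ 0`. -/
noncomputable def elog (x : ℝ) : EReal := if x ≤ 0 then ⊥ else ((Real.log x : ℝ) : EReal)

/-- The rescaled height profile `h_N ∈ C₀([0,1],ℝ)` of a configuration `τ ∈ {0,1}^N`:
`h_N(k/N) = (1/N) ∑_{i=1}^k τ_i`, with linear interpolation in between. -/
noncomputable def heightC0 (N : ℕ) (τ : Fin N → Bool) : C0Sp :=
  ⟨⟨fun t => (N : ℝ)⁻¹ * ∑ k : Fin N,
      (if τ k = true then (1 : ℝ) else 0) * min 1 (max 0 ((N : ℝ) * (t : ℝ) - (k : ℕ))),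
    by
      apply Continuous.mul continuous_const
      apply continuous_finset_sum
      intro k _
      exact continuous_const.mul
        (Continuous.min continuous_const
          (Continuous.max continuous_const
            ((continuous_const.mul continuous_subtype_val).sub continuous_const)))⟩,
    by
      simp only [ContinuousMap.coe_mk]
      have h : ∀ k : Fin N,
          (if τ k = true then (1 : ℝ) else 0) *
            min 1 (max 0 ((N : ℝ) *
              ((⟨0, Set.left_mem_Icc.mpr zero_le_one⟩ : Set.Icc (0:ℝ) 1) : ℝ) - (k : ℕ))) = 0 := by
        intro k
        have h1 : ((⟨0, Set.left_mem_Icc.mpr zero_le_one⟩ : Set.Icc (0:ℝ) 1) : ℝ) = 0 := rfl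
        rw [h1]
        have h2 : (N : ℝ) * 0 - ((k : ℕ) : ℝ) ≤ 0 := by
          simp
        rw [max_eq_left h2, min_eq_right zero_le_one, mul_zero]
      rw [Finset.sum_congr rfl fun k _ => h k]
      simp⟩

namespace OpenASEP

/-- Subsolutions of the matrix-ansatz relations. -/
structure IsSub (q Γ A Δ B : ℝ) (e : List Bool → ℝ) : Prop where
  bulk : ∀ u v, e (u ++ true :: false :: v) ≤
    q * e (u ++ false :: true :: v) + (1 - q) * (e (u ++ true :: v) + e (u ++ false :: v))
  left : ∀ u, e (false :: u) ≤ Γ * e (true :: u) + A * e u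
  right : ∀ u, e (u ++ [true]) ≤ Δ * e (u ++ [false]) + B * e u

/-- Supersolutions of the matrix-ansatz relations. -/
structure IsSuper (q Γ A Δ B : ℝ) (e : List Bool → ℝ) : Prop where
  bulk : ∀ u v, q * e (u ++ false :: true :: v) + (1 - q) * (e (u ++ true :: v) + e (u ++ false :: v))
    ≤ e (u ++ true :: false :: v)
  left : ∀ u, Γ * e (true :: u) + A * e u ≤ e (false :: u)
  right : ∀ u, Δ * e (u ++ [false]) + B * e u ≤ e (u ++ [true])

lemma pos_part_le {x y r : ℝ} (hr : 0 ≤ r) (h : x ≤ r * y) : max 0 x ≤ r * max 0 y :=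
  max_le (mul_nonneg hr (le_max_left _ _))
    (h.trans (mul_le_mul_of_nonneg_left (le_max_right _ _) hr))

theorem IsSub.nonpos {q Γ A Δ B : ℝ} {e : List Bool → ℝ} (h : IsSub q Γ A Δ B e)
    (hq0 : 0 ≤ q) (hq1 : q ≤ 1) (hΓ : 0 ≤ Γ) (hA : 0 ≤ A) (hΔ : 0 ≤ Δ) (hB : 0 ≤ B)
    (hΓΔ : Γ * Δ < 1) (h0 : e [] ≤ 0) (u : List Bool) : e u ≤ 0 := by
  induction hn : u.length using Nat.strong_induction_on generalizing u with
  | _ n ih =>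
  have short : ∀ v : List Bool, v.length < n → e v ≤ 0 := fun v hv => ih _ hv v rfl
  have swap : ∀ p v : List Bool, p.length + v.length + 2 = n →
      max 0 (e (p ++ true :: false :: v)) ≤ max 0 (e (p ++ false :: true :: v)) := by
    intro p v hpv
    have h1 := h.bulk p v
    have h2 := short (p ++ true :: v) (by simp; omega)
    have h3 := short (p ++ false :: v) (by simp; omega)
    have h4 : max 0 (e (p ++ true :: false :: v)) ≤ q * max 0 (e (p ++ false :: true :: v)) := by
      apply pos_part_le hq0
      nlinarith
    have h5 : 0 ≤ max 0 (e (p ++ false :: true :: v)) := le_max_left _ _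
    nlinarith
  have move : ∀ (z : ℕ) (p v : List Bool), p.length + z + v.length + 1 = n →
      max 0 (e (p ++ true :: (List.replicate z false ++ v))) ≤
        max 0 (e (p ++ (List.replicate z false ++ true :: v))) := by
    intro z
    induction z with
    | zero => intro p v _; simp
    | succ z ihz =>
      intro p v hp
      have h1 := swap p (List.replicate z false ++ v) (by simp; omega)
      have h2 := ihz (p ++ [false]) v (by simp; omega)
      simp only [List.append_assoc, List.singleton_append] at h2
      simp only [List.replicate_succ, List.cons_append]
      exact h1.trans h2
  have sort : ∀ x p : List Bool, p.length + x.length = n →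
      max 0 (e (p ++ x)) ≤
        max 0 (e (p ++ (List.replicate (x.count false) false ++
          List.replicate (x.count true) true))) := by
    intro x
    induction x with
    | nil => intro p _; simp
    | cons y x ihx =>
      intro p hp
      have h1 := ihx (p ++ [y]) (by simp at hp ⊢; omega)
      simp only [List.append_assoc, List.singleton_append] at h1
      have hlen := List.count_false_add_count_true x
      cases y with
      | false => simpa [List.replicate_succ] using h1
      | true =>
        have h2 := move (x.count false) p (List.replicate (x.count true) true)
          (by simp at hp ⊢; omega)
        refine (h1.trans h2).trans (le_of_eq ?_)
        simp [List.replicate_succ]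
  have key : ∀ z o : ℕ, z + o + 1 = n →
      max 0 (e (List.replicate (z + 1) false ++ List.replicate o true)) = 0 ∧
      max 0 (e (List.replicate z false ++ List.replicate (o + 1) true)) = 0 := by
    intro z o hzo
    set X := max 0 (e (List.replicate (z + 1) false ++ List.replicate o true)) with hX
    set Y := max 0 (e (List.replicate z false ++ List.replicate (o + 1) true)) with hY
    have hX0 : 0 ≤ X := le_max_left _ _
    have hY0 : 0 ≤ Y := le_max_left _ _
    have h1 : X ≤ Γ * Y := by
      have hl := h.left (List.replicate z false ++ List.replicate o true)
      have hs := short (List.replicate z false ++ List.replicate o true) (by simp; omega)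
      have h2 := pos_part_le (x := e (false :: (List.replicate z false ++ List.replicate o true)))
        (y := e (true :: (List.replicate z false ++ List.replicate o true))) hΓ (by nlinarith)
      have h3 := move z [] (List.replicate o true) (by simp; omega)
      simp only [List.nil_append] at h3
      rw [hX, hY]
      simp only [List.replicate_succ, List.cons_append]
      exact h2.trans (mul_le_mul_of_nonneg_left h3 hΓ)
    have h2 : Y ≤ Δ * X := by
      have hl := h.right (List.replicate z false ++ List.replicate o true)
      have hs := short (List.replicate z false ++ List.replicate o true) (by simp; omega)
      have h2 := pos_part_le (x := e ((List.replicate z false ++ List.replicate o true) ++ [true]))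
        (y := e ((List.replicate z false ++ List.replicate o true) ++ [false])) hΔ (by nlinarith)
      have h3 := sort ((List.replicate z false ++ List.replicate o true) ++ [false]) []
        (by simp; omega)
      simp only [List.nil_append] at h3
      rw [hX, hY, List.replicate_succ' (n := o), ← List.append_assoc]
      refine h2.trans (mul_le_mul_of_nonneg_left (h3.trans (le_of_eq ?_)) hΔ)
      simp [List.count_replicate]
    have h3 : X ≤ Γ * Δ * X := by
      calc X ≤ Γ * Y := h1
        _ ≤ Γ * (Δ * X) := mul_le_mul_of_nonneg_left h2 hΓ
        _ = _ := by ring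
    have hX1 : X = 0 := by nlinarith
    refine ⟨hX1, ?_⟩
    rw [hX1] at h2
    linarith
  rcases Nat.eq_zero_or_pos n with hn0 | hn0
  · have : u = [] := List.length_eq_zero_iff.mp (by omega)
    simpa [this] using h0
  have h1 := sort u [] (by simpa using hn)
  simp only [List.nil_append] at h1
  have hlen := List.count_false_add_count_true u
  refine (le_max_right 0 _).trans (h1.trans (le_of_eq ?_))
  rcases Nat.eq_zero_or_pos (u.count false) with hz | hz
  · have := (key 0 (u.count true - 1) (by omega)).2
    rw [hz]
    rwa [Nat.sub_add_cancel (by omega)] at this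
  · have := (key (u.count false - 1) (u.count true) (by omega)).1
    rwa [Nat.sub_add_cancel hz] at this

/-- A subsolution lies below a supersolution as soon as it does so at the empty word. -/
theorem IsSub.le {q Γ A Δ B : ℝ} {f g : List Bool → ℝ} (hf : IsSub q Γ A Δ B f)
    (hg : IsSuper q Γ A Δ B g)
    (hq0 : 0 ≤ q) (hq1 : q ≤ 1) (hΓ : 0 ≤ Γ) (hA : 0 ≤ A) (hΔ : 0 ≤ Δ) (hB : 0 ≤ B)
    (hΓΔ : Γ * Δ < 1) (h0 : f [] ≤ g []) (u : List Bool) : f u ≤ g u := by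
  have : IsSub q Γ A Δ B (fun u => f u - g u) := by
    refine ⟨fun u v => ?_, fun u => ?_, fun u => ?_⟩
    · linarith [hf.bulk u v, hg.bulk u v]
    · linarith [hf.left u, hg.left u]
    · linarith [hf.right u, hg.right u]
  have := this.nonpos hq0 hq1 hΓ hA hΔ hB hΓΔ (by linarith) u
  linarith

/-- Exact solutions of the matrix-ansatz relations. -/
structure IsWeight (q Γ A Δ B : ℝ) (e : List Bool → ℝ) : Prop where
  nil : e [] = 1
  bulk : ∀ u v, e (u ++ true :: false :: v) =
    q * e (u ++ false :: true :: v) + (1 - q) * (e (u ++ true :: v) + e (u ++ false :: v))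
  left : ∀ u, e (false :: u) = Γ * e (true :: u) + A * e u
  right : ∀ u, e (u ++ [true]) = Δ * e (u ++ [false]) + B * e u

lemma IsWeight.isSub {q Γ A Δ B : ℝ} {e : List Bool → ℝ} (h : IsWeight q Γ A Δ B e) :
    IsSub q Γ A Δ B e :=
  ⟨fun u v => (h.bulk u v).le, fun u => (h.left u).le, fun u => (h.right u).le⟩

lemma IsWeight.isSuper {q Γ A Δ B : ℝ} {e : List Bool → ℝ} (h : IsWeight q Γ A Δ B e) :
    IsSuper q Γ A Δ B e :=
  ⟨fun u v => (h.bulk u v).ge, fun u => (h.left u).ge, fun u => (h.right u).ge⟩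

/-- The parameters `(q,a,b,c,d)` in the fan region. -/
structure Par where
  (q a b c d : ℝ)
  hq0 : 0 ≤ q
  hq1 : q < 1
  ha : 0 ≤ a
  hb : 0 ≤ b
  hc : -1 < c
  hc0 : c ≤ 0
  hd : -1 < d
  hd0 : d ≤ 0
  hab : a * b < 1

namespace Par
variable (P : Par)

/-- `γ/α`. -/
def Γ : ℝ := -(P.a * P.c)
/-- `(1-q)/α`. -/
def A : ℝ := (1 + P.a) * (1 + P.c)
/-- `δ/β`. -/
def Δ : ℝ := -(P.b * P.d)
/-- `(1-q)/β`. -/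
def B : ℝ := (1 + P.b) * (1 + P.d)

/-- Parameters after particle-hole and left-right reflection. -/
def swap : Par := ⟨P.q, P.b, P.a, P.d, P.c, P.hq0, P.hq1, P.hb, P.ha, P.hd, P.hd0, P.hc, P.hc0,
  by rw [mul_comm]; exact P.hab⟩
/-- Parameters with trivial right boundary. -/
def leftPar : Par := ⟨P.q, P.a, 0, P.c, 0, P.hq0, P.hq1, P.ha, le_rfl, P.hc, P.hc0, by norm_num,
  le_rfl, by simp⟩

lemma Γ_nonneg : 0 ≤ P.Γ := by unfold Γ; nlinarith [P.ha, P.hc0]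
lemma Δ_nonneg : 0 ≤ P.Δ := by unfold Δ; nlinarith [P.hb, P.hd0]
lemma A_pos : 0 < P.A := mul_pos (by linarith [P.ha]) (by linarith [P.hc])
lemma B_pos : 0 < P.B := mul_pos (by linarith [P.hb]) (by linarith [P.hd])
lemma ΓΔ_lt : P.Γ * P.Δ < 1 := by
  unfold Γ Δ
  have h1 : 0 ≤ P.a * P.b := mul_nonneg P.ha P.hb
  have h2 : P.c * P.d ≤ 1 := by nlinarith [P.hc, P.hc0, P.hd, P.hd0]
  have h3 : 0 ≤ P.c * P.d := mul_nonneg_of_nonpos_of_nonpos P.hc0 P.hd0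
  nlinarith [P.hab]

/-- The matrix `E` acting on sequences. -/
noncomputable def opE (V : ℕ → ℝ) : ℕ → ℝ := fun n =>
  (1 + P.q ^ n * (P.a + P.c)) * V n - P.a * P.c * P.q ^ n * V (n + 1) + (1 - P.q ^ n) * V (n - 1)
/-- The matrix `D` acting on sequences. -/
def opD (V : ℕ → ℝ) : ℕ → ℝ := fun n => V n + V (n + 1)
/-- Action of a letter. -/
noncomputable def letter (x : Bool) (V : ℕ → ℝ) : ℕ → ℝ := if x then opD V else P.opE V
/-- Action of a word. -/
noncomputable def act (u : List Bool) (V : ℕ → ℝ) : ℕ → ℝ := u.foldr P.letter V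

@[simp] lemma act_nil (V : ℕ → ℝ) : P.act [] V = V := rfl
@[simp] lemma act_true (u : List Bool) (V : ℕ → ℝ) : P.act (true :: u) V = opD (P.act u V) := by
  simp [act, letter]
@[simp] lemma act_false (u : List Bool) (V : ℕ → ℝ) :
    P.act (false :: u) V = P.opE (P.act u V) := by
  simp [act, letter]
lemma act_append (u v : List Bool) (V : ℕ → ℝ) : P.act (u ++ v) V = P.act u (P.act v V) := by
  simp [act, List.foldr_append]

lemma act_linear (u : List Bool) (V W : ℕ → ℝ) (r s : ℝ) :
    P.act u (fun n => r * V n + s * W n) = fun n => r * P.act u V n + s * P.act u W n := by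
  induction u with
  | nil => rfl
  | cons x u ih =>
    cases x <;> simp only [act_true, act_false, ih] <;> funext n <;> simp only [opD, opE] <;> ring

lemma opDE (V : ℕ → ℝ) : opD (P.opE V) =
    fun n => P.q * P.opE (opD V) n + (1 - P.q) * (1 * opD V n + 1 * P.opE V n) := by
  funext n
  cases n with
  | zero => simp only [opD, opE]; simp; ring
  | succ n => simp only [opD, opE]; simp; ring

/-- The right boundary vector. -/
noncomputable def bvec : ℕ → ℝ × ℝ
  | 0 => (1, 0)
  | n + 1 => ((P.Δ * ((1 + P.q ^ n * (P.a + P.c)) * (bvec n).1 + (1 - P.q ^ n) * (bvec n).2)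
      + P.B * (bvec n).1 - (bvec n).1) / (1 + P.Δ * (P.a * P.c) * P.q ^ n), (bvec n).1)

/-- The right boundary vector. -/
noncomputable def bv (n : ℕ) : ℝ := (P.bvec n).1

lemma bv_eq : opD P.bv = fun n => P.Δ * P.opE P.bv n + P.B * P.bv n := by
  funext n
  have hden : 0 < 1 + P.Δ * (P.a * P.c) * P.q ^ n := by
    have h1 := P.ΓΔ_lt
    have h2 : P.q ^ n ≤ 1 := pow_le_one₀ P.hq0 P.hq1.le
    have h3 : 0 ≤ P.q ^ n := pow_nonneg P.hq0 n
    have h4 : 0 ≤ P.Γ * P.Δ := mul_nonneg P.Γ_nonneg P.Δ_nonneg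
    have : P.Δ * (P.a * P.c) = -(P.Γ * P.Δ) := by unfold Γ; ring
    rw [this]; nlinarith
  have h1 : (P.bvec (n+1)).1 * (1 + P.Δ * (P.a * P.c) * P.q ^ n) =
      P.Δ * ((1 + P.q ^ n * (P.a + P.c)) * (P.bvec n).1 + (1 - P.q ^ n) * (P.bvec n).2)
      + P.B * (P.bvec n).1 - (P.bvec n).1 := by
    rw [bvec, div_mul_cancel₀ _ hden.ne']
  have h2 : (1 - P.q ^ n) * (P.bvec n).2 = (1 - P.q ^ n) * (P.bvec (n-1)).1 := by
    cases n with
    | zero => simp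
    | succ n => rfl
  rw [h2] at h1
  simp only [opD, opE, bv]
  linear_combination h1

/-- The stationary weight of a word. -/
noncomputable def w (u : List Bool) : ℝ := P.act u P.bv 0

lemma w_isWeight : IsWeight P.q P.Γ P.A P.Δ P.B P.w := by
  refine ⟨?_, fun u v => ?_, fun u => ?_, fun u => ?_⟩
  · simp [w, bv, bvec]
  · simp only [w, act_append, act_true, act_false]
    rw [opDE, act_linear, act_linear]
    ring
  · simp only [w, act_true, act_false, opE, opD, Γ, A]
    simp
    ring
  · simp only [w, act_append, act_true, act_false, act_nil]
    rw [bv_eq, act_linear]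

lemma sub_le_super {f g : List Bool → ℝ} (hf : IsSub P.q P.Γ P.A P.Δ P.B f)
    (hg : IsSuper P.q P.Γ P.A P.Δ P.B g) (h0 : f [] ≤ g []) (u : List Bool) : f u ≤ g u :=
  hf.le hg P.hq0 P.hq1.le P.Γ_nonneg P.A_pos.le P.Δ_nonneg P.B_pos.le P.ΓΔ_lt h0 u

lemma eq_w {f : List Bool → ℝ} (hf : IsWeight P.q P.Γ P.A P.Δ P.B f) (u : List Bool) :
    f u = P.w u :=
  le_antisymm (P.sub_le_super hf.isSub P.w_isWeight.isSuper (by rw [hf.nil, P.w_isWeight.nil]) u)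
    (P.sub_le_super P.w_isWeight.isSub hf.isSuper (by rw [hf.nil, P.w_isWeight.nil]) u)

lemma w_nil : P.w [] = 1 := P.w_isWeight.nil

lemma pow_le_w {ε : ℝ} (h0 : 0 ≤ ε) (h1 : ε ≤ 1) (hA : ε ≤ P.A) (hB : ε ≤ P.B) (u : List Bool) :
    ε ^ u.length ≤ P.w u := by
  refine P.sub_le_super (f := fun u => ε ^ u.length) ⟨fun u v => ?_, fun u => ?_, fun u => ?_⟩
    P.w_isWeight.isSuper (by simp [w_nil]) u
  · simp only [List.length_append, List.length_cons]
    have h2 : (0:ℝ) ≤ ε ^ (u.length + (v.length + 1)) := pow_nonneg h0 _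
    have h3 : ε ^ (u.length + (v.length + 1 + 1)) ≤ ε ^ (u.length + (v.length + 1)) :=
      pow_le_pow_of_le_one h0 h1 (by omega)
    nlinarith [mul_nonneg (sub_nonneg.mpr P.hq1.le) h2, mul_nonneg (sub_nonneg.mpr P.hq1.le) (sub_nonneg.mpr h3)]
  · simp only [List.length_cons, pow_succ]
    have h2 : (0:ℝ) ≤ ε ^ u.length := pow_nonneg h0 _
    nlinarith [mul_nonneg P.Γ_nonneg (mul_nonneg h2 h0)]
  · simp only [List.length_append, List.length_cons, pow_succ, List.length_nil, zero_add]
    have h2 : (0:ℝ) ≤ ε ^ u.length := pow_nonneg h0 _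
    nlinarith [mul_nonneg P.Δ_nonneg (mul_nonneg h2 h0)]

lemma exists_eps : ∃ ε : ℝ, 0 < ε ∧ ε ≤ 1 ∧ ∀ u, ε ^ u.length ≤ P.w u := by
  refine ⟨min 1 (min P.A P.B), lt_min one_pos (lt_min P.A_pos P.B_pos), min_le_left _ _, ?_⟩
  exact P.pow_le_w (le_min zero_le_one (le_min P.A_pos.le P.B_pos.le)) (min_le_left _ _)
    ((min_le_right _ _).trans (min_le_left _ _)) ((min_le_right _ _).trans (min_le_right _ _))

lemma w_pos (u : List Bool) : 0 < P.w u := by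
  obtain ⟨ε, h0, -, h⟩ := P.exists_eps
  exact (pow_pos h0 _).trans_le (h u)

/-- Reverse-complement of a word. -/
def rc (u : List Bool) : List Bool := (u.map (!·)).reverse

@[simp] lemma rc_nil : rc [] = [] := rfl
@[simp] lemma rc_append (u v : List Bool) : rc (u ++ v) = rc v ++ rc u := by simp [rc]
@[simp] lemma rc_cons (x : Bool) (v : List Bool) : rc (x :: v) = rc v ++ [!x] := by simp [rc]
@[simp] lemma rc_rc (u : List Bool) : rc (rc u) = u := by
  induction u with
  | nil => rfl
  | cons x u ih => simp [ih]
@[simp] lemma rc_length (u : List Bool) : (rc u).length = u.length := by simp [rc]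
lemma rc_count (u : List Bool) (x : Bool) : (rc u).count x = u.count (!x) := by
  induction u with
  | nil => rfl
  | cons y u ih => cases x <;> cases y <;> simp [ih]

/-- Particle-hole symmetry. -/
lemma w_swap (u : List Bool) : P.swap.w (rc u) = P.w u := by
  refine P.eq_w (f := fun u => P.swap.w (rc u)) ⟨?_, fun u v => ?_, fun u => ?_, fun u => ?_⟩ u
  · exact P.swap.w_nil
  · have := P.swap.w_isWeight.bulk (rc v) (rc u)
    simp only [rc_append, rc_cons, Bool.not_true, Bool.not_false, List.append_assoc,
      List.cons_append, List.nil_append]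
    have hq : P.swap.q = P.q := rfl
    rw [hq] at this
    linarith
  · have := P.swap.w_isWeight.right (rc u)
    simpa [swap, Γ, Δ, A, B] using this
  · have := P.swap.w_isWeight.left (rc u)
    simpa [swap, Γ, Δ, A, B] using this

end Par

end OpenASEP

namespace OpenASEP

open Finset

section Generator
variable {N : ℕ} {α β γ δ q : ℝ}

lemma asepJump_self (τ : Fin N → Bool) : asepJump N α β γ δ q τ τ = 0 := by
  have h1 : ∀ (i : Fin N) (x : Bool), τ i = !x → τ ≠ Function.update τ i x := by
    intro i x h h'
    have := congrFun h' i
    rw [h] at this; simp at this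
  have h2 : ∀ (i j : Fin N) (x y : Bool), τ j = !y →
      τ ≠ Function.update (Function.update τ i x) j y := by
    intro i j x y h h'
    have := congrFun h' j
    rw [h] at this; simp at this
  unfold asepJump
  have e1 : ∀ i j : Fin N, ¬ ((j : ℕ) = (i : ℕ) + 1 ∧ τ i = true ∧ τ j = false ∧
        τ = Function.update (Function.update τ i false) j true) :=
    fun i j h => h2 i j false true (by simpa using h.2.2.1) h.2.2.2
  have e2 : ∀ i j : Fin N, ¬ ((j : ℕ) = (i : ℕ) + 1 ∧ τ i = false ∧ τ j = true ∧
        τ = Function.update (Function.update τ i true) j false) :=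
    fun i j h => h2 i j true false (by simpa using h.2.2.1) h.2.2.2
  have e3 : ∀ (k : ℕ) (i : Fin N), ¬ ((i : ℕ) = k ∧ τ i = false ∧ τ = Function.update τ i true) :=
    fun k i h => h1 i true (by simpa using h.2.1) h.2.2
  have e4 : ∀ (k : ℕ) (i : Fin N), ¬ ((i : ℕ) = k ∧ τ i = true ∧ τ = Function.update τ i false) :=
    fun k i h => h1 i false (by simpa using h.2.1) h.2.2
  simp only [e1, e2, e3, e4, if_false, Finset.sum_const_zero, mul_zero, add_zero]

lemma stationary_iff (μ : (Fin N → Bool) → ℝ) :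
    IsStationaryASEP N α β γ δ q μ ↔ ∀ τ', ∑ τ, μ τ * asepJump N α β γ δ q τ τ' =
      μ τ' * ∑ σ, asepJump N α β γ δ q τ' σ := by
  unfold IsStationaryASEP
  refine forall_congr' fun τ' => ?_
  have h1 : ∀ τ, μ τ * asepGen N α β γ δ q τ τ' = μ τ * asepJump N α β γ δ q τ τ' -
      if τ = τ' then μ τ' * ∑ σ, asepJump N α β γ δ q τ' σ else 0 := by
    intro τ
    unfold asepGen
    by_cases h : τ' = τ
    · subst h
      have : ∑ σ, asepJump N α β γ δ q τ' σ =
          ∑ σ ∈ Finset.univ.filter (fun σ => σ ≠ τ'), asepJump N α β γ δ q τ' σ := by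
        rw [Finset.sum_filter]
        refine Finset.sum_congr rfl fun σ _ => ?_
        by_cases h : σ = τ'
        · simp [h, asepJump_self]
        · simp [h]
      simp only [if_true, asepJump_self, this]
      ring
    · simp [h, Ne.symm h]
  simp only [h1, Finset.sum_sub_distrib, Finset.sum_ite_eq', Finset.mem_univ, if_true]
  exact sub_eq_zero

lemma asepJump_nonneg (hα : 0 ≤ α) (hβ : 0 ≤ β) (hγ : 0 ≤ γ) (hδ : 0 ≤ δ) (hq : 0 ≤ q)
    (τ τ' : Fin N → Bool) : 0 ≤ asepJump N α β γ δ q τ τ' := by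
  have h : ∀ p : Prop, (0:ℝ) ≤ if p then 1 else 0 := fun p => by split_ifs <;> norm_num
  unfold asepJump
  have h1 : ∀ f : Fin N → ℝ, (∀ i, 0 ≤ f i) → 0 ≤ ∑ i, f i := fun f hf =>
    Finset.sum_nonneg fun i _ => hf i
  refine add_nonneg (add_nonneg (add_nonneg (add_nonneg (add_nonneg ?_ ?_) ?_) ?_) ?_) ?_
  · exact h1 _ fun i => h1 _ fun j => by split_ifs <;> norm_num
  · exact mul_nonneg hq (h1 _ fun i => h1 _ fun j => by split_ifs <;> norm_num)
  · exact mul_nonneg hα (h1 _ fun i => by split_ifs <;> norm_num)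
  · exact mul_nonneg hγ (h1 _ fun i => by split_ifs <;> norm_num)
  · exact mul_nonneg hδ (h1 _ fun i => by split_ifs <;> norm_num)
  · exact mul_nonneg hβ (h1 _ fun i => by split_ifs <;> norm_num)

lemma update_inj₁ {τ τ' : Fin N → Bool} {i : Fin N} {x : Bool} :
    (τ i = !x ∧ τ' = Function.update τ i x) ↔
      (τ' i = x ∧ τ = Function.update τ' i (!x)) := by
  constructor
  · rintro ⟨h, rfl⟩
    exact ⟨by simp, by rw [Function.update_idem, ← h, Function.update_eq_self]⟩
  · rintro ⟨h, rfl⟩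
    exact ⟨by simp, by rw [Function.update_idem, ← h, Function.update_eq_self]⟩

lemma update_inj₂ {τ τ' : Fin N → Bool} {i j : Fin N} {x : Bool} (hij : i ≠ j) :
    (τ i = !x ∧ τ j = x ∧ τ' = Function.update (Function.update τ i x) j (!x)) ↔
      (τ' i = x ∧ τ' j = !x ∧ τ = Function.update (Function.update τ' i (!x)) j x) := by
  have key : ∀ (σ : Fin N → Bool) (x y z t : Bool), Function.update (Function.update
    (Function.update (Function.update σ i x) j y) i z) j t =
      Function.update (Function.update σ i z) j t := by
    intro σ x y z t
    rw [Function.update_comm hij.symm, Function.update_idem, Function.update_idem]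
  have key2 : ∀ (σ : Fin N → Bool), Function.update (Function.update σ i (σ i)) j (σ j) = σ := by
    intro σ; simp
  constructor
  · rintro ⟨h1, h2, rfl⟩
    refine ⟨by simp [hij], by simp, ?_⟩
    rw [key, ← h1]
    conv_rhs => rw [← h2]
    exact (key2 τ).symm
  · rintro ⟨h1, h2, rfl⟩
    refine ⟨by simp [hij], by simp, ?_⟩
    rw [key, ← h2]
    conv_rhs => rw [← h1]
    exact (key2 τ').symm

lemma sum_single₁ (W : (Fin N → Bool) → ℝ) (τ' : Fin N → Bool) (k : ℕ) (i : Fin N) (x y : Bool)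
    (hy : y = !x) :
    ∑ τ, W τ * (if (i : ℕ) = k ∧ τ i = y ∧ τ' = Function.update τ i x then (1:ℝ) else 0) =
      if (i : ℕ) = k then (if τ' i = x then W (Function.update τ' i y) else 0) else 0 := by
  subst hy
  have h : ∀ τ, W τ * (if (i : ℕ) = k ∧ τ i = (!x) ∧ τ' = Function.update τ i x then (1:ℝ) else 0) =
      if τ = Function.update τ' i (!x) then
        (if (i : ℕ) = k then (if τ' i = x then W (Function.update τ' i (!x)) else 0) else 0)
        else 0 := by
    intro τ
    simp only [update_inj₁]
    by_cases h : τ = Function.update τ' i (!x)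
    · by_cases h2 : (i : ℕ) = k
      · by_cases h3 : τ' i = x <;> simp [h, h2, h3]
      · simp [h2]
    · simp [h]
  simp only [h, Finset.sum_ite_eq', Finset.mem_univ, if_true]

lemma sum_single₂ (W : (Fin N → Bool) → ℝ) (τ' : Fin N → Bool) (i j : Fin N) (x y : Bool)
    (hy : y = !x) :
    ∑ τ, W τ * (if (j : ℕ) = (i : ℕ) + 1 ∧ τ i = y ∧ τ j = x ∧
        τ' = Function.update (Function.update τ i x) j y then (1:ℝ) else 0) =
      if (j : ℕ) = (i : ℕ) + 1 then (if τ' i = x ∧ τ' j = y then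
        W (Function.update (Function.update τ' i y) j x) else 0) else 0 := by
  subst hy
  by_cases hij : (j : ℕ) = (i : ℕ) + 1
  · have hne : i ≠ j := fun h => by rw [h] at hij; omega
    have h : ∀ τ, W τ * (if (j : ℕ) = (i : ℕ) + 1 ∧ τ i = (!x) ∧ τ j = x ∧
        τ' = Function.update (Function.update τ i x) j (!x) then (1:ℝ) else 0) =
      if τ = Function.update (Function.update τ' i (!x)) j x then
        (if τ' i = x ∧ τ' j = (!x) then
          W (Function.update (Function.update τ' i (!x)) j x) else 0) else 0 := by
      intro τ
      simp only [update_inj₂ hne]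
      by_cases h : τ = Function.update (Function.update τ' i (!x)) j x
      · by_cases h3 : τ' i = x ∧ τ' j = (!x)
        · simp [h, h3, hij]
        · simp [h3]; tauto
      · simp [h]
    simp only [h, Finset.sum_ite_eq', Finset.mem_univ, if_true]
    rw [if_pos hij]
  · simp [hij]

lemma inflow (W : (Fin N → Bool) → ℝ) (τ' : Fin N → Bool) :
    ∑ τ, W τ * asepJump N α β γ δ q τ τ' =
      (∑ i : Fin N, ∑ j : Fin N, if (j : ℕ) = (i : ℕ) + 1 then (if τ' i = false ∧ τ' j = true then
        W (Function.update (Function.update τ' i true) j false) else 0) else 0) +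
      q * (∑ i : Fin N, ∑ j : Fin N, if (j : ℕ) = (i : ℕ) + 1 then
        (if τ' i = true ∧ τ' j = false then
        W (Function.update (Function.update τ' i false) j true) else 0) else 0) +
      α * (∑ i : Fin N, if (i : ℕ) = 0 then
        (if τ' i = true then W (Function.update τ' i false) else 0) else 0) +
      γ * (∑ i : Fin N, if (i : ℕ) = 0 then
        (if τ' i = false then W (Function.update τ' i true) else 0) else 0) +
      δ * (∑ i : Fin N, if (i : ℕ) = N - 1 then
        (if τ' i = true then W (Function.update τ' i false) else 0) else 0) +
      β * (∑ i : Fin N, if (i : ℕ) = N - 1 then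
        (if τ' i = false then W (Function.update τ' i true) else 0) else 0) := by
  have h1 := fun k i => sum_single₁ W τ' k i true false rfl
  have h2 := fun k i => sum_single₁ W τ' k i false true rfl
  have h3 := fun i j => sum_single₂ W τ' i j false true rfl
  have h4 := fun i j => sum_single₂ W τ' i j true false rfl
  simp only [← h1, ← h2, ← h3, ← h4]
  unfold asepJump
  have c1 : ∀ f : Fin N → (Fin N → Bool) → ℝ, ∑ i, ∑ τ, W τ * f i τ = ∑ τ, W τ * ∑ i, f i τ := by
    intro f; rw [Finset.sum_comm]; simp only [Finset.mul_sum]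
  simp only [c1]
  rw [Finset.mul_sum, Finset.mul_sum, Finset.mul_sum, Finset.mul_sum, Finset.mul_sum,
    ← Finset.sum_add_distrib, ← Finset.sum_add_distrib, ← Finset.sum_add_distrib,
    ← Finset.sum_add_distrib, ← Finset.sum_add_distrib]
  refine Finset.sum_congr rfl fun τ _ => ?_
  ring

lemma outflow (τ' : Fin N → Bool) :
    ∑ σ, asepJump N α β γ δ q τ' σ =
      (∑ i : Fin N, ∑ j : Fin N, if (j : ℕ) = (i : ℕ) + 1 then
        (if τ' i = true ∧ τ' j = false then 1 else 0) else 0) +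
      q * (∑ i : Fin N, ∑ j : Fin N, if (j : ℕ) = (i : ℕ) + 1 then
        (if τ' i = false ∧ τ' j = true then 1 else 0) else 0) +
      α * (∑ i : Fin N, if (i : ℕ) = 0 then (if τ' i = false then 1 else 0) else 0) +
      γ * (∑ i : Fin N, if (i : ℕ) = 0 then (if τ' i = true then 1 else 0) else 0) +
      δ * (∑ i : Fin N, if (i : ℕ) = N - 1 then (if τ' i = false then 1 else 0) else 0) +
      β * (∑ i : Fin N, if (i : ℕ) = N - 1 then (if τ' i = true then 1 else 0) else 0) := by
  have h : ∀ (p q' : Prop) [Decidable p] [Decidable q'] (y : Fin N → Bool), ∑ σ : Fin N → Bool,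
      (if p ∧ q' ∧ σ = y then (1:ℝ) else 0) = if p then (if q' then 1 else 0) else 0 := by
    intro p q' _ _ y
    by_cases hp : p <;> by_cases hq : q' <;> simp [hp, hq]
  unfold asepJump
  have c1 : ∀ f : Fin N → (Fin N → Bool) → ℝ, ∑ τ, ∑ i, f i τ = ∑ i, ∑ τ, f i τ :=
    fun f => Finset.sum_comm
  simp only [Finset.sum_add_distrib, ← Finset.mul_sum, c1]
  have h' : ∀ (p q' r : Prop) [Decidable p] [Decidable q'] [Decidable r] (y : Fin N → Bool), ∑ σ : Fin N → Bool,
      (if p ∧ q' ∧ r ∧ σ = y then (1:ℝ) else 0) = if p then (if q' ∧ r then 1 else 0) else 0 := by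
    intro p q' r _ _ _ y
    by_cases hp : p <;> by_cases hq : q' <;> by_cases hr : r <;> simp [hp, hq, hr]
  simp only [h, h']

lemma ofFn_update (τ : Fin N → Bool) (i : Fin N) (x : Bool) :
    List.ofFn (Function.update τ i x) = (List.ofFn τ).set i x := by
  apply List.ext_getElem
  · simp
  · intro k h1 h2
    simp only [List.getElem_ofFn, List.getElem_set]
    by_cases hk : (i : ℕ) = k
    · have : (⟨k, by simpa using h1⟩ : Fin N) = i := Fin.ext hk.symm
      simp [this, hk]
    · have : (⟨k, by simpa using h1⟩ : Fin N) ≠ i := fun h => hk (by rw [← h])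
      simp [this, hk]

lemma split_one (l : List Bool) (i : ℕ) (hi : i < l.length) :
    ∃ u v, l = u ++ l[i] :: v ∧ u.length = i :=
  ⟨l.take i, l.drop (i+1), by simp, by simp; omega⟩

lemma split_two (l : List Bool) (i : ℕ) (hi : i + 1 < l.length) :
    ∃ u v, l = u ++ l[i] :: l[i+1] :: v ∧ u.length = i :=
  ⟨l.take i, l.drop (i+2), by
    rw [List.cons_getElem_drop_succ, List.cons_getElem_drop_succ, List.take_append_drop],
    by simp; omega⟩

lemma telescope (F : ℕ → ℝ) (m : ℕ) :
    ∑ i : Fin (m+1), ∑ j : Fin (m+1), (if (j : ℕ) = (i : ℕ) + 1 then F i - F j else 0) =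
      F 0 - F m := by
  have h1 : ∀ i : Fin (m+1),
      ∑ j : Fin (m+1), (if (j : ℕ) = (i : ℕ) + 1 then F i - F j else 0) =
      if (i : ℕ) < m then F i - F (i+1) else 0 := by
    intro i
    rw [Fin.sum_univ_eq_sum_range (fun j => if j = (i : ℕ) + 1 then F i - F j else 0)]
    rw [Finset.sum_ite_eq']
    simp
  simp only [h1]
  rw [Fin.sum_univ_eq_sum_range (fun i => if i < m then F i - F (i+1) else 0),
    Finset.sum_range_succ]
  simp only [lt_irrefl, if_false, add_zero]
  rw [← Finset.sum_range_sub' F m]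
  exact Finset.sum_congr rfl fun i hi => by simp [Finset.mem_range.mp hi]

end Generator

/-- Word weight as a function of the configuration. -/
noncomputable def Par.W (P : Par) (N : ℕ) (τ : Fin N → Bool) : ℝ := P.w (List.ofFn τ)

lemma Par.W_stationary (P : Par) {α β γ δ : ℝ} (hΓ : γ = α * P.Γ) (hA : 1 - P.q = α * P.A)
    (hΔ : δ = β * P.Δ) (hB : 1 - P.q = β * P.B) (m : ℕ) :
    IsStationaryASEP (m+1) α β γ δ P.q (P.W (m+1)) := by
  rw [stationary_iff]
  intro τ
  rw [inflow, outflow]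
  set l := List.ofFn τ with hl
  have hlen : l.length = m + 1 := by simp [hl]
  set F : ℕ → ℝ := fun k => (if l[k]? = some true then -1 else 1) * P.w (l.eraseIdx k) with hF
  have hget : ∀ i : Fin (m+1), l[(i:ℕ)]'(by rw [hlen]; exact i.2) = τ i := by
    intro i; simp only [hl, List.getElem_ofFn]
  have hget? : ∀ i : Fin (m+1), l[(i:ℕ)]? = some (τ i) := by
    intro i; rw [← hget i]; exact List.getElem?_eq_getElem _
  have hbond : ∀ i j : Fin (m+1), (j : ℕ) = (i : ℕ) + 1 →
      (if τ i = false ∧ τ j = true then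
        P.W (m+1) (Function.update (Function.update τ i true) j false) else 0) +
      P.q * (if τ i = true ∧ τ j = false then
        P.W (m+1) (Function.update (Function.update τ i false) j true) else 0) -
      P.W (m+1) τ * (if τ i = true ∧ τ j = false then 1 else 0) -
      P.W (m+1) τ * P.q * (if τ i = false ∧ τ j = true then 1 else 0) =
      (1 - P.q) * (F i - F j) := by
    intro i j hij
    obtain ⟨u, v, huv, hu⟩ := split_two l i (by rw [hlen, ← hij]; exact j.2)
    have hj : l[(i:ℕ)+1]'(by rw [hlen, ← hij]; exact j.2) = τ j := by
      rw [← hget j]; congr 1; exact hij.symm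
    rw [hget i, hj] at huv
    have e1 : ∀ x y, (l.set i x).set j y = u ++ x :: y :: v := by
      intro x y; rw [huv, hij, ← hu]; simp
    have e2 : l.eraseIdx i = u ++ τ j :: v := by
      conv_lhs => rw [huv]
      rw [← hu]; simp [List.eraseIdx_append_of_length_le]
    have e3 : l.eraseIdx j = u ++ τ i :: v := by
      conv_lhs => rw [huv]
      rw [hij, ← hu]; simp [List.eraseIdx_append_of_length_le]
    simp only [hF, hget?, e2, e3, Par.W, ofFn_update, ← hl, e1]
    rw [huv]
    have := P.w_isWeight.bulk u v
    cases τ i <;> cases τ j <;> simp <;> linarith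
  have hleft : ∀ i : Fin (m+1), (i : ℕ) = 0 →
      α * (if τ i = true then P.W (m+1) (Function.update τ i false) else 0) +
      γ * (if τ i = false then P.W (m+1) (Function.update τ i true) else 0) -
      P.W (m+1) τ * α * (if τ i = false then 1 else 0) -
      P.W (m+1) τ * γ * (if τ i = true then 1 else 0) = - (1 - P.q) * F 0 := by
    intro i hi
    obtain ⟨u, v, huv, hu⟩ := split_one l i (by rw [hlen]; exact i.2)
    rw [hget i] at huv
    have hu0 : u = [] := List.length_eq_zero_iff.mp (by omega)
    subst hu0
    rw [List.nil_append] at huv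
    have h2 := hget? i
    rw [hi] at h2
    simp only [hF, Par.W, ofFn_update, ← hl, hi, h2]
    rw [huv]
    have := P.w_isWeight.left v
    rw [hA, hΓ]
    cases τ i <;> simp <;> first | linear_combination α * this | linear_combination -α * this
  have hright : ∀ i : Fin (m+1), (i : ℕ) = m →
      δ * (if τ i = true then P.W (m+1) (Function.update τ i false) else 0) +
      β * (if τ i = false then P.W (m+1) (Function.update τ i true) else 0) -
      P.W (m+1) τ * δ * (if τ i = false then 1 else 0) -
      P.W (m+1) τ * β * (if τ i = true then 1 else 0) = (1 - P.q) * F m := by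
    intro i hi
    obtain ⟨u, v, huv, hu⟩ := split_one l i (by rw [hlen]; exact i.2)
    rw [hget i] at huv
    have hv0 : v = [] := by
      have := congrArg List.length huv
      simp [hlen] at this
      exact List.length_eq_zero_iff.mp (by omega)
    subst hv0
    have h2 := hget? i
    rw [hi] at h2 hu
    have e1 : ∀ x, l.set m x = u ++ [x] := by
      intro x; rw [huv, ← hu]; simp
    have e2 : l.eraseIdx m = u := by
      rw [huv, ← hu]; simp [List.eraseIdx_append_of_length_le]
    simp only [hF, Par.W, ofFn_update, ← hl, hi, h2, e1, e2]
    rw [huv]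
    have := P.w_isWeight.right u
    rw [hB, hΔ]
    cases τ i <;> simp <;> first | linear_combination β * this | linear_combination -β * this
  have hb : ∑ i : Fin (m+1), ∑ j : Fin (m+1), (if (j : ℕ) = (i : ℕ) + 1 then
      ((if τ i = false ∧ τ j = true then
        P.W (m+1) (Function.update (Function.update τ i true) j false) else 0) +
      P.q * (if τ i = true ∧ τ j = false then
        P.W (m+1) (Function.update (Function.update τ i false) j true) else 0) -
      P.W (m+1) τ * (if τ i = true ∧ τ j = false then 1 else 0) -
      P.W (m+1) τ * P.q * (if τ i = false ∧ τ j = true then 1 else 0)) else 0) =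
      (1 - P.q) * (F 0 - F m) := by
    rw [← telescope F m, Finset.mul_sum]
    refine Finset.sum_congr rfl fun i _ => ?_
    rw [Finset.mul_sum]
    refine Finset.sum_congr rfl fun j _ => ?_
    by_cases h : (j : ℕ) = (i : ℕ) + 1
    · rw [if_pos h, if_pos h]; exact hbond i j h
    · rw [if_neg h, if_neg h, mul_zero]
  have hs : ∀ (G : Fin (m+1) → ℝ) (k : Fin (m+1)),
      ∑ i : Fin (m+1), (if (i : ℕ) = k then G i else 0) = G k := by
    intro G k
    simp [← Fin.ext_iff]
  have hs0 : ∀ (G : Fin (m+1) → ℝ), ∑ i : Fin (m+1), (if (i : ℕ) = 0 then G i else 0) = G 0 :=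
    fun G => hs G 0
  have hsm : ∀ (G : Fin (m+1) → ℝ), ∑ i : Fin (m+1), (if (i : ℕ) = m then G i else 0) =
      G (Fin.last m) := fun G => hs G (Fin.last m)
  have hite : ∀ (p : Prop) [Decidable p] (x y : ℝ), (if p then x + y else 0) =
      (if p then x else 0) + (if p then y else 0) := fun p _ x y => by split_ifs <;> simp
  have hite' : ∀ (p : Prop) [Decidable p] (x y : ℝ), (if p then x - y else 0) =
      (if p then x else 0) - (if p then y else 0) := fun p _ x y => by split_ifs <;> simp
  have hite'' : ∀ (p : Prop) [Decidable p] (x y : ℝ), (if p then x * y else 0) =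
      x * (if p then y else 0) := fun p _ x y => by split_ifs <;> simp
  simp only [hite, hite', hite'', Finset.sum_add_distrib, Finset.sum_sub_distrib,
    ← Finset.mul_sum] at hb
  have h1 := hleft 0 rfl
  have h2 := hright (Fin.last m) rfl
  simp only [hs0, hsm, Nat.add_sub_cancel] 
  linear_combination hb + h1 + h2

/-- A set of words of a fixed length closed under predecessors of the dynamics is everything. -/
lemma predecessor_closed {Z : List Bool → Prop}
    (hbulk : ∀ u v, Z (u ++ false :: true :: v) → Z (u ++ true :: false :: v))
    (hleft : ∀ v, Z (true :: v) → Z (false :: v))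
    (hright : ∀ u, Z (u ++ [false]) → Z (u ++ [true]))
    {x y : List Bool} (hx : Z x) (hxy : x.length = y.length) : Z y := by
  have M : ∀ k v, Z (List.replicate k false ++ true :: v) →
      Z (List.replicate (k+1) false ++ v) := by
    intro k
    induction k with
    | zero => intro v h; exact hleft v h
    | succ k ih =>
      intro v h
      rw [List.replicate_succ', List.append_assoc] at h
      have := ih _ (hbulk _ _ h)
      rw [List.replicate_succ', List.append_assoc]
      exact this
  have C : ∀ v k, Z (List.replicate k false ++ v) → Z (List.replicate (k + v.length) false) := by
    intro v
    induction v with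
    | nil => intro k h; simpa using h
    | cons x v ih =>
      intro k h
      have : Z (List.replicate (k+1) false ++ v) := by
        cases x with
        | true => exact M k v h
        | false => rw [List.replicate_succ', List.append_assoc]; exact h
      have := ih _ this
      rw [List.length_cons]
      convert this using 2
      omega
  have M' : ∀ k u, Z (u ++ false :: List.replicate k false) →
      Z (u ++ true :: List.replicate k false) := by
    intro k
    induction k with
    | zero => intro u h; exact hright u h
    | succ k ih =>
      intro u h
      have h1 := ih (u ++ [false]) (by simpa [List.replicate_succ] using h)
      exact hbulk _ _ (by simpa using h1)
  have C' : ∀ v u, Z (u ++ List.replicate v.length false) → Z (u ++ v) := by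
    intro v
    induction v with
    | nil => intro u h; simpa using h
    | cons x v ih =>
      intro u h
      rw [List.length_cons, List.replicate_succ] at h
      have := ih (u ++ [x]) (by
        cases x with
        | true => simpa using M' _ _ h
        | false => simpa using h)
      simpa using this
  have h0 := C x 0 (by simpa using hx)
  have := C' y [] (by simpa [hxy] using h0)
  simpa using this

lemma zero_of_stationary {m : ℕ} {α β γ δ q : ℝ}
    (hα : 0 < α) (hβ : 0 < β) (hγ : 0 ≤ γ) (hδ : 0 ≤ δ) (hq0 : 0 ≤ q)
    {ν : (Fin (m+1) → Bool) → ℝ} (hν : ∀ τ, 0 ≤ ν τ)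
    (hs : IsStationaryASEP (m+1) α β γ δ q ν) {τ₀ : Fin (m+1) → Bool} (h0 : ν τ₀ = 0)
    (τ : Fin (m+1) → Bool) : ν τ = 0 := by
  rw [stationary_iff] at hs
  have hJ := asepJump_nonneg (N := m+1) hα.le hβ.le hγ hδ hq0
  have pred : ∀ σ σ', ν σ' = 0 → 0 < asepJump (m+1) α β γ δ q σ σ' → ν σ = 0 := by
    intro σ σ' h1 h2
    have h3 := hs σ'
    rw [h1, zero_mul, Finset.sum_eq_zero_iff_of_nonneg
      (fun τ _ => mul_nonneg (hν τ) (hJ τ σ'))] at h3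
    exact (mul_eq_zero.mp (h3 σ (Finset.mem_univ _))).resolve_right h2.ne'
  have inj : ∀ {σ σ' : Fin (m+1) → Bool}, List.ofFn σ = List.ofFn σ' → σ = σ' :=
    fun h => List.ofFn_injective h
  have pos1 : ∀ f : Fin (m+1) → ℝ, (∀ i, 0 ≤ f i) → ∀ i, 0 < f i → 0 < ∑ i, f i :=
    fun f hf i hi => Finset.sum_pos' (fun i _ => hf i) ⟨i, Finset.mem_univ _, hi⟩
  have pos0 : ∀ f : Fin (m+1) → ℝ, (∀ i, 0 ≤ f i) → 0 ≤ ∑ i, f i :=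
    fun f hf => Finset.sum_nonneg fun i _ => hf i
  have key := predecessor_closed (Z := fun l => ∃ σ, List.ofFn σ = l ∧ ν σ = 0) ?_ ?_ ?_
    (x := List.ofFn τ₀) (y := List.ofFn τ) ⟨τ₀, rfl, h0⟩ (by simp)
  · obtain ⟨σ, h1, h2⟩ := key
    rwa [← inj h1]
  · rintro u v ⟨σ', h1, h2⟩
    have hlen : u.length + 1 < m + 1 := by
      have := congrArg List.length h1
      simp at this; omega
    set i : Fin (m+1) := ⟨u.length, by omega⟩
    set j : Fin (m+1) := ⟨u.length + 1, by omega⟩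
    have hi : σ' i = false := by
      have : (List.ofFn σ')[u.length]? = some false := by rw [h1]; simp
      rw [List.getElem?_ofFn, dif_pos (by omega)] at this
      exact Option.some_injective _ this
    have hj : σ' j = true := by
      have : (List.ofFn σ')[u.length + 1]? = some true := by rw [h1]; simp
      rw [List.getElem?_ofFn, dif_pos (by omega)] at this
      exact Option.some_injective _ this
    refine ⟨Function.update (Function.update σ' i true) j false, ?_, pred _ σ' h2 ?_⟩
    · rw [ofFn_update, ofFn_update, h1]; simp [i, j]
    · have hne : i ≠ j := fun h => by simp [i, j] at h
      have := (update_inj₂ (τ := Function.update (Function.update σ' i true) j false) (τ' := σ')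
        (x := false) hne).mpr ⟨hi, hj, rfl⟩
      unfold asepJump
      refine add_pos_of_pos_of_nonneg (add_pos_of_pos_of_nonneg (add_pos_of_pos_of_nonneg
        (add_pos_of_pos_of_nonneg (add_pos_of_pos_of_nonneg ?_ ?_) ?_) ?_) ?_) ?_
      · refine pos1 _ (fun i => pos0 _ fun j => by split_ifs <;> norm_num) i
          (pos1 _ (fun j => by split_ifs <;> norm_num) j ?_)
        rw [if_pos ⟨rfl, this.1, this.2.1, this.2.2⟩]
        norm_num
      · exact mul_nonneg hq0 (pos0 _ fun i => pos0 _ fun j => by split_ifs <;> norm_num)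
      · exact mul_nonneg hα.le (pos0 _ fun i => by split_ifs <;> norm_num)
      · exact mul_nonneg hγ (pos0 _ fun i => by split_ifs <;> norm_num)
      · exact mul_nonneg hδ (pos0 _ fun i => by split_ifs <;> norm_num)
      · exact mul_nonneg hβ.le (pos0 _ fun i => by split_ifs <;> norm_num)
  · rintro v ⟨σ', h1, h2⟩
    have hi : σ' 0 = true := by
      have : (List.ofFn σ')[0]? = some true := by rw [h1]; simp
      rw [List.getElem?_ofFn, dif_pos (by omega)] at this
      exact Option.some_injective _ this
    refine ⟨Function.update σ' 0 false, ?_, pred _ σ' h2 ?_⟩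
    · rw [ofFn_update, h1]; simp
    · have := (update_inj₁ (τ := Function.update σ' 0 false) (τ' := σ')
        (x := true)).mpr ⟨hi, rfl⟩
      unfold asepJump
      refine add_pos_of_pos_of_nonneg (add_pos_of_pos_of_nonneg (add_pos_of_pos_of_nonneg
        (add_pos_of_nonneg_of_pos (add_nonneg ?_ ?_) ?_) ?_) ?_) ?_
      · exact pos0 _ fun i => pos0 _ fun j => by split_ifs <;> norm_num
      · exact mul_nonneg hq0 (pos0 _ fun i => pos0 _ fun j => by split_ifs <;> norm_num)
      · refine mul_pos hα (pos1 _ (fun i => by split_ifs <;> norm_num) 0 ?_)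
        rw [if_pos ⟨rfl, this.1, this.2⟩]
        norm_num
      · exact mul_nonneg hγ (pos0 _ fun i => by split_ifs <;> norm_num)
      · exact mul_nonneg hδ (pos0 _ fun i => by split_ifs <;> norm_num)
      · exact mul_nonneg hβ.le (pos0 _ fun i => by split_ifs <;> norm_num)
  · rintro u ⟨σ', h1, h2⟩
    have hlen : u.length = m := by
      have := congrArg List.length h1
      simp at this; omega
    have hi : σ' (Fin.last m) = false := by
      have : (List.ofFn σ')[u.length]? = some false := by rw [h1]; simp
      rw [List.getElem?_ofFn, dif_pos (by omega)] at this
      have h4 : (⟨u.length, by omega⟩ : Fin (m+1)) = Fin.last m := Fin.ext hlen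
      rw [← h4]
      exact Option.some_injective _ this
    refine ⟨Function.update σ' (Fin.last m) true, ?_, pred _ σ' h2 ?_⟩
    · rw [ofFn_update, h1]; simp [← hlen]
    · have := (update_inj₁ (τ := Function.update σ' (Fin.last m) true) (τ' := σ')
        (x := false)).mpr ⟨hi, rfl⟩
      unfold asepJump
      refine add_pos_of_nonneg_of_pos (add_nonneg (add_nonneg
        (add_nonneg (add_nonneg ?_ ?_) ?_) ?_) ?_) ?_
      · exact pos0 _ fun i => pos0 _ fun j => by split_ifs <;> norm_num
      · exact mul_nonneg hq0 (pos0 _ fun i => pos0 _ fun j => by split_ifs <;> norm_num)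
      · exact mul_nonneg hα.le (pos0 _ fun i => by split_ifs <;> norm_num)
      · exact mul_nonneg hγ (pos0 _ fun i => by split_ifs <;> norm_num)
      · exact mul_nonneg hδ (pos0 _ fun i => by split_ifs <;> norm_num)
      · refine mul_pos hβ (pos1 _ (fun i => by split_ifs <;> norm_num) (Fin.last m) ?_)
        rw [if_pos ⟨by simp, this.1, this.2⟩]
        norm_num

/-- The stationary measure is the normalized word weight. -/
theorem Par.stationary_eq (P : Par) {α β γ δ : ℝ}
    (hα : 0 < α) (hβ : 0 < β) (hγ : 0 ≤ γ) (hδ : 0 ≤ δ)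
    (hΓ : γ = α * P.Γ) (hA : 1 - P.q = α * P.A)
    (hΔ : δ = β * P.Δ) (hB : 1 - P.q = β * P.B) (m : ℕ) {μ : (Fin (m+1) → Bool) → ℝ}
    (hμ1 : ∑ τ, μ τ = 1)
    (hμ : IsStationaryASEP (m+1) α β γ δ P.q μ) (τ : Fin (m+1) → Bool) :
    μ τ = P.W (m+1) τ / ∑ σ, P.W (m+1) σ := by
  have hWpos : ∀ σ, 0 < P.W (m+1) σ := fun σ => P.w_pos _
  obtain ⟨τ₀, -, hτ₀⟩ := Finset.exists_min_image (Finset.univ : Finset (Fin (m+1) → Bool))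
    (fun σ => μ σ / P.W (m+1) σ) ⟨τ, Finset.mem_univ _⟩
  set r := μ τ₀ / P.W (m+1) τ₀ with hr
  have hν : ∀ σ, 0 ≤ μ σ - r * P.W (m+1) σ := by
    intro σ
    have := hτ₀ σ (Finset.mem_univ _)
    rw [le_div_iff₀ (hWpos σ)] at this
    linarith
  have hst : IsStationaryASEP (m+1) α β γ δ P.q (fun σ => μ σ - r * P.W (m+1) σ) := by
    intro τ'
    have h1 := hμ τ'
    have h2 := P.W_stationary hΓ hA hΔ hB m τ'
    simp only [sub_mul, Finset.sum_sub_distrib, h1, mul_assoc, ← Finset.mul_sum, h2]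
    simp
  have hz := zero_of_stationary hα hβ hγ hδ P.hq0 hν hst (τ₀ := τ₀) (by
    rw [hr, div_mul_cancel₀ _ (hWpos τ₀).ne', sub_self])
  have heq : ∀ σ, μ σ = r * P.W (m+1) σ := fun σ => by linarith [hz σ]
  have hsum : r * ∑ σ, P.W (m+1) σ = 1 := by
    rw [Finset.mul_sum, ← hμ1]
    exact Finset.sum_congr rfl fun σ _ => (heq σ).symm
  have hZ : 0 < ∑ σ, P.W (m+1) σ := Finset.sum_pos (fun σ _ => hWpos σ) ⟨τ, Finset.mem_univ _⟩
  rw [eq_div_iff hZ.ne', heq]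
  linear_combination P.W (m+1) τ * hsum

end OpenASEP

namespace OpenASEP

/-- Inverse Bernoulli weight of a letter. -/
noncomputable def lw (g : ℝ) (x : Bool) : ℝ := if x then 1 / g else 1 / (1 - g)

lemma lw_pos {g : ℝ} (h0 : 0 < g) (h1 : g < 1) (x : Bool) : 0 < lw g x := by
  unfold lw; split_ifs
  · exact one_div_pos.mpr h0
  · exact one_div_pos.mpr (sub_pos.mpr h1)

namespace Par
variable (P : Par)

/-- Admissible densities: between the boundary densities and in `(0,1)`. -/
def Adm (g : ℝ) : Prop := 0 < g ∧ g < 1 ∧ P.a * (1 - g) ≤ g ∧ P.b * g ≤ 1 - g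

lemma exists_adm : ∃ g, P.Adm g := by
  have ha := P.ha
  have hb := P.hb
  have hab := P.hab
  obtain ⟨r, hr, h1, h2⟩ : ∃ r : ℝ, 0 < r ∧ P.a ≤ r ∧ P.b * r ≤ 1 := by
    rcases ha.eq_or_lt with h | h
    · refine ⟨1 / (1 + P.b), by positivity, h ▸ by positivity, ?_⟩
      rw [mul_one_div, div_le_one (by positivity)]
      linarith
    · exact ⟨P.a, h, le_rfl, by linarith⟩
  have h3 : 1 - r / (1 + r) = 1 / (1 + r) := by field_simp; ring
  refine ⟨r / (1 + r), by positivity, (div_lt_one (by positivity)).mpr (by linarith), ?_, ?_⟩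
  · rw [h3, mul_one_div]
    gcongr
  · rw [h3, ← mul_div_assoc]
    gcongr

/-- Products of letter weights over nondecreasing admissible densities form a supersolution. -/
theorem w_le_prod (l : List (Bool × ℝ)) (hs : l.Pairwise (fun p r => p.2 ≤ r.2))
    (hl : ∀ p ∈ l, P.Adm p.2) : P.w (l.map Prod.fst) ≤ (l.map fun p => lw p.2 p.1).prod := by
  set S : List Bool → Set ℝ := fun u => {y | ∃ l : List (Bool × ℝ), l.map Prod.fst = u ∧
    l.Pairwise (fun p r => p.2 ≤ r.2) ∧ (∀ p ∈ l, P.Adm p.2) ∧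
    y = (l.map fun p => lw p.2 p.1).prod} with hS
  have hpos : ∀ l : List (Bool × ℝ), (∀ p ∈ l, P.Adm p.2) →
      0 < (l.map fun p => lw p.2 p.1).prod := by
    intro l hl
    refine List.prod_pos fun x hx => ?_
    obtain ⟨p, hp, rfl⟩ := List.mem_map.mp hx
    exact lw_pos (hl p hp).1 (hl p hp).2.1 _
  have hbdd : ∀ u, BddBelow (S u) := by
    intro u
    refine ⟨0, ?_⟩
    rintro y ⟨l, -, -, h3, rfl⟩
    exact (hpos l h3).le
  obtain ⟨g₀, hg₀⟩ := P.exists_adm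
  have hne : ∀ u, (S u).Nonempty := by
    intro u
    refine ⟨_, u.map (fun x => (x, g₀)), by simp [Function.comp_def], ?_, ?_, rfl⟩
    · rw [List.pairwise_map]
      exact List.pairwise_of_forall (fun _ _ => le_rfl)
    · intro p hp
      obtain ⟨x, -, rfl⟩ := List.mem_map.mp hp
      exact hg₀
  have hle : ∀ l : List (Bool × ℝ), l.Pairwise (fun p r => p.2 ≤ r.2) → (∀ p ∈ l, P.Adm p.2) →
      sInf (S (l.map Prod.fst)) ≤ (l.map fun p => lw p.2 p.1).prod :=
    fun l h1 h2 => csInf_le (hbdd _) ⟨l, rfl, h1, h2, rfl⟩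
  have key : IsSuper P.q P.Γ P.A P.Δ P.B (fun u => sInf (S u)) := by
    refine ⟨fun u v => ?_, fun u => ?_, fun u => ?_⟩
    · refine le_csInf (hne _) ?_
      rintro y ⟨l, hmap, hsort, hadm, rfl⟩
      obtain ⟨l1, l', rfl, rfl, h2⟩ := List.map_eq_append_iff.mp hmap
      obtain ⟨⟨x1, g1⟩, l'', rfl, hx1, h3⟩ := List.map_eq_cons_iff.mp h2
      obtain ⟨⟨x2, g2⟩, l2, rfl, hx2, rfl⟩ := List.map_eq_cons_iff.mp h3
      simp only at hx1 hx2
      subst hx1 hx2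
      have hg1 : P.Adm g1 := hadm (true, g1) (by simp)
      have hg2 : P.Adm g2 := hadm (false, g2) (by simp)
      have hA1 : ∀ p ∈ l1, P.Adm p.2 := fun p hp => hadm p (by simp [hp])
      have hA2 : ∀ p ∈ l2, P.Adm p.2 := fun p hp => hadm p (by simp [hp])
      have hg : g1 ≤ g2 := by
        have := (List.pairwise_append.mp hsort).2.1
        exact (List.pairwise_cons.mp this).1 (false, g2) (by simp)
      rw [List.pairwise_append, List.pairwise_cons, List.pairwise_cons] at hsort
      obtain ⟨s1, ⟨s2, s3, s4⟩, s5⟩ := hsort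
      have a1 := hle (l1 ++ (false, g1) :: (true, g2) :: l2) (by
        rw [List.pairwise_append, List.pairwise_cons, List.pairwise_cons]
        refine ⟨s1, ⟨?_, ?_, s4⟩, ?_⟩
        · intro p hp
          rcases List.mem_cons.mp hp with rfl | hp
          · exact hg
          · exact s2 p (by simp [hp])
        · exact fun p hp => s3 p hp
        · intro p hp r hr
          simp only [List.mem_cons] at hr
          rcases hr with rfl | rfl | hr
          · exact s5 p hp (true, g1) (by simp)
          · exact s5 p hp (false, g2) (by simp)
          · exact s5 p hp r (by simp [hr])) (by
        intro p hp
        simp only [List.mem_append, List.mem_cons] at hp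
        rcases hp with hp | rfl | rfl | hp
        exacts [hA1 p hp, hg1, hg2, hA2 p hp])
      have a2 : ∀ x, sInf (S ((l1 ++ (x, g1) :: l2).map Prod.fst)) ≤
          ((l1 ++ (x, g1) :: l2).map fun p => lw p.2 p.1).prod := fun x =>
        hle (l1 ++ (x, g1) :: l2) (by
        rw [List.pairwise_append, List.pairwise_cons]
        refine ⟨s1, ⟨?_, s4⟩, ?_⟩
        · exact fun p hp => s2 p (by simp [hp])
        · intro p hp r hr
          simp only [List.mem_cons] at hr
          rcases hr with rfl | hr
          · exact s5 p hp (true, g1) (by simp)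
          · exact s5 p hp r (by simp [hr])) (by
        intro p hp
        simp only [List.mem_append, List.mem_cons] at hp
        rcases hp with hp | rfl | hp
        exacts [hA1 p hp, hg1, hA2 p hp])
      have b1 := a2 true
      have b2 := a2 false
      simp only [List.map_append, List.map_cons, List.prod_append, List.prod_cons, lw, if_true,
        Bool.false_eq_true, if_false] at a1 b1 b2 ⊢
      set X := (l1.map fun p => if p.1 = true then 1 / p.2 else 1 / (1 - p.2)).prod
      set Y := (l2.map fun p => if p.1 = true then 1 / p.2 else 1 / (1 - p.2)).prod
      have hX : 0 < X := hpos l1 hA1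
      have hY : 0 < Y := hpos l2 hA2
      obtain ⟨g10, g11, -, -⟩ := hg1
      obtain ⟨g20, g21, -, -⟩ := hg2
      have i1 : 1 / (1 - g1) * (1 / g2) ≤ 1 / g1 * (1 / (1 - g2)) := by
        rw [div_mul_div_comm, div_mul_div_comm, one_mul]
        apply one_div_le_one_div_of_le <;> nlinarith [mul_pos g10 (sub_pos.mpr g21)]
      have i2 : 1 / g1 + 1 / (1 - g1) ≤ 1 / g1 * (1 / (1 - g2)) := by
        have : 1 / g1 + 1 / (1 - g1) = 1 / g1 * (1 / (1 - g1)) := by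
          have : 1 - g1 ≠ 0 := by linarith
          field_simp; ring
        rw [this]
        apply mul_le_mul_of_nonneg_left _ (by positivity)
        exact one_div_le_one_div_of_le (by linarith) (by linarith)
      have hq0 := P.hq0
      have hq1 : 0 ≤ 1 - P.q := by linarith [P.hq1]
      have j1 := mul_le_mul_of_nonneg_left a1 hq0
      have j2 := mul_le_mul_of_nonneg_left (add_le_add b1 b2) hq1
      have hXY : 0 ≤ X * Y := by positivity
      have k1 := mul_le_mul_of_nonneg_left (mul_le_mul_of_nonneg_left i1 hXY) hq0
      have k2 := mul_le_mul_of_nonneg_left (mul_le_mul_of_nonneg_left i2 hXY) hq1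
      refine (add_le_add j1 j2).trans ?_
      linarith
    · refine le_csInf (hne _) ?_
      rintro y ⟨l, hmap, hsort, hadm, rfl⟩
      obtain ⟨⟨x1, g⟩, l2, rfl, hx1, rfl⟩ := List.map_eq_cons_iff.mp hmap
      simp only at hx1
      subst hx1
      have hg : P.Adm g := hadm (false, g) (by simp)
      have hA2 : ∀ p ∈ l2, P.Adm p.2 := fun p hp => hadm p (by simp [hp])
      rw [List.pairwise_cons] at hsort
      have a1 := hle ((true, g) :: l2) (by rw [List.pairwise_cons]; exact hsort) (by
        intro p hp
        simp only [List.mem_cons] at hp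
        rcases hp with rfl | hp
        exacts [hg, hA2 p hp])
      have a2 := hle l2 hsort.2 hA2
      simp only [List.map_cons, List.prod_cons, lw, if_true,
        Bool.false_eq_true, if_false] at a1 a2 ⊢
      set Y := (l2.map fun p => if p.1 = true then 1 / p.2 else 1 / (1 - p.2)).prod
      have hY : 0 < Y := hpos l2 hA2
      obtain ⟨g0, g1, ga, gb⟩ := hg
      have i1 : P.Γ * (1 / g) + P.A ≤ 1 / (1 - g) := by
        have h1 : 0 < 1 - g := by linarith
        rw [mul_one_div, div_add' _ _ _ g0.ne', div_le_div_iff₀ g0 h1]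
        have h2 : 0 ≤ g - P.c * (1 - g) := by nlinarith [P.hc0]
        unfold Γ A
        nlinarith [mul_nonneg (sub_nonneg.mpr ga) h2]
      have j1 := mul_le_mul_of_nonneg_left a1 P.Γ_nonneg
      have j2 := mul_le_mul_of_nonneg_left a2 P.A_pos.le
      have k1 := mul_le_mul_of_nonneg_right i1 hY.le
      refine (add_le_add j1 j2).trans ?_
      linarith
    · refine le_csInf (hne _) ?_
      rintro y ⟨l, hmap, hsort, hadm, rfl⟩
      obtain ⟨l2, l', rfl, rfl, h2⟩ := List.map_eq_append_iff.mp hmap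
      obtain ⟨⟨x1, g⟩, l'', rfl, hx1, h3⟩ := List.map_eq_cons_iff.mp h2
      obtain rfl := List.map_eq_nil_iff.mp h3
      simp only at hx1
      subst hx1
      have hg : P.Adm g := hadm (true, g) (by simp)
      have hA2 : ∀ p ∈ l2, P.Adm p.2 := fun p hp => hadm p (by simp [hp])
      rw [List.pairwise_append] at hsort
      have a1 := hle (l2 ++ [(false, g)]) (by
        rw [List.pairwise_append]
        refine ⟨hsort.1, by simp, fun p hp r hr => ?_⟩
        rw [List.mem_singleton] at hr
        subst hr
        exact hsort.2.2 p hp (true, g) (by simp)) (by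
        intro p hp
        simp only [List.mem_append, List.mem_singleton] at hp
        rcases hp with hp | rfl
        exacts [hA2 p hp, hg])
      have a2 := hle l2 hsort.1 hA2
      simp only [List.map_append, List.map_cons, List.prod_append, List.prod_cons, lw, if_true,
        Bool.false_eq_true, if_false, List.map_nil, List.prod_nil, mul_one] at a1 a2 ⊢
      set Y := (l2.map fun p => if p.1 = true then 1 / p.2 else 1 / (1 - p.2)).prod
      have hY : 0 < Y := hpos l2 hA2
      obtain ⟨g0, g1, ga, gb⟩ := hg
      have i1 : P.Δ * (1 / (1 - g)) + P.B ≤ 1 / g := by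
        have h1 : 0 < 1 - g := by linarith
        rw [mul_one_div, div_add' _ _ _ h1.ne', div_le_div_iff₀ h1 g0]
        have h2 : 0 ≤ (1 - g) - P.d * g := by nlinarith [P.hd0]
        unfold Δ B
        nlinarith [mul_nonneg (sub_nonneg.mpr gb) h2]
      have j1 := mul_le_mul_of_nonneg_left a1 P.Δ_nonneg
      have j2 := mul_le_mul_of_nonneg_left a2 P.B_pos.le
      have k1 := mul_le_mul_of_nonneg_right i1 hY.le
      refine (add_le_add j1 j2).trans ?_
      linarith
  refine (P.sub_le_super P.w_isWeight.isSub key ?_ _).trans (hle l hs hl)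
  refine le_csInf (hne _) ?_
  rintro y ⟨l, hmap, -, -, rfl⟩
  obtain rfl := List.map_eq_nil_iff.mp hmap
  simp [w_nil]

lemma W_le_prod {N : ℕ} (τ : Fin N → Bool) (G : Fin N → ℝ) (hG : Monotone G)
    (hadm : ∀ i, P.Adm (G i)) : P.W N τ ≤ ∏ i, lw (G i) (τ i) := by
  have := P.w_le_prod (List.ofFn fun i => (τ i, G i)) ?_ ?_
  · simpa [List.map_ofFn, Function.comp_def, List.prod_ofFn, W] using this
  · rw [List.pairwise_ofFn]
    exact fun i j hij => hG hij.le
  · intro p hp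
    obtain ⟨i, rfl⟩ := (List.mem_ofFn' _ _).mp hp
    exact hadm i

/-! ### Gluing -/

/-- Inserting a particle in front of a word with many holes costs little. -/
lemma insert_true (v u : List Bool) {κ : ℝ} (h1 : κ ≤ 1 - P.q ^ v.count false * (1 - min 1 P.B)) :
    κ * P.w (u ++ v) ≤ P.w (u ++ true :: v) := by
  induction v generalizing u κ with
  | nil =>
    have := P.w_isWeight.right u
    have h2 := P.w_pos (u ++ [false])
    have h3 := P.w_pos u
    simp only [List.count_nil, pow_zero] at h1
    rw [this, List.append_nil]
    have h4 : κ ≤ P.B := by linarith [min_le_right 1 P.B]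
    nlinarith [mul_nonneg P.Δ_nonneg h2.le]
  | cons x v ih =>
    cases x with
    | true =>
      have := ih (u ++ [true]) (κ := κ) (by simpa using h1)
      simpa using this
    | false =>
      have h2 := ih (u ++ [false]) (κ := 1 - P.q ^ v.count false * (1 - min 1 P.B)) le_rfl
      simp only [List.append_assoc, List.singleton_append] at h2
      rw [P.w_isWeight.bulk]
      have h3 := P.w_pos (u ++ true :: v)
      have h4 := P.w_pos (u ++ false :: v)
      have hq1 : 0 ≤ 1 - P.q := by linarith [P.hq1]
      have h5 := mul_le_mul_of_nonneg_left h2 P.hq0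
      simp only [List.count_cons_self, pow_succ] at h1
      have h6 := mul_le_mul_of_nonneg_right h1 h4.le
      nlinarith [mul_nonneg hq1 h3.le]

lemma leftPar_Δ : P.leftPar.Δ = 0 := by simp [leftPar, Δ]
lemma leftPar_B : P.leftPar.B = 1 := by simp [leftPar, B]

theorem glue_left (u v : List Bool) {κ : ℝ} (h0 : 0 ≤ κ) (hκ : κ ≤ 1 - P.q ^ v.count false) :
    κ ^ u.length * P.leftPar.w u * P.w v ≤ P.w (u ++ v) := by
  have hq1 : 0 ≤ 1 - P.q := by linarith [P.hq1]
  have hpow : 0 ≤ P.q ^ v.count false := pow_nonneg P.hq0 _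
  have hκ1 : κ ≤ 1 := by linarith
  have hκ2 : κ ≤ 1 - P.q ^ v.count false * (1 - min 1 P.B) := by
    have : 0 ≤ min 1 P.B := le_min zero_le_one P.B_pos.le
    nlinarith
  have hv := P.w_pos v
  have hw := P.leftPar.w_pos
  have hsub : IsSub P.q P.Γ P.A 0 κ (fun u => κ ^ u.length * P.leftPar.w u * P.w v) := by
    refine ⟨fun x y => ?_, fun x => ?_, fun x => ?_⟩
    · have h1 := P.leftPar.w_isWeight.bulk x y
      have hqq : P.leftPar.q = P.q := rfl
      simp only [h1, hqq]
      have e1 : (x ++ true :: false :: y).length = (x.length + y.length + 1) + 1 := by simp; omega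
      have e2 : (x ++ false :: true :: y).length = (x.length + y.length + 1) + 1 := by simp; omega
      have e3 : ∀ b, (x ++ b :: y).length = x.length + y.length + 1 := by intro b; simp; omega
      rw [e1, e2, e3, e3]
      set k := x.length + y.length + 1
      have h2 : κ ^ (k + 1) ≤ κ ^ k := pow_le_pow_of_le_one h0 hκ1 (by omega)
      have h3 : 0 ≤ (1 - P.q) * (P.leftPar.w (x ++ true :: y) + P.leftPar.w (x ++ false :: y)) *
          P.w v := mul_nonneg (mul_nonneg hq1 (by linarith [hw (x ++ true :: y), hw (x ++ false :: y)]))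
            hv.le
      have h4 := mul_le_mul_of_nonneg_left h2 h3
      linarith
    · have h1 := P.leftPar.w_isWeight.left x
      have hqq : P.leftPar.Γ = P.Γ := rfl
      have hqA : P.leftPar.A = P.A := rfl
      simp only [h1, hqq, hqA, List.length_cons]
      have h2 : κ ^ (x.length + 1) ≤ κ ^ x.length := pow_le_pow_of_le_one h0 hκ1 (by omega)
      have h3 : 0 ≤ P.A * P.leftPar.w x * P.w v :=
        mul_nonneg (mul_nonneg P.A_pos.le (hw x).le) hv.le
      have h4 := mul_le_mul_of_nonneg_left h2 h3
      linarith
    · have h1 := P.leftPar.w_isWeight.right x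
      simp only [h1, leftPar_Δ, leftPar_B, List.length_append, List.length_singleton, pow_succ]
      linarith
  have hsup : IsSuper P.q P.Γ P.A 0 κ (fun u => P.w (u ++ v)) := by
    refine ⟨fun x y => ?_, fun x => ?_, fun x => ?_⟩
    · simpa using (P.w_isWeight.bulk x (y ++ v)).ge
    · simpa using (P.w_isWeight.left (x ++ v)).ge
    · simpa using P.insert_true v x hκ2
  refine hsub.le hsup P.hq0 P.hq1.le P.Γ_nonneg P.A_pos.le le_rfl h0 (by simp) ?_ u
  simp [w_nil]

/-- Weights with trivial left boundary. -/
noncomputable def wR (u : List Bool) : ℝ := P.swap.leftPar.w (rc u)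

theorem glue_right (u v : List Bool) {κ : ℝ} (h0 : 0 ≤ κ) (hκ : κ ≤ 1 - P.q ^ u.count true) :
    κ ^ v.length * P.wR v * P.w u ≤ P.w (u ++ v) := by
  have := P.swap.glue_left (rc v) (rc u) h0 (by rw [rc_count]; exact hκ)
  rw [← rc_append, w_swap, w_swap, rc_length] at this
  exact this

/-- All boundary parameters trivial. -/
def zeroPar : Par := P.swap.leftPar.swap.leftPar

lemma zeroPar_a : P.zeroPar.a = 0 := rfl
lemma zeroPar_c : P.zeroPar.c = 0 := rfl
lemma zeroPar_q : P.zeroPar.q = P.q := rfl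

/-- Three-piece gluing. -/
theorem glue_three (uL uC uR : List Bool) (m : ℕ) {κ : ℝ} (h0 : 0 ≤ κ) (hκ : κ ≤ 1 - P.q ^ m) :
    κ ^ (uL.length + 2 * uC.length + uR.length + 5 * m) *
      (P.leftPar.w (uL ++ List.replicate m false) *
      (P.w (List.replicate m true) * P.swap.leftPar.w (List.replicate m true) * P.zeroPar.w uC) *
      P.wR (List.replicate m true ++ uR)) ≤
    P.w (uL ++ List.replicate m false ++ (List.replicate m true ++ uC ++ List.replicate m false ++
      (List.replicate m true ++ uR))) := by
  have hκ' : ∀ k, m ≤ k → κ ≤ 1 - P.q ^ k := fun k hk => by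
    have := pow_le_pow_of_le_one P.hq0 P.hq1.le hk
    linarith
  have c1 := P.glue_left (uL ++ List.replicate m false) (List.replicate m true ++ uC ++
    List.replicate m false ++ (List.replicate m true ++ uR)) h0
    (hκ' _ (by simp [List.count_replicate]; omega))
  have c2 := P.glue_right (List.replicate m true ++ uC ++ List.replicate m false)
    (List.replicate m true ++ uR) h0 (hκ' _ (by simp [List.count_replicate]))
  have c3 := P.glue_right (List.replicate m true) (uC ++ List.replicate m false) h0
    (hκ' _ (by simp))
  have c4 := P.swap.leftPar.glue_right (List.replicate m true) (rc uC) h0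
    (hκ' _ (by simp))
  have e1 : rc (List.replicate m false) = List.replicate m true := by
    simp [rc]
  have e2 : P.wR (uC ++ List.replicate m false) =
      P.swap.leftPar.w (List.replicate m true ++ rc uC) := by
    rw [wR, rc_append, e1]
  have e3 : P.swap.leftPar.wR (rc uC) = P.zeroPar.w uC := by
    rw [wR, rc_rc]; rfl
  rw [e3, rc_length] at c4
  rw [e2, ← List.append_assoc] at c3
  simp only [List.length_append, List.length_replicate] at c1 c2 c3 c4
  have p1 := P.leftPar.w_pos (uL ++ List.replicate m false)
  have p2 : 0 < P.wR (List.replicate m true ++ uR) := P.swap.leftPar.w_pos _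
  have p3 := P.w_pos (List.replicate m true)
  have n : ∀ k, 0 ≤ κ ^ k := fun k => pow_nonneg h0 k
  refine le_trans ?_ c1
  have d1 := mul_le_mul_of_nonneg_left c2 (mul_nonneg (n (uL.length + m)) p1.le)
  have d2 := mul_le_mul_of_nonneg_left c3 (mul_nonneg (mul_nonneg (n (uL.length + m)) p1.le)
    (mul_nonneg (n (m + uR.length)) p2.le))
  have d3 := mul_le_mul_of_nonneg_left c4 (mul_nonneg (mul_nonneg (mul_nonneg (n (uL.length + m)) p1.le)
    (mul_nonneg (n (m + uR.length)) p2.le)) (mul_nonneg (n (uC.length + m)) p3.le))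
  have e4 : κ ^ (uL.length + 2 * uC.length + uR.length + 5 * m) ≤
      κ ^ (uL.length + m) * κ ^ (m + uR.length) * κ ^ (uC.length + m) * κ ^ uC.length := by
    rw [← pow_add, ← pow_add, ← pow_add]
    refine pow_le_pow_of_le_one h0 ?_ (by omega)
    have := pow_nonneg P.hq0 m
    linarith
  have q1 := P.swap.leftPar.w_pos (List.replicate m true)
  have q2 := P.zeroPar.w_pos uC
  refine (mul_le_mul_of_nonneg_right e4 (by positivity)).trans ?_
  linarith

end Par

end OpenASEP

namespace OpenASEP
namespace Par
variable (P : Par)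

lemma leftPar_bv : P.leftPar.bv = fun n => if n = 0 then 1 else 0 := by
  funext n
  cases n with
  | zero => simp [bv, bvec]
  | succ n => simp [bv, bvec, leftPar_Δ, leftPar_B]

lemma opE_coeff (n : ℕ) : 1 + P.c ≤ 1 + P.q ^ n * (P.a + P.c) := by
  have h0 := pow_nonneg P.hq0 n
  have h1 : P.q ^ n ≤ 1 := pow_le_one₀ P.hq0 P.hq1.le
  nlinarith [mul_nonneg h0 P.ha, P.hc0]

lemma letter_mono (x : Bool) {V W : ℕ → ℝ} (h : ∀ n, V n ≤ W n) (n : ℕ) :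
    P.letter x V n ≤ P.letter x W n := by
  have h0 := pow_nonneg P.hq0 n
  have h1 : P.q ^ n ≤ 1 := pow_le_one₀ P.hq0 P.hq1.le
  have h2 := P.opE_coeff n
  have h3 := P.Γ_nonneg
  unfold Γ at h3
  cases x with
  | true => simpa [letter, opD] using add_le_add (h n) (h (n + 1))
  | false =>
    simp only [letter, opE, Bool.false_eq_true, if_false]
    have k1 := mul_le_mul_of_nonneg_left (h n) (by linarith [P.hc] : 0 ≤ 1 + P.q ^ n * (P.a + P.c))
    have k2 := mul_le_mul_of_nonneg_left (h (n + 1)) (mul_nonneg h3 h0)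
    have k3 := mul_le_mul_of_nonneg_left (h (n - 1)) (sub_nonneg.mpr h1)
    linarith

lemma act_mono (u : List Bool) {V W : ℕ → ℝ} (h : ∀ n, V n ≤ W n) (n : ℕ) :
    P.act u V n ≤ P.act u W n := by
  induction u generalizing n with
  | nil => exact h n
  | cons x u ih => exact P.letter_mono x ih n

lemma act_nonneg (u : List Bool) {V : ℕ → ℝ} (h : ∀ n, 0 ≤ V n) (n : ℕ) : 0 ≤ P.act u V n := by
  have h0 : P.act u (fun _ => 0) = fun _ => 0 := by
    induction u with
    | nil => rfl
    | cons x u ih => cases x <;> simp only [act_true, act_false, ih] <;> funext n <;> simp [opD, opE]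
  have := P.act_mono u h n
  rwa [h0] at this

/-- Lower rate of `E`. -/
noncomputable def e0 : ℝ := (1 - P.q) * (1 + P.c)

lemma e0_pos : 0 < P.e0 := mul_pos (by linarith [P.hq1]) (by linarith [P.hc])
lemma e0_le_one : P.e0 ≤ 1 := by
  unfold e0; nlinarith [P.hq0, P.hq1, P.hc, P.hc0]

lemma le_act_replicate_false (m n : ℕ) :
    (if n ≤ m then P.e0 ^ m else 0) ≤
      P.act (List.replicate m false) (fun n => if n = 0 then 1 else 0) n := by
  induction m generalizing n with
  | zero => simp
  | succ m ih =>
    have hV0 : ∀ n, 0 ≤ P.act (List.replicate m false) (fun n => if n = 0 then 1 else 0) n :=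
      P.act_nonneg _ (fun n => by split_ifs <;> norm_num)
    rw [List.replicate_succ, act_false]
    set V := P.act (List.replicate m false) (fun n => if n = 0 then 1 else 0)
    have h0 := pow_nonneg P.hq0 n
    have h1 : P.q ^ n ≤ 1 := pow_le_one₀ P.hq0 P.hq1.le
    have h2 := P.opE_coeff n
    have h3 := P.Γ_nonneg
    unfold Γ at h3
    have hc1 : 0 < 1 + P.c := by linarith [P.hc]
    have k1 : (1 + P.c) * V n ≤ (1 + P.q ^ n * (P.a + P.c)) * V n :=
      mul_le_mul_of_nonneg_right h2 (hV0 n)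
    have k2 : 0 ≤ -(P.a * P.c) * P.q ^ n * V (n + 1) := mul_nonneg (mul_nonneg h3 h0) (hV0 _)
    have k3 : 0 ≤ (1 - P.q ^ n) * V (n - 1) := mul_nonneg (sub_nonneg.mpr h1) (hV0 _)
    have k4 : 0 ≤ (1 + P.c) * V n := mul_nonneg hc1.le (hV0 _)
    have hp := pow_pos P.e0_pos m
    have main : (1 + P.c) * V n + (1 - P.q ^ n) * V (n - 1) ≤ P.opE V n := by
      simp only [opE]; linarith
    refine le_trans ?_ main
    by_cases hn : n ≤ m
    · rw [if_pos (by omega)]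
      have := ih n
      rw [if_pos hn] at this
      have h5 : P.e0 ≤ 1 + P.c := by unfold e0; nlinarith [P.hq0]
      calc P.e0 ^ (m + 1) = P.e0 * P.e0 ^ m := pow_succ' _ _
        _ ≤ (1 + P.c) * V n := mul_le_mul h5 this hp.le hc1.le
        _ ≤ _ := by linarith
    · by_cases hn1 : n ≤ m + 1
      · rw [if_pos hn1]
        have := ih (n - 1)
        rw [if_pos (by omega)] at this
        have h5 : P.e0 ≤ 1 - P.q ^ n := by
          have : P.q ^ n ≤ P.q := pow_le_of_le_one P.hq0 P.hq1.le (by omega)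
          unfold e0
          nlinarith [P.hq1, P.hc0]
        calc P.e0 ^ (m + 1) = P.e0 * P.e0 ^ m := pow_succ' _ _
          _ ≤ (1 - P.q ^ n) * V (n - 1) := mul_le_mul h5 this hp.le (sub_nonneg.mpr h1)
          _ ≤ _ := by linarith
      · rw [if_neg hn1]
        linarith

/-- Left boundary density. -/
noncomputable def ρ : ℝ := P.a / (1 + P.a)

lemma ρ_nonneg : 0 ≤ P.ρ := div_nonneg P.ha (by linarith [P.ha])
lemma ρ_lt_one : P.ρ < 1 := (div_lt_one (by linarith [P.ha])).mpr (by linarith)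
lemma one_sub_ρ : 1 - P.ρ = 1 / (1 + P.a) := by
  have := P.ha
  unfold ρ; field_simp; ring

/-- Product weight of a word at density `g`. -/
noncomputable def lwProd (g : ℝ) (u : List Bool) : ℝ := (u.map (lw g)).prod

lemma lwProd_append (g : ℝ) (u v : List Bool) : lwProd g (u ++ v) = lwProd g u * lwProd g v := by
  simp [lwProd]

lemma lwProd_pos {g : ℝ} (h0 : 0 < g) (h1 : g < 1) (u : List Bool) : 0 < lwProd g u :=
  List.prod_pos fun x hx => by
    obtain ⟨y, -, rfl⟩ := List.mem_map.mp hx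
    exact lw_pos h0 h1 y

lemma act_geom (ha : 0 < P.a) (u : List Bool) :
    P.act u (fun n => (1 / P.a) ^ n) = fun n => lwProd P.ρ u * (1 / P.a) ^ n := by
  have ha1 : 0 < 1 + P.a := by linarith
  induction u with
  | nil => funext n; simp [lwProd]
  | cons x u ih =>
    cases x with
    | true =>
      rw [act_true, ih]
      funext n
      simp only [opD, lwProd, List.map_cons, List.prod_cons, lw, if_true, ρ, pow_succ]
      field_simp
      ring
    | false =>
      rw [act_false, ih]
      funext n
      simp only [opE, lwProd, List.map_cons, List.prod_cons, lw, Bool.false_eq_true, if_false,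
        one_sub_ρ]
      cases n with
      | zero => simp; field_simp; ring
      | succ n => simp only [Nat.add_sub_cancel, pow_succ]; field_simp; ring

lemma opE_pow (z : ℝ) (hz : 0 < z) (n : ℕ) : P.opE (fun n => z ^ n) n =
    (1 + 1 / z) * z ^ n + (P.q * z) ^ n * ((P.a * z - 1) * (1 / z - P.c)) := by
  simp only [opE, mul_pow]
  cases n with
  | zero => simp; field_simp; ring
  | succ n => simp only [Nat.add_sub_cancel, pow_succ]; field_simp; ring

/-- Upper bound for the action on a slightly larger geometric vector. -/
lemma act_pow_le (ha : 0 < P.a) {δ : ℝ} (hδ : 0 < δ) (hδ1 : δ ≤ 1) (hq : P.q * (1 + δ) ≤ 1)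
    (u : List Bool) {X M : ℝ} (hX : 0 < X)
    (h : ∀ v, v <:+ u → Real.exp (δ * (v.count true - P.ρ * v.length) + δ ^ 2 * v.length) * X ≤ M) :
    P.act u (fun n => ((1 + δ) / P.a) ^ n) 0 * X ≤ (u.length + 1) * M * lwProd P.ρ u := by
  have ha1 : 0 < 1 + P.a := by linarith
  have hρ0 := P.ρ_nonneg
  have hρ1 := P.ρ_lt_one
  have hρ : 0 < P.ρ := by unfold ρ; positivity
  set z := (1 + δ) / P.a with hz
  have hz0 : 0 < z := by positivity
  induction u using List.reverseRecOn generalizing X with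
  | nil => simpa [lwProd] using h [] (by simp)
  | append_singleton u x ih =>
    have hXM : X ≤ M := by simpa using h [] (by simp)
    have hM : 0 < M := hX.trans_le hXM
    have hPi := lwProd_pos hρ hρ1 u
    rw [act_append, lwProd_append]
    cases x with
    | true =>
      have e1 : P.act [true] (fun n => z ^ n) = fun n => (1 + z) * z ^ n + 0 * z ^ n := by
        funext n; simp [opD, pow_succ]; ring
      rw [e1, act_linear]
      have := ih (X := Real.exp (δ * (1 - P.ρ) + δ ^ 2) * X) (by positivity) (by
        intro v hv
        have := h (v ++ [true]) (by
          obtain ⟨t, rfl⟩ := hv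
          exact ⟨t, by simp⟩)
        rw [← mul_assoc, ← Real.exp_add]
        refine le_trans (le_of_eq ?_) this
        simp
        left; ring)
      have hx : (1 + z) ≤ Real.exp (δ * (1 - P.ρ) + δ ^ 2) * (1 / P.ρ) := by
        have h1 : 1 + δ * (1 - P.ρ) ≤ Real.exp (δ * (1 - P.ρ) + δ ^ 2) := by
          have := Real.add_one_le_exp (δ * (1 - P.ρ) + δ ^ 2)
          nlinarith
        refine le_trans (le_of_eq ?_) (mul_le_mul_of_nonneg_right h1 (by positivity))
        rw [one_sub_ρ, hz, ρ]
        field_simp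
        ring
      have hp : 0 ≤ P.act u (fun n => z ^ n) 0 := P.act_nonneg _ (fun n => by positivity) _
      simp only [List.length_append, List.length_singleton, lwProd, List.map_cons, List.map_nil,
        List.prod_cons, List.prod_nil, lw, if_true, mul_one, zero_mul, add_zero]
      push_cast
      change _ ≤ _ * (lwProd P.ρ u * _)
      calc (1 + z) * P.act u (fun n => z ^ n) 0 * X
          ≤ (Real.exp (δ * (1 - P.ρ) + δ ^ 2) * (1 / P.ρ)) * P.act u (fun n => z ^ n) 0 * X := by
            gcongr
        _ = (P.act u (fun n => z ^ n) 0 * (Real.exp (δ * (1 - P.ρ) + δ ^ 2) * X)) * (1 / P.ρ) := by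
            ring
        _ ≤ ((u.length + 1) * M * lwProd P.ρ u) * (1 / P.ρ) := by gcongr
        _ ≤ ((u.length + 1 + 1) * M * lwProd P.ρ u) * (1 / P.ρ) := by gcongr; linarith
        _ = _ := by ring
    | false =>
      set C := (P.a * z - 1) * (1 / z - P.c) with hC
      have haz : P.a * z = 1 + δ := by rw [hz]; field_simp
      have h1z : 1 / z ≤ P.a := by
        rw [hz, one_div_div, div_le_iff₀ (by linarith)]; nlinarith
      have hC0 : 0 ≤ C := mul_nonneg (by rw [haz]; linarith) (by
        have := P.hc0
        have : 0 < 1 / z := by positivity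
        linarith)
      have hC1 : C ≤ 1 + P.a := by
        rw [hC, haz]
        have : 1 / z - P.c ≤ 1 + P.a := by linarith [P.hc]
        have h0 : 0 ≤ 1 / z - P.c := by
          have := P.hc0
          have : 0 < 1 / z := by positivity
          linarith
        nlinarith
      have e1 : ∀ n, P.act [false] (fun n => z ^ n) n ≤ (1 + 1 / z) * z ^ n + C * (1 / P.a) ^ n := by
        intro n
        rw [act_false, act_nil, opE_pow _ _ hz0, mul_comm C]
        have hqz : P.q * z ≤ 1 / P.a := by
          rw [hz, ← mul_div_assoc]
          gcongr
        have hqz0 : 0 ≤ P.q * z := mul_nonneg P.hq0 hz0.le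
        gcongr
      have e2 := P.act_mono u e1 0
      rw [act_linear, P.act_geom ha] at e2
      have := ih (X := Real.exp (δ * (0 - P.ρ) + δ ^ 2) * X) (by positivity) (by
        intro v hv
        have := h (v ++ [false]) (by
          obtain ⟨t, rfl⟩ := hv
          exact ⟨t, by simp⟩)
        rw [← mul_assoc, ← Real.exp_add]
        refine le_trans (le_of_eq ?_) this
        simp
        left; ring)
      have hx : (1 + 1 / z) ≤ Real.exp (δ * (0 - P.ρ) + δ ^ 2) * (1 + P.a) := by
        have h1 : 1 - P.ρ * δ / (1 + δ) ≤ Real.exp (δ * (0 - P.ρ) + δ ^ 2) := by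
          have := Real.add_one_le_exp (δ * (0 - P.ρ) + δ ^ 2)
          have h2 : P.ρ * δ - δ ^ 2 ≤ P.ρ * δ / (1 + δ) := by
            rw [le_div_iff₀ (by linarith)]
            nlinarith [mul_pos hδ hδ, mul_pos (mul_pos hδ hδ) hδ]
          linarith
        refine le_trans (le_of_eq ?_) (mul_le_mul_of_nonneg_right h1 ha1.le)
        rw [hz, ρ]
        field_simp
        ring
      have hp : 0 ≤ P.act u (fun n => z ^ n) 0 := P.act_nonneg _ (fun n => by positivity) _
      simp only [List.length_append, List.length_singleton, lwProd, List.map_cons, List.map_nil,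
        List.prod_cons, List.prod_nil, lw, Bool.false_eq_true, if_false, mul_one, one_sub_ρ,
        one_div_one_div]
      push_cast
      change _ ≤ _ * (lwProd P.ρ u * _)
      simp only [pow_zero, mul_one] at e2
      calc P.act u (P.act [false] fun n => z ^ n) 0 * X
          ≤ ((1 + 1 / z) * P.act u (fun n => z ^ n) 0 + C * lwProd P.ρ u) * X := by gcongr
        _ ≤ ((Real.exp (δ * (0 - P.ρ) + δ ^ 2) * (1 + P.a)) * P.act u (fun n => z ^ n) 0 +
              (1 + P.a) * lwProd P.ρ u) * X := by gcongr
        _ = (P.act u (fun n => z ^ n) 0 * (Real.exp (δ * (0 - P.ρ) + δ ^ 2) * X)) * (1 + P.a) +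
              (1 + P.a) * lwProd P.ρ u * X := by ring
        _ ≤ ((u.length + 1) * M * lwProd P.ρ u) * (1 + P.a) + (1 + P.a) * lwProd P.ρ u * M := by
            gcongr
        _ = _ := by ring

/-- Lower bound for the left boundary piece. -/
theorem left_piece (ha : 0 < P.a) {δ : ℝ} (hδ : 0 < δ) (hδ1 : δ ≤ 1) (hq : P.q * (1 + δ) ≤ 1)
    (u : List Bool) (m : ℕ) {E : ℝ} (h : ∀ v, v <:+ u → v.count true ≤ P.ρ * v.length + E)
    (hm : 2 * ((u.length + 1) * Real.exp (δ * E + δ ^ 2 * u.length)) ≤ (1 + δ) ^ m) :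
    (P.e0 * min 1 P.a) ^ m * (lwProd P.ρ u / 2) ≤
      P.leftPar.w (u ++ List.replicate m false) := by
  have hρ : 0 < P.ρ := by have := P.ha; unfold ρ; positivity
  have hρ1 := P.ρ_lt_one
  have hPi := lwProd_pos hρ hρ1 u
  have hu := P.act_pow_le ha hδ hδ1 hq u (X := 1) (M := Real.exp (δ * E + δ ^ 2 * u.length)) one_pos
    (by
      intro v hv
      rw [mul_one]
      apply Real.exp_le_exp.mpr
      have h1 := h v hv
      have h2 : (v.length : ℝ) ≤ u.length := by exact_mod_cast hv.length_le
      have h3 : δ * (v.count true - P.ρ * v.length) ≤ δ * E :=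
        mul_le_mul_of_nonneg_left (by linarith) hδ.le
      have h4 : δ ^ 2 * (v.length : ℝ) ≤ δ ^ 2 * u.length := by gcongr
      linarith)
  rw [mul_one] at hu
  have hact : ∀ (v : List Bool) (V : ℕ → ℝ), P.leftPar.act v V = P.act v V := fun v V => rfl
  have he : P.leftPar.e0 = P.e0 := rfl
  have hD : 0 < (1 + δ) ^ m := by positivity
  rw [w, act_append, leftPar_bv, hact, hact]
  set κ := (P.e0 * min 1 P.a) ^ m with hκ
  have hmin : 0 < min 1 P.a := lt_min one_pos ha
  have hκ0 : 0 < κ := pow_pos (mul_pos P.e0_pos hmin) _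
  have hpt : ∀ n, κ * (1 / P.a) ^ n + (-(κ / (1 + δ) ^ m)) * ((1 + δ) / P.a) ^ n ≤
      P.act (List.replicate m false) (fun n => if n = 0 then 1 else 0) n := by
    intro n
    refine le_trans ?_ (P.le_act_replicate_false m n)
    have hr : 0 < (1 / P.a) ^ n := by positivity
    have e : κ * (1 / P.a) ^ n + (-(κ / (1 + δ) ^ m)) * ((1 + δ) / P.a) ^ n =
        κ * (1 / P.a) ^ n * (1 - (1 + δ) ^ n / (1 + δ) ^ m) := by
      rw [div_pow, div_pow]; field_simp; ring
    rw [e]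
    by_cases hn : n ≤ m
    · rw [if_pos hn]
      have h1 : (min 1 P.a) ^ m * (1 / P.a) ^ n ≤ 1 := by
        have h2 : (min 1 P.a) ^ m ≤ (min 1 P.a) ^ n :=
          pow_le_pow_of_le_one hmin.le (min_le_left _ _) hn
        have h3 : (min 1 P.a) ^ n ≤ P.a ^ n := pow_le_pow_left₀ hmin.le (min_le_right _ _) _
        rw [one_div_pow, mul_one_div]
        exact (div_le_one (by positivity)).mpr (h2.trans h3)
      have h4 : 0 ≤ (1 + δ) ^ n / (1 + δ) ^ m := by positivity
      have h5 := pow_pos P.e0_pos m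
      have h6 : κ * (1 / P.a) ^ n ≤ P.e0 ^ m := by
        rw [hκ, mul_pow, mul_assoc]
        exact mul_le_of_le_one_right h5.le h1
      have h7 : 0 ≤ κ * (1 / P.a) ^ n := by positivity
      nlinarith
    · rw [if_neg hn]
      have : 1 ≤ (1 + δ) ^ n / (1 + δ) ^ m := by
        rw [one_le_div hD]
        exact pow_le_pow_right₀ (by linarith) (by omega)
      have h7 : 0 ≤ κ * (1 / P.a) ^ n := by positivity
      nlinarith
  refine le_trans ?_ (P.act_mono u hpt 0)
  rw [act_linear, P.act_geom ha]
  simp only [pow_zero, mul_one]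
  have h1 : P.act u (fun n => ((1 + δ) / P.a) ^ n) 0 / (1 + δ) ^ m ≤ lwProd P.ρ u / 2 := by
    rw [div_le_iff₀ hD]
    refine hu.trans ?_
    nlinarith
  have h2 := mul_le_mul_of_nonneg_left h1 hκ0.le
  have h3 : κ / (1 + δ) ^ m * P.act u (fun n => ((1 + δ) / P.a) ^ n) 0 =
    κ * (P.act u (fun n => ((1 + δ) / P.a) ^ n) 0 / (1 + δ) ^ m) := by ring
  linarith

end Par
end OpenASEP

namespace OpenASEP

/-- Sum over words of length `n`. -/
noncomputable def wordSum : ℕ → (List Bool → ℝ) → ℝ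
  | 0, f => f []
  | n + 1, f => wordSum n (fun u => f (true :: u)) + wordSum n (fun u => f (false :: u))

lemma wordSum_mono {n : ℕ} {f g : List Bool → ℝ} (h : ∀ u, u.length = n → f u ≤ g u) :
    wordSum n f ≤ wordSum n g := by
  induction n generalizing f g with
  | zero => exact h [] rfl
  | succ n ih =>
    exact add_le_add (ih fun u hu => h _ (by simp [hu])) (ih fun u hu => h _ (by simp [hu]))

lemma wordSum_zero (n : ℕ) : wordSum n (fun _ => 0) = 0 := by
  induction n with
  | zero => rfl
  | succ n ih => simp [wordSum, ih]

lemma wordSum_nonneg {n : ℕ} {f : List Bool → ℝ} (h : ∀ u, u.length = n → 0 ≤ f u) :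
    0 ≤ wordSum n f := by
  rw [← wordSum_zero n]
  exact wordSum_mono h

lemma wordSum_add (m n : ℕ) (f : List Bool → ℝ) :
    wordSum (m + n) f = wordSum m (fun u => wordSum n (fun v => f (u ++ v))) := by
  induction m generalizing f with
  | zero => simp [wordSum]
  | succ m ih =>
    rw [Nat.succ_add]
    simp only [wordSum, ih, List.cons_append]

lemma wordSum_mul_left (n : ℕ) (c : ℝ) (f : List Bool → ℝ) :
    wordSum n (fun u => c * f u) = c * wordSum n f := by
  induction n generalizing f with
  | zero => rfl
  | succ n ih => simp only [wordSum, ih, mul_add]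

lemma wordSum_mul_right (n : ℕ) (c : ℝ) (f : List Bool → ℝ) :
    wordSum n (fun u => f u * c) = wordSum n f * c := by
  simp only [mul_comm _ c, wordSum_mul_left]

lemma le_wordSum (v : List Bool) (f : List Bool → ℝ) (h : ∀ u, u.length = v.length → 0 ≤ f u) :
    f v ≤ wordSum v.length f := by
  induction v generalizing f with
  | nil => exact le_rfl
  | cons x v ih =>
    have h1 := ih (fun u => f (x :: u)) (fun u hu => h _ (by simp [hu]))
    have h2 : 0 ≤ wordSum v.length (fun u => f ((!x) :: u)) :=
      wordSum_nonneg (fun u hu => h _ (by simp [hu]))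
    cases x <;> simp only [List.length_cons, wordSum, Bool.not_true, Bool.not_false] at h1 h2 ⊢ <;>
      linarith

lemma wordSum_eq_sum (n : ℕ) (f : List Bool → ℝ) :
    wordSum n f = ∑ τ : Fin n → Bool, f (List.ofFn τ) := by
  induction n generalizing f with
  | zero => simp [wordSum]
  | succ n ih =>
    rw [← (Fin.consEquiv (fun _ : Fin (n + 1) => Bool)).sum_comp, Fintype.sum_prod_type]
    simp [wordSum, ih, Fin.consEquiv, List.ofFn_succ]

/-- Height of a word after `k` letters. -/
def ht (u : List Bool) (k : ℕ) : ℕ := (u.take k).count true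

@[simp] lemma ht_zero (u : List Bool) : ht u 0 = 0 := by simp [ht]
@[simp] lemma ht_nil (k : ℕ) : ht [] k = 0 := by simp [ht]
@[simp] lemma ht_true (u : List Bool) (k : ℕ) : ht (true :: u) (k + 1) = ht u k + 1 := by simp [ht]
@[simp] lemma ht_false (u : List Bool) (k : ℕ) : ht (false :: u) (k + 1) = ht u k := by simp [ht]
lemma ht_append (u v : List Bool) (k : ℕ) : ht (u ++ v) k = ht u k + ht v (k - u.length) := by
  simp [ht, List.take_append]
lemma ht_of_length_le {u : List Bool} {k : ℕ} (h : u.length ≤ k) : ht u k = u.count true := by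
  rw [ht, List.take_of_length_le h]
namespace Par
variable (P : Par)

theorem zero_act_lower (u : List Bool) {V : ℕ → ℝ} {M m₀ : ℕ} {c κ : ℝ} (hc : 0 ≤ c)
    (hV : ∀ n, 0 ≤ V n) (hVc : ∀ n, n ≤ M → c ≤ V n) (hm : 1 ≤ m₀) (hκ0 : 0 ≤ κ)
    (hκ : κ ≤ 1 - P.q ^ m₀) (n : ℕ) :
    c * (κ ^ u.length * wordSum u.length (fun σ =>
      if (∀ k ≤ u.length, m₀ + ht σ k ≤ n + ht u k) ∧ n + ht u u.length ≤ M + ht σ u.length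
      then 1 else 0)) ≤ P.zeroPar.act u V n := by
  have hκ1 : κ ≤ 1 := by have := pow_nonneg P.hq0 m₀; linarith
  induction u generalizing n with
  | nil =>
    simp only [List.length_nil, pow_zero, one_mul, wordSum, ht_zero, act_nil, add_zero]
    split_ifs with h
    · simpa using hVc n h.2
    · simpa using hV n
  | cons x u ih =>
    have hnn := P.zeroPar.act_nonneg u hV
    by_cases hn : m₀ ≤ n
    swap
    · refine le_trans (le_of_eq ?_) (P.zeroPar.act_nonneg (x :: u) hV n)
      have : (fun σ => if (∀ k ≤ (x :: u).length, m₀ + ht σ k ≤ n + ht (x :: u) k) ∧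
          n + ht (x :: u) (x :: u).length ≤ M + ht σ (x :: u).length then (1 : ℝ) else 0) =
          fun _ => 0 := by
        funext σ
        rw [if_neg]
        rintro ⟨h, -⟩
        have := h 0 (Nat.zero_le _)
        simp at this
        omega
      rw [this, wordSum_zero]; simp
    have hqn : κ ≤ 1 - P.q ^ n := by
      have := pow_le_pow_of_le_one P.hq0 P.hq1.le hn
      linarith
    have iff_gen : ∀ (y : Bool) (n' : ℕ) (σ : List Bool),
        n' + (if y then 1 else 0) = n + (if x then 1 else 0) →
        (((∀ k ≤ (x :: u).length, m₀ + ht (y :: σ) k ≤ n + ht (x :: u) k) ∧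
          n + ht (x :: u) (x :: u).length ≤ M + ht (y :: σ) (x :: u).length) ↔
        ((∀ k ≤ u.length, m₀ + ht σ k ≤ n' + ht u k) ∧ n' + ht u u.length ≤ M + ht σ u.length)) := by
      intro y n' σ hn'
      have hstep : ∀ (z : Bool) (v : List Bool) (k : ℕ),
          ht (z :: v) (k + 1) = ht v k + (if z then 1 else 0) := by
        intro z v k; cases z <;> simp
      constructor
      · rintro ⟨h1, h2⟩
        refine ⟨fun k hk => ?_, ?_⟩
        · have := h1 (k + 1) (by simpa using hk)
          rw [hstep, hstep] at this
          omega
        · rw [List.length_cons, hstep, hstep] at h2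
          omega
      · rintro ⟨h1, h2⟩
        refine ⟨fun k hk => ?_, ?_⟩
        · cases k with
          | zero => simpa using hn
          | succ k =>
            have := h1 k (by simpa using hk)
            rw [hstep, hstep]
            omega
        · rw [List.length_cons, hstep, hstep]
          omega
    have hκp : 0 ≤ κ ^ u.length := pow_nonneg hκ0 _
    have hS : ∀ n, 0 ≤ c * (κ ^ u.length * wordSum u.length (fun σ =>
      if (∀ k ≤ u.length, m₀ + ht σ k ≤ n + ht u k) ∧ n + ht u u.length ≤ M + ht σ u.length
      then 1 else 0)) := fun n => mul_nonneg hc (mul_nonneg hκp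
        (wordSum_nonneg fun σ _ => by split_ifs <;> norm_num))
    cases x with
    | true =>
      have e1 := fun σ => iff_gen true n σ (by simp)
      have e2 := fun σ => iff_gen false (n + 1) σ (by simp)
      have hl : (true :: u).length = u.length + 1 := rfl
      rw [hl] at e1 e2 ⊢
      simp only [wordSum, e1, e2, act_true, opD, pow_succ]
      have h1 := ih n
      have h2 := ih (n + 1)
      have s1 := hS n
      have s2 := hS (n + 1)
      have := mul_le_mul_of_nonneg_right hκ1 (add_nonneg s1 s2)
      linarith
    | false =>
      have e1 := fun σ => iff_gen true (n - 1) σ (by simp; omega)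
      have e2 := fun σ => iff_gen false n σ (by simp)
      have hl : (false :: u).length = u.length + 1 := rfl
      rw [hl] at e1 e2 ⊢
      simp only [wordSum, e1, e2, act_false, opE, zeroPar_a, zeroPar_c, zeroPar_q, pow_succ]
      have h1 := ih (n - 1)
      have h2 := ih n
      have s1 := hS (n - 1)
      have s2 := hS n
      have t1 := mul_le_mul_of_nonneg_right hκ1 s2
      have t2 := mul_le_mul_of_nonneg_right hqn (hnn (n - 1))
      have t3 := mul_le_mul_of_nonneg_left h1 hκ0
      linarith

lemma le_act_replicate_true (j : ℕ) {V : ℕ → ℝ} (hV : ∀ n, 0 ≤ V n) (n : ℕ) :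
    V (n + j) ≤ P.act (List.replicate j true) V n := by
  induction j generalizing n with
  | zero => simp
  | succ j ih =>
    rw [List.replicate_succ, act_true, opD]
    have h1 := ih (n + 1)
    have h2 := P.act_nonneg (List.replicate j true) hV n
    rw [show n + (j + 1) = n + 1 + j by ring]
    linarith

lemma zeroPar_e0 : P.zeroPar.e0 = 1 - P.q := by
  simp [e0, zeroPar_q, zeroPar_c]

/-- Lower bound for the middle piece in terms of two-layer paths. -/
theorem core_piece (u : List Bool) {m : ℕ} (hm : 1 ≤ m) {κ : ℝ} (hκ0 : 0 ≤ κ)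
    (hκ : κ ≤ 1 - P.q ^ m) :
    (1 - P.q) ^ (3 * m) * (κ ^ u.length * wordSum u.length (fun σ =>
      if (∀ k ≤ u.length, ht σ k ≤ m + ht u k) ∧ ht u u.length ≤ m + ht σ u.length
      then 1 else 0)) ≤
      P.zeroPar.w (List.replicate (2 * m) true ++ u ++ List.replicate (3 * m) false) := by
  have hbv : P.zeroPar.bv = fun n => if n = 0 then 1 else 0 := P.swap.leftPar.swap.leftPar_bv
  have hq : 0 ≤ 1 - P.q := by linarith [P.hq1]
  rw [w, act_append, act_append, hbv]
  set V := P.zeroPar.act (List.replicate (3 * m) false) (fun n => if n = 0 then 1 else 0)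
  have hV0 : ∀ n, 0 ≤ V n := P.zeroPar.act_nonneg _ (fun n => by split_ifs <;> norm_num)
  have hVc : ∀ n, n ≤ 3 * m → (1 - P.q) ^ (3 * m) ≤ V n := by
    intro n hn
    have := P.zeroPar.le_act_replicate_false (3 * m) n
    rwa [if_pos hn, zeroPar_e0] at this
  refine le_trans ?_ (P.zeroPar.le_act_replicate_true (2 * m) (P.zeroPar.act_nonneg u hV0) 0)
  refine le_trans (le_of_eq ?_)
    (P.zero_act_lower u (pow_nonneg hq _) hV0 hVc hm hκ0 hκ (0 + 2 * m))
  congr 2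
  congr 1
  funext σ
  congr 1
  apply propext
  constructor
  · rintro ⟨h1, h2⟩
    exact ⟨fun k hk => by have := h1 k hk; omega, by omega⟩
  · rintro ⟨h1, h2⟩
    exact ⟨fun k hk => by have := h1 k hk; omega, by omega⟩

end Par
end OpenASEP

namespace OpenASEP

lemma wordSum_fun_add (n : ℕ) (f g : List Bool → ℝ) :
    wordSum n (fun u => f u + g u) = wordSum n f + wordSum n g := by
  induction n generalizing f g with
  | zero => rfl
  | succ n ih => simp only [wordSum, ih]; ring

lemma wordSum_finset_sum {ι : Type*} (s : Finset ι) (n : ℕ) (f : ι → List Bool → ℝ) :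
    wordSum n (fun u => ∑ i ∈ s, f i u) = ∑ i ∈ s, wordSum n (f i) := by
  induction s using Finset.induction_on with
  | empty => simp [wordSum_zero]
  | insert i s hi ih => simp only [Finset.sum_insert hi, wordSum_fun_add, ih]

/-- Product Bernoulli probability of a word with densities `θ`. -/
noncomputable def bern : (ℕ → ℝ) → List Bool → ℝ
  | _, [] => 1
  | θ, x :: u => (if x then θ 0 else 1 - θ 0) * bern (fun j => θ (j + 1)) u

/-- Weighted sum of the centred letters of a word. -/
noncomputable def dev : (ℕ → ℝ) → (ℕ → ℝ) → List Bool → ℝ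
  | _, _, [] => 0
  | t, θ, x :: u =>
    t 0 * ((if x then 1 else 0) - θ 0) + dev (fun j => t (j + 1)) (fun j => θ (j + 1)) u

lemma dev_const_mul (r : ℝ) (t θ : ℕ → ℝ) (u : List Bool) :
    dev (fun j => r * t j) θ u = r * dev t θ u := by
  induction u generalizing t θ with
  | nil => simp [dev]
  | cons x u ih => simp only [dev, ih]; ring

lemma dev_eq_zero (θ : ℕ → ℝ) (u : List Bool) : dev (fun _ => 0) θ u = 0 := by
  have := dev_const_mul 0 (fun _ => 0) θ u
  simpa using this

lemma dev_indicator (θ : ℕ → ℝ) (u : List Bool) (i : ℕ) (hi : i ≤ u.length) :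
    dev (fun j => if j < i then 1 else 0) θ u = ht u i - ∑ j ∈ Finset.range i, θ j := by
  induction u generalizing θ i with
  | nil =>
    obtain rfl : i = 0 := by simpa using hi
    simp [dev]
  | cons x u ih =>
    cases i with
    | zero => simpa using dev_eq_zero θ (x :: u)
    | succ i =>
      have := ih (fun j => θ (j + 1)) i (by simpa using hi)
      simp only [dev, Nat.add_lt_add_iff_right, this, Finset.sum_range_succ' θ]
      cases x <;> simp <;> ring

lemma bern_eq_exp {θ : ℕ → ℝ} (h0 : ∀ j, 0 < θ j) (h1 : ∀ j, θ j < 1) (u : List Bool) :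
    bern θ u = Real.exp ((∑ j ∈ Finset.range u.length, Hent (θ j)) +
      dev (fun j => Real.log (θ j) - Real.log (1 - θ j)) θ u) := by
  induction u generalizing θ with
  | nil => simp [bern, dev]
  | cons x u ih =>
    rw [bern, ih (θ := fun j => θ (j + 1)) (fun j => h0 _) (fun j => h1 _)]
    have hx : (if x then θ 0 else 1 - θ 0) = Real.exp (Hent (θ 0) +
        (Real.log (θ 0) - Real.log (1 - θ 0)) * ((if x then 1 else 0) - θ 0)) := by
      cases x with
      | true =>
        have : Hent (θ 0) + (Real.log (θ 0) - Real.log (1 - θ 0)) * (1 - θ 0) = Real.log (θ 0) := by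
          unfold Hent; ring
        simp only [if_true, this, Real.exp_log (h0 0)]
      | false =>
        have : Hent (θ 0) + (Real.log (θ 0) - Real.log (1 - θ 0)) * (0 - θ 0) =
            Real.log (1 - θ 0) := by
          unfold Hent; ring
        simp only [Bool.false_eq_true, if_false, this,
          Real.exp_log (show 0 < 1 - θ 0 by linarith [h1 0])]
    rw [hx, ← Real.exp_add]
    congr 1
    rw [List.length_cons, Finset.sum_range_succ', dev]
    ring

lemma bern_nonneg {θ : ℕ → ℝ} (h0 : ∀ j, 0 < θ j) (h1 : ∀ j, θ j < 1) (u : List Bool) :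
    0 ≤ bern θ u := by
  rw [bern_eq_exp h0 h1]; positivity

lemma wordSum_bern (n : ℕ) (θ : ℕ → ℝ) : wordSum n (bern θ) = 1 := by
  induction n generalizing θ with
  | zero => rfl
  | succ n ih => simp [wordSum, bern, wordSum_mul_left, ih]

lemma wordSum_bern_exp {n : ℕ} {t θ : ℕ → ℝ} (h0 : ∀ j, 0 < θ j) (h1 : ∀ j, θ j < 1)
    (ht : ∀ j, |t j| ≤ 1) :
    wordSum n (fun u => bern θ u * Real.exp (dev t θ u)) ≤
      Real.exp (∑ j ∈ Finset.range n, t j ^ 2) := by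
  induction n generalizing t θ with
  | zero => simp [wordSum, bern, dev]
  | succ n ih =>
    have := ih (t := fun j => t (j + 1)) (θ := fun j => θ (j + 1)) (fun j => h0 _) (fun j => h1 _)
      (fun j => ht _)
    simp only [wordSum, bern, dev, if_true, Bool.false_eq_true, if_false, Real.exp_add]
    have e : ∀ r s : ℝ, (fun u => r * bern (fun j => θ (j + 1)) u * (s *
        Real.exp (dev (fun j => t (j + 1)) (fun j => θ (j + 1)) u))) = fun u => (r * s) *
        (bern (fun j => θ (j + 1)) u *
        Real.exp (dev (fun j => t (j + 1)) (fun j => θ (j + 1)) u)) := by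
      intro r s; funext u; ring
    rw [e, e, wordSum_mul_left, wordSum_mul_left, ← add_mul, Finset.sum_range_succ', Real.exp_add,
      mul_comm]
    have a0 := h0 0
    have a1 := h1 0
    refine mul_le_mul this ?_ (by have : 0 < 1 - θ 0 := by linarith
                                  positivity) (by positivity)
    have key : ∀ y : ℝ, |y| ≤ 1 → Real.exp y ≤ 1 + y + y ^ 2 := by
      intro y hy
      have := (abs_le.mp (Real.abs_exp_sub_one_sub_id_le hy)).2
      linarith
    have b1 := key (t 0 * (1 - θ 0)) (by
      rw [abs_mul]
      exact mul_le_one₀ (ht 0) (abs_nonneg _) (by rw [abs_le]; constructor <;> linarith))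
    have b2 := key (t 0 * (0 - θ 0)) (by
      rw [abs_mul]
      exact mul_le_one₀ (ht 0) (abs_nonneg _) (by rw [abs_le]; constructor <;> linarith))
    have b3 := Real.add_one_le_exp (t 0 ^ 2)
    have b4 := mul_le_mul_of_nonneg_left b1 a0.le
    have b5 := mul_le_mul_of_nonneg_left b2 (sub_nonneg.mpr a1.le)
    have b6 : θ 0 * (1 - θ 0) * t 0 ^ 2 ≤ 1 * t 0 ^ 2 :=
      mul_le_mul_of_nonneg_right (by nlinarith) (sq_nonneg _)
    nlinarith

/-- A word-count lower bound for tubes around paths with slopes bounded away from `0` and `1`. -/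
theorem tube_lower {ε₀ η : ℝ} (hε : 0 < ε₀) (hη : 0 < η) :
    ∃ N₀ : ℕ, ∀ N ≥ N₀, ∀ n ≤ N, ∀ θ : ℕ → ℝ, (∀ j, ε₀ ≤ θ j) → (∀ j, θ j ≤ 1 - ε₀) →
      Real.exp (-(∑ j ∈ Finset.range n, Hent (θ j)) - η * N) ≤
        wordSum n (fun u => if ∀ i ≤ n, |(ht u i : ℝ) - ∑ j ∈ Finset.range i, θ j| ≤ η * N
          then 1 else 0) := by
  set C : ℝ := |Real.log ε₀| + 1 with hC
  have hC1 : 1 ≤ C := by have := abs_nonneg (Real.log ε₀); linarith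
  set l : ℝ := min (1 / C) (η / (4 * C ^ 2)) with hl
  have hl0 : 0 < l := lt_min (by positivity) (by positivity)
  have hlC : l * C ≤ 1 := by
    have := min_le_left (1 / C) (η / (4 * C ^ 2))
    rw [← hl, le_div_iff₀ (by linarith)] at this
    exact this
  have hlη : l * (4 * C ^ 2) ≤ η := by
    have := min_le_right (1 / C) (η / (4 * C ^ 2))
    rwa [← hl, le_div_iff₀ (by positivity)] at this
  set κ : ℝ := l * η / 4 with hκ
  have hκ0 : 0 < κ := by positivity
  have ev1 : ∀ᶠ N : ℕ in Filter.atTop, (2 * (N : ℝ) + 3) * Real.exp (-κ * N) ≤ 1 / 2 := by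
    have t1 : Filter.Tendsto (fun x : ℝ => (2 * x + 3) * Real.exp (-κ * x)) Filter.atTop (nhds 0) := by
      have h1 := Real.tendsto_pow_mul_exp_neg_atTop_nhds_zero 1
      have h0 := Real.tendsto_pow_mul_exp_neg_atTop_nhds_zero 0
      have hk : Filter.Tendsto (fun x : ℝ => κ * x) Filter.atTop Filter.atTop :=
        Filter.tendsto_id.const_mul_atTop hκ0
      have h2 := ((h1.comp hk).const_mul (2 / κ)).add ((h0.comp hk).const_mul 3)
      simp only [Function.comp_def, mul_zero, add_zero] at h2
      refine h2.congr fun x => ?_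
      rw [neg_mul]
      field_simp
    exact (t1.comp tendsto_natCast_atTop_atTop).eventually_le_const (by norm_num)
  have ev2 : ∀ᶠ N : ℕ in Filter.atTop, Real.exp (-(η / 2) * N) ≤ 1 / 2 := by
    have : Filter.Tendsto (fun N : ℕ => Real.exp (-(η / 2) * N)) Filter.atTop (nhds 0) := by
      refine Real.tendsto_exp_atBot.comp ?_
      exact (tendsto_natCast_atTop_atTop).const_mul_atTop_of_neg (by linarith)
    exact this.eventually_le_const (by norm_num)
  obtain ⟨N₀, hN₀⟩ := Filter.eventually_atTop.mp (ev1.and ev2)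
  refine ⟨N₀, fun N hN n hn θ hθ0 hθ1 => ?_⟩
  obtain ⟨e1, e2⟩ := hN₀ N hN
  have h0 : ∀ j, 0 < θ j := fun j => hε.trans_le (hθ0 j)
  have h1 : ∀ j, θ j < 1 := fun j => (hθ1 j).trans_lt (by linarith)
  have hnN : (n : ℝ) ≤ N := by exact_mod_cast hn
  set L : ℕ → ℝ := fun j => Real.log (θ j) - Real.log (1 - θ j) with hL
  have hLC : ∀ j, |L j| ≤ C := by
    intro j
    have a1 : Real.log ε₀ ≤ Real.log (θ j) := Real.log_le_log hε (hθ0 j)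
    have a2 : Real.log ε₀ ≤ Real.log (1 - θ j) := Real.log_le_log hε (by linarith [hθ1 j])
    have a3 : Real.log (θ j) ≤ 0 := Real.log_nonpos (h0 j).le (h1 j).le
    have a4 : Real.log (1 - θ j) ≤ 0 := Real.log_nonpos (by linarith [h1 j]) (by linarith [h0 j])
    have a5 := neg_abs_le (Real.log ε₀)
    rw [abs_le]
    constructor <;> simp only [hL] <;> linarith
  have cher : ∀ t : ℕ → ℝ, (∀ j, |t j| ≤ C) →
      wordSum n (fun u => bern θ u * Real.exp (dev (fun j => l * t j) θ u - l * (η / 2 * N))) ≤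
        Real.exp (-κ * N) := by
    intro t ht
    have := wordSum_bern_exp (n := n) (t := fun j => l * t j) h0 h1 (fun j => by
      rw [abs_mul, abs_of_pos hl0]
      exact (mul_le_mul_of_nonneg_left (ht j) hl0.le).trans hlC)
    simp only [sub_eq_add_neg _ (l * (η / 2 * N)), Real.exp_add, ← mul_assoc (bern θ _)]
    rw [wordSum_mul_right]
    refine (mul_le_mul_of_nonneg_right this (Real.exp_pos _).le).trans ?_
    rw [← Real.exp_add]
    apply Real.exp_le_exp.mpr
    have s1 : ∑ j ∈ Finset.range n, (l * t j) ^ 2 ≤ N * (l ^ 2 * C ^ 2) := by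
      have : ∑ j ∈ Finset.range n, (l * t j) ^ 2 ≤ ∑ _j ∈ Finset.range n, l ^ 2 * C ^ 2 := by
        refine Finset.sum_le_sum fun j _ => ?_
        rw [mul_pow]
        have := sq_le_sq' (by linarith [(abs_le.mp (ht j)).1]) (abs_le.mp (ht j)).2
        gcongr
      rw [Finset.sum_const, Finset.card_range, nsmul_eq_mul] at this
      exact this.trans (mul_le_mul_of_nonneg_right hnN (by positivity))
    have s2 : l * (l * (4 * C ^ 2)) * N ≤ l * η * N := by gcongr
    rw [hκ]
    nlinarith
  set G : List Bool → Prop := fun u => ∀ i ≤ n, |(ht u i : ℝ) - ∑ j ∈ Finset.range i, θ j| ≤ η * N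
    with hG
  set tub : List Bool → ℝ := fun u => if G u then 1 else 0 with htub
  set S := ∑ j ∈ Finset.range n, Hent (θ j) with hS
  have ind : ∀ i j : ℕ, |(if j < i then (1 : ℝ) else 0)| ≤ C := by
    intro i j; split_ifs <;> simp <;> linarith
  have pt : ∀ u : List Bool, u.length = n → bern θ u ≤ tub u * Real.exp (S + η / 2 * N) +
      ((∑ i ∈ Finset.range (n + 1),
        (bern θ u * Real.exp (dev (fun j => l * (if j < i then 1 else 0)) θ u - l * (η / 2 * N)) +
         bern θ u * Real.exp (dev (fun j => l * -(if j < i then 1 else 0)) θ u - l * (η / 2 * N)))) +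
      bern θ u * Real.exp (dev (fun j => l * L j) θ u - l * (η / 2 * N))) := by
    intro u hu
    have hb := bern_nonneg h0 h1 u
    have hsum : ∀ i, 0 ≤ (bern θ u * Real.exp (dev (fun j => l * (if j < i then 1 else 0)) θ u - l * (η / 2 * N)) +
         bern θ u * Real.exp (dev (fun j => l * -(if j < i then 1 else 0)) θ u - l * (η / 2 * N))) :=
      fun i => by positivity
    have hsum' := Finset.sum_nonneg (fun i (_ : i ∈ Finset.range (n + 1)) => hsum i)
    have hLn : 0 ≤ bern θ u * Real.exp (dev (fun j => l * L j) θ u - l * (η / 2 * N)) := by positivity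
    have htn : 0 ≤ tub u * Real.exp (S + η / 2 * N) := by
      simp only [htub]; split_ifs <;> positivity
    have big : ∀ y : ℝ, 0 ≤ y → bern θ u ≤ bern θ u * Real.exp y := fun y hy =>
      le_mul_of_one_le_right hb (Real.one_le_exp hy)
    by_cases hLb : dev L θ u ≤ η / 2 * N
    swap
    · have := big (dev (fun j => l * L j) θ u - l * (η / 2 * N)) (by
        rw [dev_const_mul]
        have := mul_le_mul_of_nonneg_left (not_le.mp hLb).le hl0.le
        linarith)
      linarith
    by_cases hGu : G u
    · have h2 : bern θ u ≤ tub u * Real.exp (S + η / 2 * N) := by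
        simp only [htub, if_pos hGu, one_mul]
        rw [bern_eq_exp h0 h1, hu]
        apply Real.exp_le_exp.mpr
        linarith
      linarith
    · simp only [hG, not_forall, not_le] at hGu
      obtain ⟨i, hi, hbad⟩ := hGu
      have hle := Finset.single_le_sum (fun i (_ : i ∈ Finset.range (n + 1)) => hsum i)
        (Finset.mem_range.mpr (Nat.lt_succ_of_le hi))
      have hdi := dev_indicator θ u i (by omega)
      have hηN : 0 ≤ η * N := by positivity
      have p1 : 0 ≤ bern θ u * Real.exp (dev (fun j => l * (if j < i then 1 else 0)) θ u - l * (η / 2 * N)) := by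
        positivity
      have p2 : 0 ≤ bern θ u * Real.exp (dev (fun j => l * -(if j < i then 1 else 0)) θ u - l * (η / 2 * N)) := by
        positivity
      have : bern θ u ≤ (bern θ u * Real.exp (dev (fun j => l * (if j < i then 1 else 0)) θ u - l * (η / 2 * N)) +
         bern θ u * Real.exp (dev (fun j => l * -(if j < i then 1 else 0)) θ u - l * (η / 2 * N))) := by
        rcases lt_abs.mp hbad with hb' | hb'
        · have := big (dev (fun j => l * (if j < i then 1 else 0)) θ u - l * (η / 2 * N)) (by
            rw [dev_const_mul, hdi]
            have := mul_le_mul_of_nonneg_left hb'.le hl0.le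
            have := mul_nonneg hl0.le hηN
            linarith)
          linarith
        · have := big (dev (fun j => l * -(if j < i then 1 else 0)) θ u - l * (η / 2 * N)) (by
            have e : (fun j => l * -(if j < i then (1 : ℝ) else 0)) =
              fun j => (-l) * (if j < i then 1 else 0) := by funext j; ring
            rw [e, dev_const_mul, hdi]
            have := mul_le_mul_of_nonneg_left hb'.le hl0.le
            have := mul_nonneg hl0.le hηN
            linarith)
          linarith
      linarith
  have tot := wordSum_mono pt
  rw [wordSum_bern, wordSum_fun_add, wordSum_fun_add, wordSum_finset_sum, wordSum_mul_right] at tot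
  simp only [wordSum_fun_add] at tot
  have bL := cher L hLC
  have bI : ∑ i ∈ Finset.range (n + 1),
      (wordSum n (fun u => bern θ u * Real.exp (dev (fun j => l * (if j < i then 1 else 0)) θ u - l * (η / 2 * N))) +
       wordSum n (fun u => bern θ u * Real.exp (dev (fun j => l * -(if j < i then 1 else 0)) θ u - l * (η / 2 * N)))) ≤
      ∑ _i ∈ Finset.range (n + 1), (Real.exp (-κ * N) + Real.exp (-κ * N)) :=
    Finset.sum_le_sum fun i _ => add_le_add (cher _ (ind i)) (cher _ (fun j => by
      rw [abs_neg]; exact ind i j))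
  rw [Finset.sum_const, Finset.card_range, nsmul_eq_mul] at bI
  push_cast at bI
  have hexp := Real.exp_pos (-κ * N)
  have half : 1 / 2 ≤ wordSum n tub * Real.exp (S + η / 2 * N) := by nlinarith
  have hfin : Real.exp (-S - η * N) = Real.exp (-(η / 2) * N) * Real.exp (-(S + η / 2 * N)) := by
    rw [← Real.exp_add]; congr 1; ring
  rw [hfin]
  have hinv : Real.exp (S + η / 2 * N) * Real.exp (-(S + η / 2 * N)) = 1 := by
    rw [← Real.exp_add]; simp
  have hpos := Real.exp_pos (-(S + η / 2 * N))
  calc _ ≤ 1 / 2 * Real.exp (-(S + η / 2 * N)) := by gcongr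
    _ ≤ (wordSum n tub * Real.exp (S + η / 2 * N)) * Real.exp (-(S + η / 2 * N)) := by gcongr
    _ = wordSum n tub := by rw [mul_assoc, hinv, mul_one]

end OpenASEP

namespace OpenASEP

open MeasureTheory Filter Topology Set

/-- Nondecreasing `1`-Lipschitz functions on `ℝ` starting from `0`. -/
structure IsPath (F : ℝ → ℝ) : Prop where
  mono : Monotone F
  lip : LipschitzWith 1 F
  zero : F 0 = 0

lemma Hent_continuous : Continuous Hent := by
  unfold Hent
  exact Real.continuous_mul_log.add
    (Real.continuous_mul_log.comp (continuous_const.sub continuous_id))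

namespace IsPath
variable {F : ℝ → ℝ}

lemma sub_le (hF : IsPath F) {x y : ℝ} (h : x ≤ y) : F y - F x ≤ y - x := by
  have := hF.lip.dist_le_mul y x
  rw [Real.dist_eq, Real.dist_eq, abs_of_nonneg (sub_nonneg.2 (hF.mono h)),
    abs_of_nonneg (sub_nonneg.2 h)] at this
  simpa using this

lemma abs_sub_le (hF : IsPath F) (x y : ℝ) : |F x - F y| ≤ |x - y| := by
  simpa [Real.dist_eq] using hF.lip.dist_le_mul x y

lemma nonneg (hF : IsPath F) {x : ℝ} (h : 0 ≤ x) : 0 ≤ F x := hF.zero ▸ hF.mono h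

lemma le_self (hF : IsPath F) {x : ℝ} (h : 0 ≤ x) : F x ≤ x := by
  have := hF.sub_le h; rw [hF.zero] at this; linarith

lemma continuous (hF : IsPath F) : Continuous F := hF.lip.continuous

lemma deriv_nonneg (hF : IsPath F) (x : ℝ) : 0 ≤ deriv F x := hF.mono.deriv_nonneg

lemma deriv_le_one (hF : IsPath F) (x : ℝ) : deriv F x ≤ 1 := by
  have := norm_deriv_le_of_lipschitz hF.lip (x₀ := x)
  exact (le_abs_self _).trans (by simpa using this)

lemma integral_deriv (hF : IsPath F) (u v : ℝ) : ∫ x in u..v, deriv F x = F v - F u :=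
  (hF.lip.lipschitzOnWith.absolutelyContinuousOnInterval).integral_deriv_eq_sub

lemma intervalIntegrable_comp (hF : IsPath F) {L : ℝ → ℝ} (hL : Continuous L) (u v : ℝ) :
    IntervalIntegrable (fun x => L (deriv F x)) volume u v := by
  obtain ⟨C, hC⟩ := (isCompact_Icc (a := (0:ℝ)) (b := 1)).exists_bound_of_continuousOn
    hL.continuousOn
  refine (intervalIntegrable_const (c := C)).mono_fun
    (hL.measurable.comp (measurable_deriv F)).aestronglyMeasurable (Eventually.of_forall ?_)
  intro x
  exact (hC _ ⟨hF.deriv_nonneg x, hF.deriv_le_one x⟩).trans (le_abs_self C)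

/-- Convergence of difference quotients over intervals shrinking to a point of differentiability. -/
lemma _root_.OpenASEP.tendsto_slope_straddle {φ : ℝ → ℝ} {x p : ℝ} (h : HasDerivAt φ p x)
    {u v : ℕ → ℝ} (hu : ∀ᶠ n in atTop, u n ≤ x) (hv : ∀ᶠ n in atTop, x ≤ v n)
    (huv : ∀ᶠ n in atTop, u n < v n) (hlim : Tendsto (fun n => v n - u n) atTop (𝓝 0)) :
    Tendsto (fun n => (φ (v n) - φ (u n)) / (v n - u n)) atTop (𝓝 p) := by
  rw [Metric.tendsto_atTop']
  intro ε hε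
  have h1 := (hasDerivAt_iff_isLittleO.1 h).def (half_pos hε)
  obtain ⟨δ, hδ, hb⟩ := Metric.eventually_nhds_iff.1 h1
  have h2 : ∀ᶠ n in atTop, v n - u n < δ := hlim.eventually (gt_mem_nhds hδ)
  obtain ⟨n₀, hn₀⟩ := eventually_atTop.1 (hu.and (hv.and (huv.and h2)))
  refine ⟨n₀, fun n hn => ?_⟩
  obtain ⟨a1, a2, a3, a4⟩ := hn₀ n hn.le
  have b1 := hb (y := v n) (by rw [Real.dist_eq, abs_of_nonneg] <;> linarith)
  have b2 := hb (y := u n) (by rw [Real.dist_eq, abs_of_nonpos] <;> linarith)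
  simp only [Real.norm_eq_abs, smul_eq_mul] at b1 b2
  rw [abs_of_nonneg (show 0 ≤ v n - x by linarith)] at b1
  rw [abs_of_nonpos (show u n - x ≤ 0 by linarith)] at b2
  have hpos : 0 < v n - u n := by linarith
  rw [Real.dist_eq, div_sub' hpos.ne', abs_div, abs_of_pos hpos, div_lt_iff₀ hpos]
  have : |φ (v n) - φ (u n) - (v n - u n) * p| ≤ ε / 2 * (v n - u n) := by
    rw [abs_le] at b1 b2 ⊢
    constructor <;> nlinarith
  nlinarith

/-- Riemann sums of a continuous function of the block slopes of a path. -/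
theorem tendsto_riemann (hF : IsPath F) {L : ℝ → ℝ} (hL : Continuous L) :
    Tendsto (fun M : ℕ => ∑ j ∈ Finset.range M,
      (1 / (M : ℝ)) * L (M * (F ((j + 1) / M) - F (j / M)))) atTop
      (𝓝 (∫ x in (0:ℝ)..1, L (deriv F x))) := by
  obtain ⟨C, hC⟩ := (isCompact_Icc (a := (0:ℝ)) (b := 1)).exists_bound_of_continuousOn
    hL.continuousOn
  set S : ℕ → ℝ → ℝ := fun M x =>
    L (M * (F (((⌊M * x⌋₊ : ℝ) + 1) / M) - F ((⌊M * x⌋₊ : ℝ) / M))) with hS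
  have hSm : ∀ M, Measurable (S M) := by
    intro M
    have h1 : Measurable fun x : ℝ => ((⌊(M:ℝ) * x⌋₊ : ℕ) : ℝ) :=
      measurable_from_nat.comp (Nat.measurable_floor.comp (measurable_const_mul _))
    exact hL.measurable.comp ((((hF.continuous.measurable.comp ((h1.add_const 1).div_const _)).sub
      (hF.continuous.measurable.comp (h1.div_const _)))).const_mul _)
  have hb : ∀ M : ℕ, ∀ k : ℕ, 0 < M →
      (M:ℝ) * (F (((k : ℝ) + 1) / M) - F ((k : ℝ) / M)) ∈ Icc (0:ℝ) 1 := by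
    intro M k hM
    have hM' : (0:ℝ) < M := by exact_mod_cast hM
    have h1 : (k:ℝ) / M ≤ ((k:ℝ) + 1) / M := by gcongr; linarith
    have h2 := hF.sub_le h1
    have h3 := hF.mono h1
    have h4 : ((k:ℝ) + 1) / M - k / M = 1 / M := by ring
    constructor
    · exact mul_nonneg hM'.le (by linarith)
    · calc _ ≤ (M:ℝ) * (1 / M) := by gcongr; linarith
        _ = 1 := by field_simp
  have hint : ∀ᶠ M : ℕ in atTop, ∫ x in (0:ℝ)..1, S M x = ∑ j ∈ Finset.range M,
      (1 / (M : ℝ)) * L (M * (F ((j + 1) / M) - F (j / M))) := by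
    filter_upwards [eventually_gt_atTop 0] with M hM
    have hM' : (0:ℝ) < M := by exact_mod_cast hM
    have h := intervalIntegral.sum_integral_adjacent_intervals (f := S M) (μ := volume)
      (a := fun j : ℕ => (j:ℝ) / M) (n := M) (fun k _ => by
        refine (intervalIntegrable_const (c := C)).mono_fun (hSm M).aestronglyMeasurable
          (Eventually.of_forall fun x => ?_)
        exact (hC _ (hb M _ hM)).trans (le_abs_self C))
    simp only [Nat.cast_zero, zero_div, div_self hM'.ne'] at h
    rw [← h]
    refine Finset.sum_congr rfl fun k _ => ?_
    have h1 : (k:ℝ) / M ≤ ((k + 1 : ℕ):ℝ) / M := by gcongr; simp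
    rw [intervalIntegral.integral_of_le h1, integral_Ioc_eq_integral_Ioo]
    have : ∫ x in Ioo ((k:ℝ) / M) (((k + 1 : ℕ):ℝ) / M), S M x =
        ∫ x in Ioo ((k:ℝ) / M) (((k + 1 : ℕ):ℝ) / M), L (M * (F ((k + 1) / M) - F (k / M))) := by
      refine setIntegral_congr_fun measurableSet_Ioo fun x hx => ?_
      have h3 : ⌊(M:ℝ) * x⌋₊ = k := by
        rw [Nat.floor_eq_iff (by
          have : (0:ℝ) ≤ (k:ℝ) / M := by positivity
          have := this.trans hx.1.le
          positivity)]
        have := hx.1; have := hx.2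
        rw [div_lt_iff₀ hM'] at *
        rw [lt_div_iff₀ hM'] at *
        push_cast at *
        constructor <;> linarith
      simp only [hS, h3]
    rw [this, setIntegral_const, smul_eq_mul]
    congr 1
    rw [Measure.real, Real.volume_Ioo, ENNReal.toReal_ofReal (by linarith)]
    push_cast; ring
  refine Tendsto.congr' hint ?_
  refine intervalIntegral.tendsto_integral_filter_of_dominated_convergence (fun _ => C)
    (Eventually.of_forall fun M => (hSm M).aestronglyMeasurable) ?_ intervalIntegrable_const ?_
  · filter_upwards [eventually_gt_atTop 0] with M hM
    exact Eventually.of_forall fun x _ => hC _ (hb M _ hM)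
  · filter_upwards [hF.lip.ae_differentiableAt] with x hx hx01
    rw [uIoc_of_le zero_le_one] at hx01
    refine (hL.tendsto _).comp ?_
    have h := tendsto_slope_straddle hx.hasDerivAt (u := fun M : ℕ => (⌊(M:ℝ) * x⌋₊ : ℝ) / M)
      (v := fun M : ℕ => ((⌊(M:ℝ) * x⌋₊ : ℝ) + 1) / M) ?_ ?_ ?_ ?_
    · refine h.congr' ?_
      filter_upwards [eventually_gt_atTop 0] with M hM
      have hM' : (0:ℝ) < M := by exact_mod_cast hM
      have h4 : ((⌊(M:ℝ) * x⌋₊ : ℝ) + 1) / M - (⌊(M:ℝ) * x⌋₊ : ℝ) / M = 1 / M := by ring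
      rw [h4]; field_simp
    · filter_upwards [eventually_gt_atTop 0] with M hM
      have hM' : (0:ℝ) < M := by exact_mod_cast hM
      rw [div_le_iff₀ hM', mul_comm x]
      exact Nat.floor_le (mul_nonneg hM'.le hx01.1.le)
    · filter_upwards [eventually_gt_atTop 0] with M hM
      have hM' : (0:ℝ) < M := by exact_mod_cast hM
      rw [le_div_iff₀ hM', mul_comm x]
      exact (Nat.lt_floor_add_one _).le
    · filter_upwards [eventually_gt_atTop 0] with M hM
      have hM' : (0:ℝ) < M := by exact_mod_cast hM
      gcongr; linarith
    · refine tendsto_one_div_atTop_nhds_zero_nat.congr fun M => ?_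
      ring

end IsPath

/-- Gibbs' inequality for two Bernoulli laws. -/
lemma gibbs {y θ : ℝ} (hy0 : 0 ≤ y) (hy1 : y ≤ 1) (h0 : 0 < θ) (h1 : θ < 1) :
    y * Real.log θ + (1 - y) * Real.log (1 - θ) ≤ Hent y := by
  have key : ∀ u v : ℝ, 0 ≤ u → 0 < v → u * Real.log v + (u - v) ≤ u * Real.log u := by
    intro u v hu hv
    rcases hu.eq_or_lt with rfl | hu
    · simp [hv.le]
    · have := Real.add_one_le_exp (Real.log v - Real.log u)
      rw [Real.exp_sub, Real.exp_log hv, Real.exp_log hu, le_div_iff₀ hu] at this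
      nlinarith
  have := key y θ hy0 h0
  have := key (1 - y) (1 - θ) (by linarith) (by linarith)
  unfold Hent; linarith

lemma Hent_nonpos {y : ℝ} (hy0 : 0 ≤ y) (hy1 : y ≤ 1) : Hent y ≤ 0 := by
  unfold Hent
  have := mul_nonneg hy0 (neg_nonneg.2 (Real.log_nonpos hy0 hy1))
  have := mul_nonneg (sub_nonneg.2 hy1) (neg_nonneg.2 (Real.log_nonpos (sub_nonneg.2 hy1)
    (by linarith)))
  linarith

/-- Truncation to `[ε, 1 - ε]`. -/
noncomputable def clamp (ε x : ℝ) : ℝ := max ε (min x (1 - ε))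

lemma clamp_le {ε x : ℝ} (h : ε ≤ 1 / 2) : clamp ε x ≤ 1 - ε :=
  max_le (by linarith) (min_le_right _ _)

lemma le_clamp (ε x : ℝ) : ε ≤ clamp ε x := le_max_left _ _

lemma clamp_mono (ε : ℝ) : Monotone (clamp ε) := fun _ _ h =>
  max_le_max le_rfl (min_le_min h le_rfl)

lemma clamp_cases {ε x : ℝ} (h : ε ≤ 1 / 2) :
    (clamp ε x = x) ∨ (x < ε ∧ clamp ε x = ε) ∨ (1 - ε < x ∧ clamp ε x = 1 - ε) := by
  unfold clamp
  rcases le_total x (1 - ε) with h1 | h1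
  · rw [min_eq_left h1]
    rcases le_or_gt ε x with h2 | h2
    · left; exact max_eq_right h2
    · right; left; exact ⟨h2, max_eq_left h2.le⟩
  · rw [min_eq_right h1, max_eq_right (by linarith)]
    rcases h1.eq_or_lt with h2 | h2
    · left; exact h2
    · right; right; exact ⟨h2, rfl⟩

lemma abs_clamp_sub_le {ε x : ℝ} (h0 : 0 ≤ ε) (h : ε ≤ 1 / 2) (hx0 : 0 ≤ x) (hx1 : x ≤ 1) :
    |clamp ε x - x| ≤ ε := by
  rcases clamp_cases (x := x) h with h1 | ⟨h1, h2⟩ | ⟨h1, h2⟩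
  · rw [h1]; simpa
  · rw [h2, abs_le]; constructor <;> linarith
  · rw [h2, abs_le]; constructor <;> linarith

/-- Truncating the parameter costs at most `-log (1 - ε)`. -/
lemma clamp_log_le {ε p x : ℝ} (h0 : 0 < ε) (h : ε ≤ 1 / 2) (hp0 : 0 ≤ p) (hp1 : p ≤ 1)
    (hx0 : 0 ≤ x) (hx1 : x ≤ 1) (h1 : x = 0 → p = 0) (h2 : x = 1 → p = 1) :
    p * Real.log x + (1 - p) * Real.log (1 - x) + Real.log (1 - ε) ≤
      p * Real.log (clamp ε x) + (1 - p) * Real.log (1 - clamp ε x) := by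
  have hl : Real.log (1 - ε) ≤ 0 := Real.log_nonpos (by linarith) (by linarith)
  have A : ∀ p x : ℝ, 0 ≤ p → p ≤ 1 → 0 ≤ x → x ≤ 1 → (x = 0 → p = 0) → x < ε →
      p * Real.log x + (1 - p) * Real.log (1 - x) + Real.log (1 - ε) ≤
      p * Real.log ε + (1 - p) * Real.log (1 - ε) := by
    intro p x hp0 hp1 hx0 hx1 h1 hx
    have e1 : p * Real.log x ≤ p * Real.log ε := by
      rcases hx0.eq_or_lt with rfl | hx'
      · simp [h1 rfl]
      · exact mul_le_mul_of_nonneg_left (Real.log_le_log hx' hx.le) hp0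
    have e2 : (1 - p) * Real.log (1 - x) ≤ 0 :=
      mul_nonpos_of_nonneg_of_nonpos (by linarith) (Real.log_nonpos (by linarith) (by linarith))
    nlinarith
  rcases clamp_cases (x := x) h with h3 | ⟨h3, h4⟩ | ⟨h3, h4⟩
  · rw [h3]; linarith
  · rw [h4]; exact A p x hp0 hp1 hx0 hx1 h1 h3
  · rw [h4]
    have := A (1 - p) (1 - x) (by linarith) (by linarith) (by linarith) (by linarith)
      (fun h => by rw [h2 (by linarith)]; ring) (by linarith)
    simp only [sub_sub_cancel] at this ⊢
    linarith

/-- Jensen's inequality for the entropy with a truncated slope. -/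
lemma IsPath.jensen {F : ℝ → ℝ} (hF : IsPath F) {ε u v : ℝ} (h0 : 0 < ε) (h : ε ≤ 1 / 2)
    (huv : u < v) :
    (v - u) * Hent (clamp ε ((F v - F u) / (v - u))) ≤ ∫ x in u..v, Hent (deriv F x) := by
  set p := (F v - F u) / (v - u) with hp
  set θ := clamp ε p with hθ
  have hvu : 0 < v - u := by linarith
  have t0 : 0 < θ := h0.trans_le (le_clamp _ _)
  have t1 : θ < 1 := (clamp_le h).trans_lt (by linarith)
  have hlow : ∫ x in u..v, (deriv F x * Real.log θ + (1 - deriv F x) * Real.log (1 - θ)) ≤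
      ∫ x in u..v, Hent (deriv F x) := by
    refine intervalIntegral.integral_mono_on huv.le ?_ (hF.intervalIntegrable_comp
      Hent_continuous _ _) fun x _ => gibbs (hF.deriv_nonneg x) (hF.deriv_le_one x) t0 t1
    exact hF.intervalIntegrable_comp (L := fun p => p * Real.log θ + (1 - p) * Real.log (1 - θ))
      (by fun_prop) _ _
  refine le_trans ?_ hlow
  have hint : IntervalIntegrable (deriv F) volume u v :=
    hF.intervalIntegrable_comp (L := fun p => p) continuous_id _ _
  have : ∫ x in u..v, (deriv F x * Real.log θ + (1 - deriv F x) * Real.log (1 - θ)) =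
      (F v - F u) * Real.log θ + ((v - u) - (F v - F u)) * Real.log (1 - θ) := by
    rw [intervalIntegral.integral_add (hint.mul_const _)
      ((intervalIntegrable_const.sub hint).mul_const _), intervalIntegral.integral_mul_const,
      intervalIntegral.integral_mul_const, intervalIntegral.integral_sub intervalIntegrable_const
      hint, hF.integral_deriv]
    simp
  rw [this]
  have hpp : F v - F u = (v - u) * p := by rw [hp]; field_simp
  rw [hpp]
  have : 0 ≤ (p - θ) * (Real.log θ - Real.log (1 - θ)) := by
    rcases clamp_cases (x := p) h with h1 | ⟨h1, h2⟩ | ⟨h1, h2⟩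
    · rw [hθ, h1]; simp
    · have : Real.log θ ≤ Real.log (1 - θ) := Real.log_le_log t0 (by rw [hθ, h2]; linarith)
      apply mul_nonneg_of_nonpos_of_nonpos <;> [skip; linarith]
      rw [hθ, h2]; linarith
    · have : Real.log (1 - θ) ≤ Real.log θ := Real.log_le_log (by linarith)
        (by rw [hθ, h2]; linarith)
      apply mul_nonneg <;> [skip; linarith]
      rw [hθ, h2]; linarith
  unfold Hent
  nlinarith

end OpenASEP

namespace OpenASEP

open MeasureTheory Filter Topology Set

section Envelope
variable {F : ℝ → ℝ}

lemma IsPath.convEnv_bddAbove (x : ℝ) (hx : x ∈ Icc (0:ℝ) 1) :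
    BddAbove {y : ℝ | ∃ g : ℝ → ℝ, ConvexOn ℝ (Icc (0:ℝ) 1) g ∧
      (∀ t ∈ Icc (0:ℝ) 1, g t ≤ F t) ∧ y = g x} :=
  ⟨F x, by rintro _ ⟨g, _, h, rfl⟩; exact h x hx⟩

lemma le_convEnv {g : ℝ → ℝ} (hg : ConvexOn ℝ (Icc (0:ℝ) 1) g)
    (h : ∀ t ∈ Icc (0:ℝ) 1, g t ≤ F t) {x : ℝ} (hx : x ∈ Icc (0:ℝ) 1) : g x ≤ convEnv F x :=
  le_csSup (IsPath.convEnv_bddAbove x hx) ⟨g, hg, h, rfl⟩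

lemma convexOn_affine (m k : ℝ) : ConvexOn ℝ (Icc (0:ℝ) 1) (fun x => m + k * x) := by
  refine ⟨convex_Icc 0 1, fun x _ y _ a b _ _ hab => le_of_eq ?_⟩
  simp only [smul_eq_mul]
  linear_combination -m * hab

lemma affine_le_convEnv {m k : ℝ} (h : ∀ t ∈ Icc (0:ℝ) 1, m + k * t ≤ F t) {x : ℝ}
    (hx : x ∈ Icc (0:ℝ) 1) : m + k * x ≤ convEnv F x :=
  le_convEnv (convexOn_affine m k) h hx

namespace IsPath
variable (hF : IsPath F)

lemma convEnv_le (hF : IsPath F) {x : ℝ} (hx : x ∈ Icc (0:ℝ) 1) : convEnv F x ≤ F x := by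
  refine csSup_le ⟨0 + 0 * x, _, convexOn_affine 0 0, fun t ht => ?_, rfl⟩ ?_
  · simpa using hF.nonneg ht.1
  · rintro _ ⟨g, _, h, rfl⟩; exact h x hx

lemma convEnv_convex (hF : IsPath F) : ConvexOn ℝ (Icc (0:ℝ) 1) (convEnv F) := by
  refine ⟨convex_Icc 0 1, fun x hx y hy a b ha hb hab => ?_⟩
  refine csSup_le ⟨_, _, convexOn_affine 0 0, fun t ht => ?_, rfl⟩ ?_
  · simpa using hF.nonneg ht.1
  · rintro _ ⟨g, hg, h, rfl⟩
    refine (hg.2 hx hy ha hb hab).trans ?_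
    simp only [smul_eq_mul]
    gcongr <;> exact le_convEnv hg h ‹_›

lemma convEnv_nonneg (hF : IsPath F) {x : ℝ} (hx : x ∈ Icc (0:ℝ) 1) : 0 ≤ convEnv F x := by
  simpa using affine_le_convEnv (m := 0) (k := 0) (fun t ht => by simpa using hF.nonneg ht.1) hx

lemma convEnv_zero (hF : IsPath F) : convEnv F 0 = 0 :=
  le_antisymm ((hF.convEnv_le ⟨le_rfl, zero_le_one⟩).trans hF.zero.le)
    (hF.convEnv_nonneg ⟨le_rfl, zero_le_one⟩)

lemma le_convEnv_right (hF : IsPath F) {x : ℝ} (hx : x ∈ Icc (0:ℝ) 1) :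
    F 1 - (1 - x) ≤ convEnv F x := by
  have := affine_le_convEnv (F := F) (m := F 1 - 1) (k := 1) (fun t ht => by
    have := hF.sub_le ht.2; linarith) hx
  linarith

lemma convEnv_one (hF : IsPath F) : convEnv F 1 = F 1 :=
  le_antisymm (hF.convEnv_le ⟨zero_le_one, le_rfl⟩)
    (by have := hF.le_convEnv_right (x := 1) ⟨zero_le_one, le_rfl⟩; linarith)

lemma convEnv_mono (hF : IsPath F) {x y : ℝ} (hx : 0 ≤ x) (hxy : x ≤ y) (hy : y ≤ 1) :
    convEnv F x ≤ convEnv F y := by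
  rcases hx.eq_or_lt with rfl | hx
  · rw [hF.convEnv_zero]; exact hF.convEnv_nonneg ⟨hxy, hy⟩
  have hy0 : 0 < y := hx.trans_le hxy
  have h := hF.convEnv_convex.2 (show (0:ℝ) ∈ Icc (0:ℝ) 1 from ⟨le_rfl, zero_le_one⟩)
    (show y ∈ Icc (0:ℝ) 1 from ⟨hy0.le, hy⟩) (show 0 ≤ 1 - x / y from sub_nonneg.2 ((div_le_one hy0).2 hxy))
    (show 0 ≤ x / y by positivity) (by ring)
  simp only [smul_eq_mul, mul_zero, zero_add, hF.convEnv_zero] at h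
  rw [div_mul_cancel₀ _ hy0.ne'] at h
  exact h.trans (mul_le_of_le_one_left (hF.convEnv_nonneg ⟨hy0.le, hy⟩) ((div_le_one hy0).2 hxy))

lemma convEnv_sub_le (hF : IsPath F) {x y : ℝ} (hx : 0 ≤ x) (hxy : x ≤ y) (hy : y ≤ 1) :
    convEnv F y - convEnv F x ≤ y - x := by
  rcases hxy.eq_or_lt with rfl | hxy
  · simp
  rcases hy.eq_or_lt with rfl | hy
  · have := hF.le_convEnv_right (x := x) ⟨hx, hxy.le⟩
    rw [hF.convEnv_one]; linarith
  have h := hF.convEnv_convex.slope_mono_adjacent (x := x) (y := y) (z := 1)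
    ⟨hx, by linarith⟩ ⟨by linarith, le_rfl⟩ hxy hy
  have h2 := hF.le_convEnv_right (x := y) ⟨by linarith, hy.le⟩
  rw [hF.convEnv_one] at h
  have h3 : (F 1 - convEnv F y) / (1 - y) ≤ 1 := by
    rw [div_le_one (by linarith)]; linarith
  have h4 := h.trans h3
  rwa [div_le_one (by linarith)] at h4

end IsPath

/-- The convex envelope, extended to `ℝ` by constants. -/
noncomputable def env (F : ℝ → ℝ) (x : ℝ) : ℝ := convEnv F (max 0 (min 1 x))

lemma env_eq {x : ℝ} (hx : x ∈ Icc (0:ℝ) 1) : env F x = convEnv F x := by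
  rw [env, min_eq_right hx.2, max_eq_right hx.1]

lemma IsPath.env (hF : IsPath F) : IsPath (env F) := by
  have hm : Monotone (OpenASEP.env F) := fun x y h =>
    hF.convEnv_mono (le_max_left _ _) (max_le_max le_rfl (min_le_min le_rfl h))
      (max_le zero_le_one (min_le_left _ _))
  refine ⟨hm, ?_, ?_⟩
  · have key : ∀ x y, x ≤ y → OpenASEP.env F y - OpenASEP.env F x ≤ y - x := by
      intro x y h
      have h1 : max 0 (min 1 x) ≤ max 0 (min 1 y) := max_le_max le_rfl (min_le_min le_rfl h)
      refine (hF.convEnv_sub_le (le_max_left _ _) h1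
        (max_le zero_le_one (min_le_left _ _))).trans ?_
      rcases max_cases 0 (min 1 x) with ⟨e1, _⟩ | ⟨e1, _⟩ <;>
      rcases max_cases 0 (min 1 y) with ⟨e2, _⟩ | ⟨e2, _⟩ <;>
      rcases min_cases 1 x with ⟨e3, _⟩ | ⟨e3, _⟩ <;>
      rcases min_cases 1 y with ⟨e4, _⟩ | ⟨e4, _⟩ <;> rw [e1, e2] <;> linarith
    refine LipschitzWith.of_dist_le_mul fun x y => ?_
    rw [Real.dist_eq, Real.dist_eq, NNReal.coe_one, one_mul]
    rcases le_total x y with h | h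
    · rw [abs_of_nonpos (sub_nonpos.2 (hm h)), abs_of_nonpos (sub_nonpos.2 h)]
      linarith [key x y h]
    · rw [abs_of_nonneg (sub_nonneg.2 (hm h)), abs_of_nonneg (sub_nonneg.2 h)]
      exact key y x h
  · rw [env_eq ⟨le_rfl, zero_le_one⟩, hF.convEnv_zero]

lemma env_convex (hF : IsPath F) : ConvexOn ℝ (Icc (0:ℝ) 1) (env F) :=
  hF.convEnv_convex.congr fun _ hx => (env_eq hx).symm

lemma env_le (hF : IsPath F) {x : ℝ} (hx : x ∈ Icc (0:ℝ) 1) : env F x ≤ F x :=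
  env_eq hx ▸ hF.convEnv_le hx

lemma env_one (hF : IsPath F) : env F 1 = F 1 := by
  rw [env_eq ⟨zero_le_one, le_rfl⟩, hF.convEnv_one]

lemma affine_le_env {m k : ℝ} (h : ∀ t ∈ Icc (0:ℝ) 1, m + k * t ≤ F t) {x : ℝ}
    (hx : x ∈ Icc (0:ℝ) 1) : m + k * x ≤ env F x :=
  env_eq hx ▸ affine_le_convEnv h hx

lemma deriv_convEnv_eq {x : ℝ} (hx : x ∈ Ioo (0:ℝ) 1) :
    deriv (convEnv F) x = deriv (env F) x := by
  refine Filter.EventuallyEq.deriv_eq ?_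
  filter_upwards [Ioo_mem_nhds hx.1 hx.2] with y hy
  exact (env_eq ⟨hy.1.le, hy.2.le⟩).symm

/-- Where a path is far above its convex envelope, the envelope is affine. -/
lemma env_affine (hF : IsPath F) {p q x : ℝ} (hp : 0 ≤ p) (hpx : p ≤ x) (hxq : x ≤ q) (hq : q ≤ 1)
    (hpq : p < q) (hD : 2 * (q - p) ≤ F x - env F x) :
    env F p + (x - p) * ((env F q - env F p) / (q - p)) ≤ env F x := by
  set g := env F with hg
  set k := (g q - g p) / (q - p) with hk
  have hqp : 0 < q - p := by linarith
  have hgp : IsPath g := hF.env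
  have hkq : k * (q - p) = g q - g p := by rw [hk]; field_simp
  have hk0 : 0 ≤ k := div_nonneg (by linarith [hgp.mono hpq.le]) hqp.le
  have hconv := env_convex hF
  have key : ∀ t ∈ Icc (0:ℝ) 1, max (g t) ((g p - k * p) + k * t) ≤ F t := by
    intro t ht
    refine max_le (env_le hF ht) ?_
    rcases lt_or_ge t p with h1 | h1
    · have h := hconv.slope_mono_adjacent (x := t) (y := p) (z := q) ht ⟨by linarith, hq⟩ h1 hpq
      rw [← hg, ← hk, div_le_iff₀ (by linarith)] at h
      refine le_trans ?_ (env_le hF ht)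
      rw [← hg]; nlinarith
    rcases lt_or_ge q t with h2 | h2
    · have h := hconv.slope_mono_adjacent (x := p) (y := q) (z := t) ⟨hp, by linarith⟩ ht hpq h2
      rw [← hg, ← hk, le_div_iff₀ (by linarith)] at h
      refine le_trans ?_ (env_le hF ht)
      rw [← hg]; nlinarith
    · have e1 : F x - (q - p) ≤ F t := by
        rcases le_total x t with h | h
        · linarith [hF.mono h]
        · linarith [hF.sub_le h]
      have e2 : g q ≤ g x + (q - p) := by linarith [hgp.sub_le hxq]
      have e3 : k * (t - p) ≤ k * (q - p) := by gcongr
      nlinarith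
  have h := le_convEnv (F := F) (x := x) (g := g ⊔ fun t => (g p - k * p) + k * t)
    (hconv.sup (convexOn_affine _ _)) key ⟨by linarith, by linarith⟩
  rw [← env_eq ⟨by linarith, by linarith⟩] at h
  have h3 : (g p - k * p) + k * x ≤ g x := le_trans (le_max_right _ _) h
  linarith

end Envelope

/-- The second integrand of the rate function, as a function of the slope of the envelope. -/
noncomputable def Lfun (ρ ρ' p : ℝ) : ℝ :=
  Hent (min (max p ρ) ρ') + min (p - ρ) 0 * (Real.log ρ - Real.log (1 - ρ)) +
    max (p - ρ') 0 * (Real.log ρ' - Real.log (1 - ρ'))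

lemma Lfun_continuous (ρ ρ' : ℝ) : Continuous (Lfun ρ ρ') := by
  unfold Lfun
  have := Hent_continuous
  fun_prop

lemma Lfun_eq {ρ ρ' : ℝ} (h : ρ ≤ ρ') (p : ℝ) :
    Lfun ρ ρ' p = p * Real.log (min (max p ρ) ρ') + (1 - p) * Real.log (1 - min (max p ρ) ρ') := by
  unfold Lfun Hent
  rcases le_total p ρ with h1 | h1
  · rw [max_eq_right h1, min_eq_left h, min_eq_left (by linarith), max_eq_right (by linarith)]
    ring
  · rw [max_eq_left h1, min_eq_right (by linarith : (0:ℝ) ≤ p - ρ)]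
    rcases le_total p ρ' with h2 | h2
    · rw [min_eq_left h2, max_eq_right (by linarith)]; ring
    · rw [min_eq_right h2, max_eq_left (by linarith)]; ring

lemma Lfun_of_le {ρ ρ' p : ℝ} (h : ρ ≤ ρ') (hp : p ≤ ρ) :
    Lfun ρ ρ' p = p * Real.log ρ + (1 - p) * Real.log (1 - ρ) := by
  rw [Lfun_eq h, max_eq_right hp, min_eq_left h]

lemma Lfun_of_ge {ρ ρ' p : ℝ} (h : ρ ≤ ρ') (hp : ρ' ≤ p) :
    Lfun ρ ρ' p = p * Real.log ρ' + (1 - p) * Real.log (1 - ρ') := by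
  rw [Lfun_eq h, max_eq_left (h.trans hp), min_eq_right hp]

lemma Lfun_of_mem {ρ ρ' p : ℝ} (hp : ρ ≤ p) (hp' : p ≤ ρ') : Lfun ρ ρ' p = Hent p := by
  rw [Lfun_eq (hp.trans hp'), max_eq_left hp, min_eq_left hp']; rfl

/-- The unnormalised rate of a path. -/
noncomputable def rate (ρ ρ' : ℝ) (F : ℝ → ℝ) : ℝ :=
  (∫ x in (0:ℝ)..1, Hent (deriv F x)) + ∫ x in (0:ℝ)..1, Lfun ρ ρ' (deriv (env F) x)

lemma rate_eq {a b : ℝ} (h : a / (1 + a) ≤ 1 / (1 + b)) (F : ℝ → ℝ) :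
    (∫ x in (0:ℝ)..1, (deriv (convEnv F) x * Real.log (Gstar a b F x) +
      (1 - deriv (convEnv F) x) * Real.log (1 - Gstar a b F x))) =
    ∫ x in (0:ℝ)..1, Lfun (a / (1 + a)) (1 / (1 + b)) (deriv (env F) x) := by
  rw [intervalIntegral.integral_of_le zero_le_one, intervalIntegral.integral_of_le zero_le_one,
    integral_Ioc_eq_integral_Ioo, integral_Ioc_eq_integral_Ioo]
  refine setIntegral_congr_fun measurableSet_Ioo fun x hx => ?_
  simp only [Gstar, deriv_convEnv_eq hx, Lfun_eq h]

end OpenASEP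

namespace OpenASEP

open MeasureTheory Filter Topology Set

lemma ht_ofFn_succ {N : ℕ} (τ : Fin N → Bool) (i : Fin N) :
    (ht (List.ofFn τ) (i + 1) : ℝ) = ht (List.ofFn τ) i + if τ i then 1 else 0 := by
  unfold ht
  have h : (i : ℕ) < (List.ofFn τ).length := by simp
  rw [List.take_succ_eq_append_getElem h, List.count_append]
  cases hτ : τ i <;> simp [hτ]

section Blocks

lemma block_sum (e c : ℕ → ℝ) {n blk : ℕ → ℕ} (hn : Monotone n) (h0 : n 0 = 0)
    (hb : ∀ j i, n j ≤ i → i < n (j + 1) → blk i = j) (M : ℕ) :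
    ∑ i ∈ Finset.range (n M), (e (i + 1) - e i) * c (blk i) =
      ∑ j ∈ Finset.range M, c j * (e (n (j + 1)) - e (n j)) := by
  induction M with
  | zero => simp [h0]
  | succ M ih =>
    rw [Finset.sum_range_succ, ← ih, Finset.range_eq_Ico, Finset.range_eq_Ico,
      ← Finset.sum_Ico_consecutive _ (Nat.zero_le _) (hn (Nat.le_succ M))]
    congr 1
    rw [Finset.sum_congr rfl (g := fun i => c M * (e (i + 1) - e i)), ← Finset.mul_sum,
      Finset.sum_Ico_eq_sub _ (hn (Nat.le_succ M)), Finset.sum_range_sub, Finset.sum_range_sub]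
    · ring
    · intro i hi
      rw [Finset.mem_Ico] at hi
      rw [hb M i hi.1 hi.2, mul_comm]

lemma block_approx {e c H : ℕ → ℝ} {n blk : ℕ → ℕ} (hn : Monotone n) (h0 : n 0 = 0)
    (hb : ∀ j i, n j ≤ i → i < n (j + 1) → blk i = j) {M : ℕ} {C E : ℝ}
    (hc : ∀ j < M, |c j| ≤ C) (hE : ∀ j ≤ M, |e (n j) - H j| ≤ E) :
    ∑ j ∈ Finset.range M, c j * (H (j + 1) - H j) - 2 * M * C * E ≤
    ∑ i ∈ Finset.range (n M), (e (i + 1) - e i) * c (blk i) := by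
  rw [block_sum e c hn h0 hb, sub_le_iff_le_add, ← sub_le_iff_le_add', ← Finset.sum_sub_distrib]
  calc _ ≤ ∑ j ∈ Finset.range M, C * (2 * E) := ?_
    _ = _ := by rw [Finset.sum_const, Finset.card_range, nsmul_eq_mul]; ring
  refine Finset.sum_le_sum fun j hj => ?_
  have hj := Finset.mem_range.1 hj
  have h1 := hE j hj.le
  have h2 := hE (j + 1) hj
  rw [← mul_sub]
  refine (le_abs_self _).trans ?_
  rw [abs_mul]
  have h3 : |H (j + 1) - H j - (e (n (j + 1)) - e (n j))| ≤ 2 * E := by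
    rw [abs_le] at *; constructor <;> linarith
  exact mul_le_mul (hc j hj) h3 (abs_nonneg _) ((abs_nonneg _).trans (hc j hj))

lemma abel_lower {D φ : ℕ → ℝ} {K : ℝ} (hD0 : D 0 = 0) {M : ℕ}
    (h : ∀ m, m + 1 < M → φ m ≤ φ (m + 1) ∧ (D (m + 1) ≤ K ∨ φ (m + 1) = φ m)) (m : ℕ)
    (hm : m < M) :
    D (m + 1) * φ m - K * (φ m - φ 0) ≤ ∑ j ∈ Finset.range (m + 1), (D (j + 1) - D j) * φ j := by
  induction m with
  | zero => simp [hD0]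
  | succ m ih =>
    rw [Finset.sum_range_succ]
    have := ih (by omega)
    obtain ⟨h1, h2⟩ := h m hm
    have : D (m + 1) * (φ (m + 1) - φ m) ≤ K * (φ (m + 1) - φ m) := by
      rcases h2 with h2 | h2
      · exact mul_le_mul_of_nonneg_right h2 (by linarith)
      · simp [h2]
    nlinarith

lemma mono_of_step {φ : ℕ → ℝ} {M : ℕ} (h : ∀ m, m + 1 < M → φ m ≤ φ (m + 1)) {i j : ℕ}
    (hij : i ≤ j) (hj : j < M) : φ i ≤ φ j := by
  induction j, hij using Nat.le_induction with
  | base => exact le_rfl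
  | succ k hk ih => exact (ih (by omega)).trans (h k hj)

lemma prod_lw_eq {N : ℕ} (τ : Fin N → Bool) {g : ℕ → ℝ} (h0 : ∀ i < N, 0 < g i)
    (h1 : ∀ i < N, g i < 1) : ∏ i : Fin N, lw (g i) (τ i) =
    Real.exp (-(∑ i ∈ Finset.range N, ((ht (List.ofFn τ) (i + 1) - ht (List.ofFn τ) i) *
      Real.log (g i) + (((i + 1 : ℕ) - ht (List.ofFn τ) (i + 1) : ℝ) -
      ((i : ℕ) - ht (List.ofFn τ) i : ℝ)) * Real.log (1 - g i)))) := by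
  rw [Finset.sum_range, ← Finset.sum_neg_distrib, Real.exp_sum]
  refine Finset.prod_congr rfl fun i _ => ?_
  have hg0 := h0 i i.2
  have hg1 := h1 i i.2
  rw [ht_ofFn_succ]
  cases τ i
  · simp [lw, Real.exp_neg, Real.exp_log (show 0 < 1 - g i by linarith)]
  · simp [lw, Real.exp_neg, Real.exp_log hg0]

lemma sum_prod_bern {N : ℕ} (g : Fin N → ℝ) :
    ∑ τ : Fin N → Bool, ∏ i, (if τ i then g i else 1 - g i) = 1 := by
  have := Finset.prod_univ_sum (fun _ : Fin N => (Finset.univ : Finset Bool))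
    (fun i x => if x then g i else 1 - g i)
  rw [Fintype.piFinset_univ] at this
  rw [← this]
  simp

lemma sum_le_of_weights {N : ℕ} (O : (Fin N → Bool) → Prop) (W : (Fin N → Bool) → ℝ)
    (θ : Fin N → ℝ) (h0 : ∀ i, 0 < θ i) (h1 : ∀ i, θ i < 1) {K : ℝ} (hK : 0 ≤ K)
    (h : ∀ τ, O τ → W τ * ∏ i, lw (θ i) (τ i) ≤ K) :
    (∑ τ, if O τ then W τ else 0) ≤ K := by
  calc _ ≤ ∑ τ : Fin N → Bool, K * ∏ i, (if τ i then θ i else 1 - θ i) := ?_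
    _ = K := by rw [← Finset.mul_sum, sum_prod_bern, mul_one]
  refine Finset.sum_le_sum fun τ _ => ?_
  have hb : 0 < ∏ i, (if τ i then θ i else 1 - θ i) :=
    Finset.prod_pos fun i _ => by split_ifs; exacts [h0 i, by linarith [h1 i]]
  split_ifs with hτ
  · have e : (∏ i, lw (θ i) (τ i)) * ∏ i, (if τ i then θ i else 1 - θ i) = 1 := by
      rw [← Finset.prod_mul_distrib]
      refine Finset.prod_eq_one fun i _ => ?_
      have := h0 i; have := h1 i
      unfold lw
      split_ifs
      · field_simp
      · have : 1 - θ i ≠ 0 := by linarith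
        field_simp
    calc W τ = (W τ * ∏ i, lw (θ i) (τ i)) * ∏ i, (if τ i then θ i else 1 - θ i) := by
          rw [mul_assoc, e, mul_one]
      _ ≤ _ := mul_le_mul_of_nonneg_right (h τ hτ) hb.le
  · positivity

end Blocks

namespace Par
variable (P : Par)

/-- Upper end of the window of admissible densities. -/
noncomputable def ρ' : ℝ := 1 / (1 + P.b)

lemma ρ_lt_ρ' : P.ρ < P.ρ' := by
  have := P.ha; have := P.hb; have := P.hab
  rw [ρ, ρ', div_lt_div_iff₀ (by linarith) (by linarith)]; linarith

lemma ρ'_pos : 0 < P.ρ' := by have := P.hb; unfold ρ'; positivity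

lemma ρ'_le_one : P.ρ' ≤ 1 := by
  have := P.hb; rw [ρ', div_le_one (by linarith)]; linarith

lemma adm_of_mem {g : ℝ} (h0 : 0 < g) (h1 : g < 1) (h : P.ρ ≤ g) (h' : g ≤ P.ρ') : P.Adm g := by
  have ha := P.ha; have hb := P.hb
  refine ⟨h0, h1, ?_, ?_⟩
  · rw [ρ, div_le_iff₀ (by linarith)] at h; linarith
  · rw [ρ', le_div_iff₀ (by linarith)] at h'; linarith

end Par

end OpenASEP

namespace OpenASEP

open MeasureTheory Filter Topology Set

/-- Block slopes of a function on the grid of mesh `1 / M`. -/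
noncomputable def slopeB (F : ℝ → ℝ) (M j : ℕ) : ℝ := M * (F ((j + 1) / M) - F (j / M))

section Slopes
variable {F : ℝ → ℝ} {M : ℕ}

lemma IsPath.slopeB_nonneg (hF : IsPath F) (j : ℕ) : 0 ≤ slopeB F M j := by
  refine mul_nonneg (Nat.cast_nonneg M) (sub_nonneg.2 (hF.mono ?_))
  gcongr; linarith

lemma IsPath.slopeB_le_one (hF : IsPath F) (hM : 0 < M) (j : ℕ) : slopeB F M j ≤ 1 := by
  have hM' : (0:ℝ) < M := by exact_mod_cast hM
  have h1 : (j:ℝ) / M ≤ ((j:ℝ) + 1) / M := by gcongr; linarith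
  have h2 := hF.sub_le h1
  have h4 : ((j:ℝ) + 1) / M - j / M = 1 / M := by ring
  calc _ ≤ (M:ℝ) * (1 / M) := by unfold slopeB; gcongr; linarith
    _ = 1 := by field_simp

lemma slopeB_env_mono (hF : IsPath F) (m : ℕ) (hm : m + 1 < M) :
    slopeB (env F) M m ≤ slopeB (env F) M (m + 1) := by
  have hM' : (0:ℝ) < M := by exact_mod_cast (by omega : 0 < M)
  have hm' : (m:ℝ) + 1 + 1 ≤ M := by exact_mod_cast hm
  have h := (env_convex hF).slope_mono_adjacent (x := m / M) (y := (m + 1) / M)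
    (z := (m + 1 + 1) / M) ⟨by positivity, by rw [div_le_one hM']; linarith⟩
    ⟨by positivity, by rw [div_le_one hM']; linarith⟩ (by gcongr; linarith) (by gcongr; linarith)
  have e1 : ((m:ℝ) + 1) / M - m / M = 1 / M := by ring
  have e2 : ((m:ℝ) + 1 + 1) / M - (m + 1) / M = 1 / M := by ring
  rw [e1, e2, div_div_eq_mul_div, div_div_eq_mul_div] at h
  unfold slopeB
  push_cast
  linarith

lemma slopeB_env_eq (hF : IsPath F) (m : ℕ) (hm : m + 1 < M)
    (hD : 4 / (M : ℝ) ≤ F ((m + 1) / M) - env F ((m + 1) / M)) :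
    slopeB (env F) M (m + 1) = slopeB (env F) M m := by
  refine le_antisymm ?_ (slopeB_env_mono hF m hm)
  have hM' : (0:ℝ) < M := by exact_mod_cast (by omega : 0 < M)
  have hm' : (m:ℝ) + 1 + 1 ≤ M := by exact_mod_cast hm
  have e1 : ((m:ℝ) + 1 + 1) / M - m / M = 2 / M := by ring
  have e2 : ((m:ℝ) + 1) / M - m / M = 1 / M := by ring
  have h := env_affine hF (p := m / M) (x := (m + 1) / M) (q := (m + 1 + 1) / M) (by positivity)
    (by gcongr; linarith) (by gcongr; linarith) (by rw [div_le_one hM']; linarith)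
    (by gcongr; linarith) (by rw [e1]; refine le_trans (le_of_eq ?_) hD; ring)
  rw [e1, e2] at h
  have e3 : 1 / (M:ℝ) * ((env F ((m + 1 + 1) / M) - env F (m / M)) / (2 / M)) =
      (env F ((m + 1 + 1) / M) - env F (m / M)) / 2 := by field_simp
  rw [e3] at h
  unfold slopeB
  push_cast
  refine mul_le_mul_of_nonneg_left ?_ hM'.le
  linarith

end Slopes

/-- Cost of a slope `p` relative to the density `g`. -/
noncomputable def cost (p g : ℝ) : ℝ := p * Real.log g + (1 - p) * Real.log (1 - g)

namespace Par
variable (P : Par)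

/-- Truncated optimal density of a slope of the convex envelope. -/
noncomputable def dens (ε p : ℝ) : ℝ := clamp ε (min (max p P.ρ) P.ρ' : ℝ)

/-- Convergence of the block version of the rate, up to truncation. -/
theorem block_rate {F : ℝ → ℝ} (hF : IsPath F) {ε : ℝ} (hε : 0 < ε) :
    ∃ ε₀ : ℝ, 0 < ε₀ ∧ ε₀ ≤ 1 / 2 ∧ ε₀ ≤ P.ρ' ∧ P.ρ ≤ 1 - ε₀ ∧ ∃ M : ℕ, 0 < M ∧
      rate P.ρ P.ρ' F - ε ≤
        ∑ j ∈ Finset.range M, (1 / (M:ℝ)) * cost (slopeB F M j) (clamp ε₀ (slopeB F M j)) +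
        ∑ j ∈ Finset.range M, (1 / (M:ℝ)) *
          cost (slopeB F M j) (P.dens ε₀ (slopeB (env F) M j)) := by
  have hρ1 := P.ρ_lt_one
  have hρ0 := P.ρ_nonneg
  have hρ'0 := P.ρ'_pos
  have hρ'1 := P.ρ'_le_one
  have hρρ := P.ρ_lt_ρ'
  have hexp : Real.exp (-(ε / 8)) < 1 := by rw [Real.exp_lt_one_iff]; linarith
  obtain ⟨ε₀, h0, h1, h2, h3, h4⟩ : ∃ ε₀ : ℝ, 0 < ε₀ ∧ ε₀ ≤ 1 / 2 ∧ ε₀ ≤ P.ρ' ∧ ε₀ ≤ 1 - P.ρ ∧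
      ε₀ ≤ 1 - Real.exp (-(ε / 8)) := by
    refine ⟨min (min (1 / 2) P.ρ') (min (1 - P.ρ) (1 - Real.exp (-(ε / 8)))), ?_, ?_, ?_, ?_, ?_⟩
    · refine lt_min (lt_min (by norm_num) hρ'0) (lt_min (by linarith) (by linarith))
    · exact (min_le_left _ _).trans (min_le_left _ _)
    · exact (min_le_left _ _).trans (min_le_right _ _)
    · exact (min_le_right _ _).trans (min_le_left _ _)
    · exact (min_le_right _ _).trans (min_le_right _ _)
  refine ⟨ε₀, h0, h1, h2, by linarith, ?_⟩
  have hlog : -(ε / 8) ≤ Real.log (1 - ε₀) := by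
    rw [Real.le_log_iff_exp_le (by linarith)]; linarith
  set C := -Real.log ε₀ with hC
  have hev1 := (hF.tendsto_riemann Hent_continuous).eventually
    (lt_mem_nhds (sub_lt_self _ (show 0 < ε / 8 by linarith)))
  have hev2 := (hF.env.tendsto_riemann (Lfun_continuous P.ρ P.ρ')).eventually
    (lt_mem_nhds (sub_lt_self _ (show 0 < ε / 8 by linarith)))
  have hev3 : ∀ᶠ M : ℕ in atTop, (8 * C) * (1 / (M:ℝ)) < ε / 8 := by
    have := (tendsto_one_div_atTop_nhds_zero_nat (𝕜 := ℝ)).const_mul (8 * C)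
    rw [mul_zero] at this
    exact this.eventually (gt_mem_nhds (by linarith))
  obtain ⟨M, hr1, hr2, hr3, hM⟩ := (hev1.and (hev2.and (hev3.and (eventually_gt_atTop 0)))).exists
  refine ⟨M, hM, ?_⟩
  have hM' : (0:ℝ) < M := by exact_mod_cast hM
  have hsum1 : ∑ j ∈ Finset.range M, (1 / (M:ℝ)) = 1 := by
    rw [Finset.sum_const, Finset.card_range, nsmul_eq_mul]; field_simp
  have hA : ∑ j ∈ Finset.range M, (1 / (M:ℝ)) * Hent (slopeB F M j) + Real.log (1 - ε₀) ≤
      ∑ j ∈ Finset.range M, (1 / (M:ℝ)) * cost (slopeB F M j) (clamp ε₀ (slopeB F M j)) := by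
    calc _ = ∑ j ∈ Finset.range M, (1 / (M:ℝ)) * (Hent (slopeB F M j) + Real.log (1 - ε₀)) := by
          simp only [mul_add, Finset.sum_add_distrib]
          rw [← Finset.sum_mul, hsum1, one_mul]
      _ ≤ _ := by
        refine Finset.sum_le_sum fun j _ => mul_le_mul_of_nonneg_left ?_ (by positivity)
        exact clamp_log_le h0 h1 (hF.slopeB_nonneg j) (hF.slopeB_le_one hM j)
          (hF.slopeB_nonneg j) (hF.slopeB_le_one hM j) id id
  have hB : ∑ j ∈ Finset.range M, (1 / (M:ℝ)) * Lfun P.ρ P.ρ' (slopeB (env F) M j) +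
      Real.log (1 - ε₀) ≤ ∑ j ∈ Finset.range M, (1 / (M:ℝ)) *
        cost (slopeB (env F) M j) (P.dens ε₀ (slopeB (env F) M j)) := by
    calc _ = ∑ j ∈ Finset.range M, (1 / (M:ℝ)) *
          (Lfun P.ρ P.ρ' (slopeB (env F) M j) + Real.log (1 - ε₀)) := by
          simp only [mul_add, Finset.sum_add_distrib]
          rw [← Finset.sum_mul, hsum1, one_mul]
      _ ≤ _ := by
        refine Finset.sum_le_sum fun j _ => mul_le_mul_of_nonneg_left ?_ (by positivity)
        have hp0 := hF.env.slopeB_nonneg (M := M) j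
        have hp1 := hF.env.slopeB_le_one hM j
        set p := slopeB (env F) M j
        rw [Lfun_eq hρρ.le]
        refine clamp_log_le h0 h1 hp0 hp1 (le_min (hp0.trans (le_max_left _ _)) hρ'0.le)
          ((min_le_right _ _).trans hρ'1) (fun h => ?_) (fun h => ?_)
        · rcases min_choice (max p P.ρ) P.ρ' with h' | h' <;> rw [h'] at h
          · exact le_antisymm (h ▸ le_max_left _ _) hp0
          · linarith
        · have := h ▸ min_le_left (max p P.ρ) P.ρ'
          rcases le_max_iff.1 this with h' | h' <;> linarith
  set G : ℕ → ℝ := fun j => P.dens ε₀ (slopeB (env F) M j) with hG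
  set φ : ℕ → ℝ := fun j => Real.log (G j) - Real.log (1 - G j) with hφ
  have hG0 : ∀ j, ε₀ ≤ G j := fun j => le_clamp _ _
  have hG1 : ∀ j, G j ≤ 1 - ε₀ := fun j => clamp_le h1
  have hφb : ∀ j, |φ j| ≤ C := by
    intro j
    have b1 := Real.log_le_log h0 (hG0 j)
    have b2 : Real.log (G j) ≤ 0 := Real.log_nonpos (by linarith [hG0 j]) (by linarith [hG1 j])
    have b3 := Real.log_le_log h0 (show ε₀ ≤ 1 - G j by linarith [hG1 j])
    have b4 : Real.log (1 - G j) ≤ 0 := Real.log_nonpos (by linarith [hG1 j]) (by linarith [hG0 j])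
    rw [abs_le]; constructor <;> simp only [hφ, hC] <;> linarith
  have hφm : ∀ m, m + 1 < M → φ m ≤ φ (m + 1) := by
    intro m hm
    have h5 : G m ≤ G (m + 1) := clamp_mono _ (min_le_min (max_le_max
      (slopeB_env_mono hF m hm) le_rfl) le_rfl)
    have := Real.log_le_log (by linarith [hG0 m]) h5
    have := Real.log_le_log (by linarith [hG1 (m + 1)]) (show 1 - G (m + 1) ≤ 1 - G m by linarith)
    simp only [hφ]; linarith
  have habel := abel_lower (D := fun j => F ((j:ℝ) / M) - env F ((j:ℝ) / M)) (φ := φ)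
    (K := 4 / M) (by simp [hF.zero, hF.env.zero]) (M := M) (fun m hm => ⟨hφm m hm, by
      rcases le_total (F (((m + 1 : ℕ):ℝ) / M) - env F (((m + 1 : ℕ):ℝ) / M)) (4 / M) with h | h
      · exact Or.inl h
      · right
        push_cast at h
        have := slopeB_env_eq hF m hm h
        simp only [hφ, hG, this]⟩) (M - 1) (by omega)
  rw [Nat.sub_add_cancel hM, div_self hM'.ne', env_one hF, sub_self, zero_mul] at habel
  have hdiff : ∑ j ∈ Finset.range M, (1 / (M:ℝ)) * cost (slopeB F M j) (G j) -
      ∑ j ∈ Finset.range M, (1 / (M:ℝ)) * cost (slopeB (env F) M j) (G j) =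
      ∑ j ∈ Finset.range M, ((F (((j + 1 : ℕ):ℝ) / M) - env F (((j + 1 : ℕ):ℝ) / M)) -
        (F ((j:ℝ) / M) - env F ((j:ℝ) / M))) * φ j := by
    rw [← Finset.sum_sub_distrib]
    refine Finset.sum_congr rfl fun j _ => ?_
    simp only [cost, slopeB, hφ]
    push_cast
    field_simp
    ring
  have hKb : 4 / (M:ℝ) * (φ (M - 1) - φ 0) ≤ ε / 8 := by
    have b1 := (abs_le.1 (hφb (M - 1))).2
    have b2 := (abs_le.1 (hφb 0)).1
    calc 4 / (M:ℝ) * (φ (M - 1) - φ 0) ≤ 4 / (M:ℝ) * (2 * C) := by gcongr; linarith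
      _ = (8 * C) * (1 / M) := by ring
      _ ≤ _ := hr3.le
  unfold rate
  change _ < ∑ j ∈ Finset.range M, (1 / (M:ℝ)) * Hent (slopeB F M j) at hr1
  change _ < ∑ j ∈ Finset.range M, (1 / (M:ℝ)) * Lfun P.ρ P.ρ' (slopeB (env F) M j) at hr2
  linarith

end Par
end OpenASEP

namespace OpenASEP

open MeasureTheory Filter Topology Set

/-- A configuration whose height function is uniformly close to `N F`. -/
def Near (F : ℝ → ℝ) (r : ℝ) (N : ℕ) (u : List Bool) : Prop :=
  ∀ k ≤ N, |(ht u k : ℝ) - N * F (k / N)| ≤ r * N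

section
variable {M N : ℕ}

/-- First site of block `j` when `N` sites are cut into `M` blocks. -/
def blockStart (M N j : ℕ) : ℕ := (j * N + (M - 1)) / M

lemma blockStart_mono : Monotone (blockStart M N) := fun i j h => by
  unfold blockStart; gcongr

lemma blockStart_zero (hM : 0 < M) : blockStart M N 0 = 0 := by
  unfold blockStart; rw [zero_mul, zero_add]; exact Nat.div_eq_of_lt (by omega)

lemma blockStart_le_iff (hM : 0 < M) (j i : ℕ) : blockStart M N j ≤ i ↔ j * N ≤ i * M := by
  unfold blockStart
  rw [← Nat.lt_add_one_iff, Nat.div_lt_iff_lt_mul hM, add_mul, one_mul]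
  omega

lemma blockStart_last (hM : 0 < M) : blockStart M N M = N := by
  refine le_antisymm ((blockStart_le_iff hM _ _).2 (by rw [mul_comm])) ?_
  have := (blockStart_le_iff (N := N) hM M _).1 le_rfl
  rw [mul_comm] at this
  exact Nat.le_of_mul_le_mul_right this hM

lemma block_index (hM : 0 < M) (j i : ℕ) (h1 : blockStart M N j ≤ i)
    (h2 : i < blockStart M N (j + 1)) : i * M / N = j := by
  rw [blockStart_le_iff hM] at h1
  rw [← not_le, blockStart_le_iff hM, not_le] at h2
  exact Nat.div_eq_of_lt_le h1 h2

lemma abs_blockStart_sub (hM : 0 < M) (j : ℕ) :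
    |(blockStart M N j : ℝ) - N * (j / M)| ≤ 1 := by
  have hM' : (0:ℝ) < M := by exact_mod_cast hM
  have h1 : (j:ℝ) * N ≤ blockStart M N j * M := by
    exact_mod_cast (blockStart_le_iff (N := N) hM j _).1 le_rfl
  have h2 : (blockStart M N j : ℝ) * M ≤ j * N + M := by
    have : blockStart M N j * M ≤ j * N + (M - 1) := Nat.div_mul_le_self _ _
    have : blockStart M N j * M ≤ j * N + M := by omega
    exact_mod_cast this
  have e : (N:ℝ) * (j / M) * M = j * N := by field_simp
  rw [abs_le]
  constructor
  · by_contra hc; nlinarith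
  · by_contra hc; nlinarith

/-- Lower bound on the block cost of a configuration close to a path. -/
lemma block_cost {F : ℝ → ℝ} (hF : IsPath F) (hM : 0 < M) (hN : 0 < N) {r C : ℝ}
    {g : ℕ → ℝ} {ε₀ : ℝ} (h0 : 0 < ε₀) (hg0 : ∀ j, ε₀ ≤ g j)
    (hg1 : ∀ j, g j ≤ 1 - ε₀) (hC : C = -Real.log ε₀) (τ : Fin N → Bool)
    (hτ : Near F r N (List.ofFn τ)) :
    ∏ i : Fin N, lw (g (i * M / N)) (τ i) ≤
      Real.exp (-(N * ∑ j ∈ Finset.range M, (1 / (M:ℝ)) * cost (slopeB F M j) (g j)) +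
        4 * M * C * (r * N + 2)) := by
  have hM' : (0:ℝ) < M := by exact_mod_cast hM
  have hN' : (0:ℝ) < N := by exact_mod_cast hN
  have hcl : ∀ x : ℝ, ε₀ ≤ x → x ≤ 1 - ε₀ → |Real.log x| ≤ C := by
    intro x hx hx'
    have b1 := Real.log_le_log h0 hx
    have b2 : Real.log x ≤ 0 := Real.log_nonpos (by linarith) (by linarith)
    rw [abs_le]; constructor <;> linarith
  rw [prod_lw_eq τ (g := fun i => g (i * M / N)) (fun i _ => h0.trans_le (hg0 _))
    (fun i _ => by linarith [hg1 (i * M / N)])]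
  refine Real.exp_le_exp.2 ?_
  have hclose : ∀ j ≤ M, |(ht (List.ofFn τ) (blockStart M N j) : ℝ) - N * F (j / M)| ≤
      r * N + 1 := by
    intro j hj
    have hk : blockStart M N j ≤ N := by
      conv_rhs => rw [← blockStart_last (N := N) hM]
      exact blockStart_mono hj
    have h1 := hτ _ hk
    have h2 := hF.abs_sub_le ((blockStart M N j : ℝ) / N) (j / M)
    have h3 := abs_blockStart_sub (N := N) hM j
    have h4 : |(N:ℝ) * F ((blockStart M N j : ℝ) / N) - N * F (j / M)| ≤ 1 := by
      rw [← mul_sub, abs_mul, abs_of_pos hN']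
      refine (mul_le_mul_of_nonneg_left h2 hN'.le).trans (le_trans (le_of_eq ?_) h3)
      rw [← abs_of_pos hN', ← abs_mul, abs_of_pos hN']
      congr 1; field_simp
    calc _ = |((ht (List.ofFn τ) (blockStart M N j) : ℝ) - N * F ((blockStart M N j : ℝ) / N)) +
          (N * F ((blockStart M N j : ℝ) / N) - N * F (j / M))| := by ring_nf
      _ ≤ _ := (abs_add_le _ _).trans (add_le_add h1 h4)
  have a1 := block_approx (e := fun i => (ht (List.ofFn τ) i : ℝ)) (c := fun j => Real.log (g j))
    (H := fun j => N * F (j / M)) (n := blockStart M N) (blk := fun i => i * M / N)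
    blockStart_mono (blockStart_zero hM) (block_index hM) (M := M) (C := C) (E := r * N + 2)
    (fun j _ => hcl _ (hg0 j) (hg1 j)) (fun j hj => (hclose j hj).trans (by linarith))
  have a2 := block_approx (e := fun i => (i : ℝ) - (ht (List.ofFn τ) i : ℝ))
    (c := fun j => Real.log (1 - g j))
    (H := fun j => N * (j / M) - N * F (j / M)) (n := blockStart M N) (blk := fun i => i * M / N)
    blockStart_mono (blockStart_zero hM) (block_index hM) (M := M) (C := C) (E := r * N + 2)
    (fun j _ => hcl _ (by linarith [hg1 j]) (by linarith [hg0 j])) (fun j hj => by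
      have h1 := hclose j hj
      have h3 := abs_blockStart_sub (N := N) hM j
      rw [abs_le] at *
      constructor <;> linarith)
  rw [blockStart_last hM] at a1 a2
  rw [Finset.sum_add_distrib]
  have e : (N:ℝ) * ∑ j ∈ Finset.range M, (1 / (M:ℝ)) * cost (slopeB F M j) (g j) =
      ∑ j ∈ Finset.range M, Real.log (g j) * (N * F (((j + 1 : ℕ):ℝ) / M) - N * F ((j:ℝ) / M)) +
      ∑ j ∈ Finset.range M, Real.log (1 - g j) *
        ((N * (((j + 1 : ℕ):ℝ) / M) - N * F (((j + 1 : ℕ):ℝ) / M)) -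
        (N * ((j:ℝ) / M) - N * F ((j:ℝ) / M))) := by
    rw [← Finset.sum_add_distrib, Finset.mul_sum]
    refine Finset.sum_congr rfl fun j _ => ?_
    simp only [cost, slopeB]
    push_cast
    field_simp
    ring
  rw [e]
  linarith

end

/-- Local upper bound for the total weight of configurations close to a path. -/
theorem Par.upper_local (P : Par) {F : ℝ → ℝ} (hF : IsPath F) {ε : ℝ} (hε : 0 < ε) :
    ∃ r : ℝ, 0 < r ∧ ∃ N₀ : ℕ, ∀ N ≥ N₀,
      (∑ τ : Fin N → Bool, if Near F r N (List.ofFn τ) then P.W N τ else 0) ≤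
        Real.exp (-(N * (rate P.ρ P.ρ' F - ε))) := by
  obtain ⟨ε₀, h0, h1, h2, h3, M, hM, hrate⟩ := P.block_rate hF (half_pos hε)
  set C := -Real.log ε₀ with hC
  have hCpos : 0 < C := neg_pos.2 (Real.log_neg h0 (by linarith))
  have hM' : (0:ℝ) < M := by exact_mod_cast hM
  refine ⟨ε / (32 * M * C), by positivity, max 1 ⌈64 * M * C / ε⌉₊, fun N hN => ?_⟩
  have hN1 : 0 < N := (le_max_left _ _).trans hN
  have hN' : (0:ℝ) < N := by exact_mod_cast hN1
  have hN2 : 64 * M * C / ε ≤ N :=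
    (Nat.le_ceil _).trans (by exact_mod_cast (le_max_right _ _).trans hN)
  rw [div_le_iff₀ hε] at hN2
  set G : ℕ → ℝ := fun j => P.dens ε₀ (slopeB (env F) M j) with hG
  set Θ : ℕ → ℝ := fun j => clamp ε₀ (slopeB F M j) with hΘ
  have hG0 : ∀ j, ε₀ ≤ G j := fun j => le_clamp _ _
  have hG1 : ∀ j, G j ≤ 1 - ε₀ := fun j => clamp_le h1
  have hΘ0 : ∀ j, ε₀ ≤ Θ j := fun j => le_clamp _ _
  have hΘ1 : ∀ j, Θ j ≤ 1 - ε₀ := fun j => clamp_le h1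
  refine sum_le_of_weights _ _ (fun i => Θ (i * M / N)) (fun i => h0.trans_le (hΘ0 _))
    (fun i => by linarith [hΘ1 (i * M / N)]) (Real.exp_nonneg _) fun τ hτ => ?_
  have hblk : ∀ i : Fin N, (i:ℕ) * M / N < M := fun i => by
    rw [Nat.div_lt_iff_lt_mul hN1, mul_comm]; exact Nat.mul_lt_mul_of_pos_left i.2 hM
  have hW := P.W_le_prod τ (fun i : Fin N => G (i * M / N)) (fun i j hij => by
    refine mono_of_step (φ := G) (M := M) (fun m hm => ?_) (by gcongr; exact hij) (hblk j)
    exact clamp_mono _ (min_le_min (max_le_max (slopeB_env_mono hF m hm) le_rfl) le_rfl))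
    (fun i => by
      refine P.adm_of_mem (h0.trans_le (hG0 _)) (by linarith [hG1 (i * M / N)]) ?_ ?_
      · refine le_trans (le_min ?_ h3) (le_max_right _ _)
        exact le_min (le_max_right _ _) P.ρ_lt_ρ'.le
      · exact max_le h2 ((min_le_left _ _).trans (min_le_right _ _)))
  have c1 := block_cost hF hM hN1 h0 hG0 hG1 hC τ hτ
  have c2 := block_cost hF hM hN1 h0 hΘ0 hΘ1 hC τ hτ
  calc P.W N τ * ∏ i : Fin N, lw (Θ (i * M / N)) (τ i)
      ≤ _ * _ := mul_le_mul (hW.trans c1) c2 (Finset.prod_nonneg fun i _ =>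
        (lw_pos (h0.trans_le (hΘ0 _)) (by linarith [hΘ1 (i * M / N)]) _).le) (Real.exp_nonneg _)
    _ = _ := (Real.exp_add _ _).symm
    _ ≤ _ := by
      refine Real.exp_le_exp.2 ?_
      have e : 4 * M * C * (ε / (32 * M * C) * N + 2) = ε / 8 * N + 8 * M * C := by
        field_simp; ring
      rw [e]
      have := mul_le_mul_of_nonneg_left hrate hN'.le
      simp only [hG, hΘ] at *
      nlinarith

end OpenASEP

namespace OpenASEP

open MeasureTheory Filter Topology Set

lemma le_Lfun_left {ρ ρ' p : ℝ} (h0 : 0 < ρ) (h : ρ < ρ') (h1 : ρ' ≤ 1) (hp0 : 0 ≤ p)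
    (hp1 : p ≤ 1) : p * Real.log ρ + (1 - p) * Real.log (1 - ρ) ≤ Lfun ρ ρ' p := by
  rcases le_total p ρ with h2 | h2
  · rw [Lfun_of_le h.le h2]
  rcases le_or_gt p ρ' with h3 | h3
  · rw [Lfun_of_mem h2 h3]; exact gibbs hp0 hp1 h0 (by linarith)
  · rw [Lfun_of_ge h.le h3.le]
    have g := gibbs (y := ρ') (by linarith) h1 h0 (by linarith)
    unfold Hent at g
    have l1 := Real.log_le_log h0 h.le
    have l2 := Real.log_le_log (show 0 < 1 - ρ' by linarith) (show 1 - ρ' ≤ 1 - ρ by linarith)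
    nlinarith

lemma le_Lfun_right {ρ ρ' p : ℝ} (h0 : 0 ≤ ρ) (h : ρ < ρ') (h1 : ρ' < 1) (hp0 : 0 ≤ p)
    (hp1 : p ≤ 1) : p * Real.log ρ' + (1 - p) * Real.log (1 - ρ') ≤ Lfun ρ ρ' p := by
  rcases le_total ρ' p with h2 | h2
  · rw [Lfun_of_ge h.le h2]
  rcases le_or_gt ρ p with h3 | h3
  · rw [Lfun_of_mem h3 h2]; exact gibbs hp0 hp1 (by linarith) h1
  · rw [Lfun_of_le h.le h3.le]
    have g := gibbs (y := ρ) h0 (by linarith) (show 0 < ρ' by linarith) h1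
    unfold Hent at g
    have l1 := Real.log_le_log (show 0 < ρ by linarith) h.le
    have l2 := Real.log_le_log (show 0 < 1 - ρ' by linarith) (show 1 - ρ' ≤ 1 - ρ by linarith)
    nlinarith

section
variable {F : ℝ → ℝ}

/-- A point where `F` touches a line of slope `k` from above. -/
def TouchAt (F : ℝ → ℝ) (k s : ℝ) : Prop :=
  s ∈ Icc (0:ℝ) 1 ∧ ∀ x ∈ Icc (0:ℝ) 1, F s - k * s ≤ F x - k * x

lemma IsPath.exists_touch_left (hF : IsPath F) (k : ℝ) :
    ∃ s, TouchAt F k s ∧ (k = 0 → s = 0) := by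
  by_cases hk : k = 0
  · refine ⟨0, ⟨⟨le_rfl, zero_le_one⟩, fun x hx => ?_⟩, fun _ => rfl⟩
    have := hF.mono hx.1
    simp [hk, this]
  · obtain ⟨s, hs, h⟩ := (isCompact_Icc (a := (0:ℝ)) (b := 1)).exists_isMinOn
      (nonempty_Icc.2 zero_le_one) (f := fun x => F x - k * x)
      (by have := hF.continuous; fun_prop)
    exact ⟨s, ⟨hs, fun x hx => h hx⟩, fun h => absurd h hk⟩

lemma IsPath.exists_touch_right (hF : IsPath F) (k : ℝ) :
    ∃ s, TouchAt F k s ∧ (k = 1 → s = 1) := by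
  by_cases hk : k = 1
  · refine ⟨1, ⟨⟨zero_le_one, le_rfl⟩, fun x hx => ?_⟩, fun _ => rfl⟩
    have := hF.sub_le hx.2
    subst hk; linarith
  · obtain ⟨s, hs, h⟩ := (isCompact_Icc (a := (0:ℝ)) (b := 1)).exists_isMinOn
      (nonempty_Icc.2 zero_le_one) (f := fun x => F x - k * x)
      (by have := hF.continuous; fun_prop)
    exact ⟨s, ⟨hs, fun x hx => h hx⟩, fun h => absurd h hk⟩

lemma TouchAt.le {k k' s t : ℝ} (hk : k < k') (hs : TouchAt F k s) (ht : TouchAt F k' t) :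
    s ≤ t := by
  have h1 := hs.2 t ht.1
  have h2 := ht.2 s hs.1
  by_contra hc
  nlinarith

lemma TouchAt.le_env {k s x : ℝ} (hs : TouchAt F k s) (hx : x ∈ Icc (0:ℝ) 1) :
    F s + k * (x - s) ≤ env F x := by
  have := affine_le_env (F := F) (m := F s - k * s) (k := k)
    (fun t ht => by linarith [hs.2 t ht]) hx
  linarith

lemma TouchAt.env_eq (hF : IsPath F) {k s : ℝ} (hs : TouchAt F k s) : env F s = F s :=
  le_antisymm (env_le hF hs.1) (by have := hs.le_env hs.1; linarith)

/-- Between the contact points the slope of the envelope lies in the window. -/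
lemma deriv_env_mem (hF : IsPath F) {k k' s t x : ℝ} (hs : TouchAt F k s) (ht : TouchAt F k' t)
    (hsx : s < x) (hxt : x < t) (hd : DifferentiableAt ℝ (env F) x) :
    k ≤ deriv (env F) x ∧ deriv (env F) x ≤ k' := by
  have hx : x ∈ Icc (0:ℝ) 1 := ⟨hs.1.1.trans hsx.le, hxt.le.trans ht.1.2⟩
  constructor
  · have h := (env_convex hF).slope_le_deriv hs.1 hx hsx hd
    refine le_trans ?_ h
    rw [slope_def_field, le_div_iff₀ (by linarith), hs.env_eq hF]
    linarith [hs.le_env hx]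
  · have h := (env_convex hF).deriv_le_slope hx ht.1 hxt hd
    refine le_trans h ?_
    rw [slope_def_field, div_le_iff₀ (by linarith), ht.env_eq hF]
    linarith [ht.le_env hx]

/-- Truncated block slopes. -/
noncomputable def cslope (ε : ℝ) (F : ℝ → ℝ) (n j : ℕ) : ℝ := clamp ε (slopeB F n j)

lemma IsPath.abs_sum_cslope (hF : IsPath F) {ε : ℝ} (h0 : 0 ≤ ε) (h : ε ≤ 1 / 2) {n : ℕ}
    (hn : 0 < n) (i k : ℕ) :
    |∑ j ∈ Finset.range k, cslope ε F n (i + j) - (n * F ((i + k : ℕ) / n) - n * F (i / n))| ≤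
      ε * k := by
  have e : n * F ((i + k : ℕ) / n) - n * F (i / n) =
      ∑ j ∈ Finset.range k, slopeB F n (i + j) := by
    have := Finset.sum_range_sub (fun j => n * F (((i + j : ℕ) : ℝ) / n)) k
    simp only [add_zero] at this
    rw [← this]
    refine Finset.sum_congr rfl fun j _ => ?_
    unfold slopeB; push_cast; rw [add_assoc]; ring
  rw [e, ← Finset.sum_sub_distrib]
  refine (Finset.abs_sum_le_sum_abs _ _).trans ?_
  calc _ ≤ ∑ j ∈ Finset.range k, ε := Finset.sum_le_sum fun j _ =>
        abs_clamp_sub_le h0 h (hF.slopeB_nonneg _) (hF.slopeB_le_one hn _)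
    _ = _ := by rw [Finset.sum_const, Finset.card_range, nsmul_eq_mul, mul_comm]

lemma IsPath.Hent_cslope_le (hF : IsPath F) {ε : ℝ} (h0 : 0 < ε) (h : ε ≤ 1 / 2) {n : ℕ}
    (hn : 0 < n) (j : ℕ) :
    Hent (cslope ε F n j) ≤ n * ∫ x in ((j:ℝ) / n)..((j + 1 : ℕ) / n : ℝ), Hent (deriv F x) := by
  have hn' : (0:ℝ) < n := by exact_mod_cast hn
  have := hF.jensen h0 h (u := (j:ℝ) / n) (v := ((j + 1 : ℕ) / n : ℝ)) (by gcongr; simp)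
  have e : ((j + 1 : ℕ) / n : ℝ) - j / n = 1 / n := by push_cast; ring
  have e2 : (F ((j + 1 : ℕ) / n : ℝ) - F (j / n)) / (1 / n) = slopeB F n j := by
    unfold slopeB; push_cast; field_simp
  rw [e, e2] at this
  calc Hent (cslope ε F n j) = n * (1 / n * Hent (clamp ε (slopeB F n j))) := by
        rw [← mul_assoc, mul_one_div_cancel hn'.ne', one_mul]; rfl
    _ ≤ _ := mul_le_mul_of_nonneg_left this hn'.le

lemma IsPath.sum_Hent_cslope_le (hF : IsPath F) {ε : ℝ} (h0 : 0 < ε) (h : ε ≤ 1 / 2) {n : ℕ}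
    (hn : 0 < n) :
    ∑ j ∈ Finset.range n, Hent (cslope ε F n j) ≤ n * ∫ x in (0:ℝ)..1, Hent (deriv F x) := by
  have hn' : (0:ℝ) < n := by exact_mod_cast hn
  have e := intervalIntegral.sum_integral_adjacent_intervals (μ := volume)
    (f := fun x => Hent (deriv F x)) (a := fun j : ℕ => (j:ℝ) / n) (n := n)
    (fun k _ => hF.intervalIntegrable_comp Hent_continuous _ _)
  simp only [Nat.cast_zero, zero_div, div_self hn'.ne'] at e
  rw [← e, Finset.mul_sum]
  exact Finset.sum_le_sum fun j _ => hF.Hent_cslope_le h0 h hn j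

lemma sum_Hent_env_le (hF : IsPath F) {ε : ℝ} (h0 : 0 < ε) (h : ε ≤ 1 / 2) {n : ℕ}
    (hn : 0 < n) {k k' s t C : ℝ} (hs : TouchAt F k s) (ht : TouchAt F k' t)
    (hC0 : 0 ≤ C) (hC : ∀ p ∈ Icc (0:ℝ) 1, -C ≤ Lfun k k' p) {n₁ n₂ : ℕ} (h12 : n₁ ≤ n₂)
    (hn1 : n * s ≤ n₁ + 1) (hn2 : n₂ ≤ n * t) :
    ∑ j ∈ Finset.range (n₂ - n₁), Hent (cslope ε (env F) n (n₁ + j)) ≤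
      n * (∫ x in ((n₁:ℝ) / n)..((n₂:ℝ) / n), Lfun k k' (deriv (env F) x)) + C := by
  have hn' : (0:ℝ) < n := by exact_mod_cast hn
  have e := intervalIntegral.sum_integral_adjacent_intervals (μ := volume)
    (f := fun x => Lfun k k' (deriv (env F) x)) (a := fun j : ℕ => ((n₁ + j : ℕ):ℝ) / n)
    (n := n₂ - n₁) (fun _ _ => hF.env.intervalIntegrable_comp (Lfun_continuous k k') _ _)
  simp only [add_zero, Nat.add_sub_cancel' h12] at e
  rw [← e, Finset.mul_sum]
  have hcell : ∀ j ∈ Finset.range (n₂ - n₁), Hent (cslope ε (env F) n (n₁ + j)) ≤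
      n * (∫ x in (((n₁ + j : ℕ):ℝ) / n)..(((n₁ + (j + 1) : ℕ):ℝ) / n),
        Lfun k k' (deriv (env F) x)) + if j = 0 then C else 0 := by
    intro j hj
    rw [Finset.mem_range] at hj
    have hle : ((n₁ + j : ℕ):ℝ) / n ≤ ((n₁ + (j + 1) : ℕ):ℝ) / n := by gcongr; simp
    by_cases hj0 : j = 0
    · rw [if_pos hj0]
      have a1 : Hent (cslope ε (env F) n (n₁ + j)) ≤ 0 :=
        Hent_nonpos (h0.le.trans (le_clamp _ _)) ((clamp_le h).trans (by linarith))
      have a2 : ∫ x in (((n₁ + j : ℕ):ℝ) / n)..(((n₁ + (j + 1) : ℕ):ℝ) / n), (-C) ≤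
          ∫ x in (((n₁ + j : ℕ):ℝ) / n)..(((n₁ + (j + 1) : ℕ):ℝ) / n),
            Lfun k k' (deriv (env F) x) :=
        intervalIntegral.integral_mono_on hle intervalIntegrable_const
          (hF.env.intervalIntegrable_comp (Lfun_continuous k k') _ _)
          fun x _ => hC _ ⟨hF.env.deriv_nonneg x, hF.env.deriv_le_one x⟩
      have e1 : ((n₁ + (j + 1) : ℕ):ℝ) / n - ((n₁ + j : ℕ):ℝ) / n = 1 / n := by push_cast; ring
      rw [intervalIntegral.integral_const, e1, smul_eq_mul] at a2
      have a3 := mul_le_mul_of_nonneg_left a2 hn'.le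
      rw [← mul_assoc, mul_one_div_cancel hn'.ne'] at a3
      linarith
    · rw [if_neg hj0, add_zero]
      refine (hF.env.Hent_cslope_le h0 h hn (n₁ + j)).trans (le_of_eq ?_)
      congr 1
      refine intervalIntegral.integral_congr_ae ?_
      have hne : ∀ᵐ x : ℝ, x ≠ ((n₁ + (j + 1) : ℕ):ℝ) / n := by
        simp [ae_iff]
      filter_upwards [hF.env.lip.ae_differentiableAt, hne] with x hx hx2 hx1
      rw [add_assoc, uIoc_of_le hle] at hx1
      have b1 : s < x := by
        refine lt_of_le_of_lt ?_ hx1.1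
        rw [le_div_iff₀ hn']
        have : (1:ℝ) ≤ j := by exact_mod_cast Nat.one_le_iff_ne_zero.2 hj0
        push_cast; linarith
      have b2 : x < t := by
        refine lt_of_lt_of_le (lt_of_le_of_ne hx1.2 hx2) ?_
        rw [div_le_iff₀ hn']
        have : ((n₁ + (j + 1) : ℕ):ℝ) ≤ n₂ := by exact_mod_cast (by omega)
        linarith
      obtain ⟨c1, c2⟩ := deriv_env_mem hF hs ht b1 b2 hx
      exact (Lfun_of_mem c1 c2).symm
  refine (Finset.sum_le_sum hcell).trans ?_
  rw [Finset.sum_add_distrib, add_le_add_iff_left]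
  rw [Finset.sum_ite_eq']
  split_ifs <;> linarith

lemma integral_affine_deriv (hF : IsPath F) (A B u v : ℝ) :
    ∫ x in u..v, (deriv F x * A + (1 - deriv F x) * B) =
      (F v - F u) * A + ((v - u) - (F v - F u)) * B := by
  have hint : IntervalIntegrable (deriv F) volume u v :=
    hF.intervalIntegrable_comp (L := fun p => p) continuous_id _ _
  rw [intervalIntegral.integral_add (hint.mul_const _)
    ((intervalIntegrable_const.sub hint).mul_const _), intervalIntegral.integral_mul_const,
    intervalIntegral.integral_mul_const, intervalIntegral.integral_sub intervalIntegrable_const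
    hint, hF.integral_deriv]
  simp

/-- Total discrete energy of the three-piece construction. -/
theorem energy_le (hF : IsPath F) {ρ ρ' s t : ℝ} (hρ : 0 ≤ ρ) (hρρ : ρ < ρ') (hρ' : ρ' ≤ 1)
    (hs : TouchAt F ρ s) (hs0 : ρ = 0 → s = 0) (ht : TouchAt F ρ' t) (ht1 : ρ' = 1 → t = 1) :
    ∃ C : ℝ, ∀ n : ℕ, 0 < n → ∀ ε : ℝ, 0 < ε → ε ≤ 1 / 2 → ∀ n₁ n₂ : ℕ,
      n₁ = ⌊n * s⌋₊ → n₂ = ⌊n * t⌋₊ →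
      (∑ j ∈ Finset.range n, Hent (cslope ε F n j)) +
      (∑ j ∈ Finset.range (n₂ - n₁), Hent (cslope ε (env F) n (n₁ + j))) +
      (n * F (n₁ / n) * Real.log ρ + (n₁ - n * F (n₁ / n)) * Real.log (1 - ρ)) +
      ((n * F 1 - n * F (n₂ / n)) * Real.log ρ' +
        ((n - n₂) - (n * F 1 - n * F (n₂ / n))) * Real.log (1 - ρ')) ≤
      n * rate ρ ρ' F + C := by
  obtain ⟨C₀, hC₀⟩ := (isCompact_Icc (a := (0:ℝ)) (b := 1)).exists_bound_of_continuousOn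
    (Lfun_continuous ρ ρ').continuousOn
  have hC0 : 0 ≤ C₀ := (norm_nonneg _).trans (hC₀ 0 ⟨le_rfl, zero_le_one⟩)
  set Cl := |Real.log ρ| + |Real.log (1 - ρ)| with hCl
  set Cr := |Real.log ρ'| + |Real.log (1 - ρ')| with hCr
  refine ⟨C₀ + 2 * Cl + 2 * Cr, ?_⟩
  rintro n hn ε h0 h n₁ n₂ rfl rfl
  have hn' : (0:ℝ) < n := by exact_mod_cast hn
  have hst : s ≤ t := hs.le hρρ ht
  set n₁ := ⌊n * s⌋₊ with hn1
  set n₂ := ⌊n * t⌋₊ with hn2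
  have h12 : n₁ ≤ n₂ := Nat.floor_mono (by gcongr)
  have f1 : (n₁:ℝ) ≤ n * s := Nat.floor_le (mul_nonneg hn'.le hs.1.1)
  have f2 : (n:ℝ) * s < n₁ + 1 := Nat.lt_floor_add_one _
  have f3 : (n₂:ℝ) ≤ n * t := Nat.floor_le (mul_nonneg hn'.le ht.1.1)
  have f4 : (n:ℝ) * t < n₂ + 1 := Nat.lt_floor_add_one _
  have E1 := hF.sum_Hent_cslope_le h0 h hn
  have E2 := sum_Hent_env_le hF h0 h hn hs ht hC0
    (fun p hp => (abs_le.1 (hC₀ p hp)).1) h12 f2.le f3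
  have near : ∀ (k x : ℝ) (m : ℕ), TouchAt F k x → (m:ℝ) ≤ n * x → (n:ℝ) * x < m + 1 →
      |n * F (m / n) - n * env F (m / n)| ≤ 2 := by
    intro k x m hx g1 g2
    have g3 : (m:ℝ) / n ≤ x := by rw [div_le_iff₀ hn']; linarith
    have i1 := hF.mono g3
    have i2 := hF.sub_le g3
    have i3 := hF.env.mono g3
    have i4 := hF.env.sub_le g3
    rw [hx.env_eq hF] at i3 i4
    have i5 : n * (x - m / n) ≤ 1 := by rw [mul_sub, mul_div_cancel₀ _ hn'.ne']; linarith
    have j1 := mul_le_mul_of_nonneg_left i2 hn'.le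
    have j2 := mul_le_mul_of_nonneg_left i4 hn'.le
    have j3 := mul_le_mul_of_nonneg_left i1 hn'.le
    have j4 := mul_le_mul_of_nonneg_left i3 hn'.le
    rw [abs_le]; constructor <;> linarith
  have replace_le : ∀ A B z w c : ℝ, |z - w| ≤ 2 →
      z * A + (c - z) * B ≤ w * A + (c - w) * B + 2 * (|A| + |B|) := by
    intro A B z w c hz
    have k1 : (z - w) * A ≤ 2 * |A| := (le_abs_self _).trans (by rw [abs_mul]; gcongr)
    have k2 : (w - z) * B ≤ 2 * |B| :=
      (le_abs_self _).trans (by rw [abs_mul, abs_sub_comm]; gcongr)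
    linarith
  have E3 : n * F (n₁ / n) * Real.log ρ + (n₁ - n * F (n₁ / n)) * Real.log (1 - ρ) ≤
      n * (∫ x in (0:ℝ)..((n₁:ℝ) / n), Lfun ρ ρ' (deriv (env F) x)) + 2 * Cl := by
    refine (replace_le _ _ _ (n * env F (n₁ / n)) _ (near ρ s n₁ hs f1 f2)).trans ?_
    rw [add_le_add_iff_right]
    rcases hρ.eq_or_lt with hz | hpos
    · have : n₁ = 0 := by rw [hn1, hs0 hz.symm]; simp
      simp [this, hF.env.zero]
    · have m := intervalIntegral.integral_mono_on (a := (0:ℝ)) (b := (n₁:ℝ) / n) (by positivity)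
        (hF.env.intervalIntegrable_comp
          (L := fun p => p * Real.log ρ + (1 - p) * Real.log (1 - ρ)) (by fun_prop) _ _)
        (hF.env.intervalIntegrable_comp (Lfun_continuous ρ ρ') _ _)
        (fun x _ => le_Lfun_left hpos hρρ hρ' (hF.env.deriv_nonneg x) (hF.env.deriv_le_one x))
      rw [integral_affine_deriv hF.env, hF.env.zero] at m
      refine le_trans (le_of_eq ?_) (mul_le_mul_of_nonneg_left m hn'.le)
      field_simp; ring
  have E4 : (n * F 1 - n * F (n₂ / n)) * Real.log ρ' +
        ((n - n₂) - (n * F 1 - n * F (n₂ / n))) * Real.log (1 - ρ') ≤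
      n * (∫ x in ((n₂:ℝ) / n)..1, Lfun ρ ρ' (deriv (env F) x)) + 2 * Cr := by
    refine (replace_le _ _ _ (n * F 1 - n * env F (n₂ / n)) _ ?_).trans ?_
    · have := near ρ' t n₂ ht f3 f4
      rwa [sub_sub_sub_cancel_left, abs_sub_comm]
    rw [add_le_add_iff_right]
    rcases hρ'.eq_or_lt with hz | hpos
    · have : n₂ = n := by rw [hn2, ht1 hz]; simp
      simp [this, hn'.ne', env_one hF]
    · have hle : (n₂:ℝ) / n ≤ 1 := by
        rw [div_le_one hn']
        nlinarith [ht.1.2]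
      have m := intervalIntegral.integral_mono_on (a := (n₂:ℝ) / n) (b := 1) hle
        (hF.env.intervalIntegrable_comp
          (L := fun p => p * Real.log ρ' + (1 - p) * Real.log (1 - ρ')) (by fun_prop) _ _)
        (hF.env.intervalIntegrable_comp (Lfun_continuous ρ ρ') _ _)
        (fun x _ => le_Lfun_right hρ hρρ hpos (hF.env.deriv_nonneg x) (hF.env.deriv_le_one x))
      rw [integral_affine_deriv hF.env, env_one hF] at m
      refine le_trans (le_of_eq ?_) (mul_le_mul_of_nonneg_left m hn'.le)
      field_simp
  have hi := fun u v => hF.env.intervalIntegrable_comp (Lfun_continuous ρ ρ') u v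
  have hadd : (∫ x in (0:ℝ)..((n₁:ℝ) / n), Lfun ρ ρ' (deriv (env F) x)) +
      (∫ x in ((n₁:ℝ) / n)..((n₂:ℝ) / n), Lfun ρ ρ' (deriv (env F) x)) +
      (∫ x in ((n₂:ℝ) / n)..1, Lfun ρ ρ' (deriv (env F) x)) =
      ∫ x in (0:ℝ)..1, Lfun ρ ρ' (deriv (env F) x) := by
    rw [intervalIntegral.integral_add_adjacent_intervals (hi _ _) (hi _ _),
      intervalIntegral.integral_add_adjacent_intervals (hi _ _) (hi _ _)]
  unfold rate
  rw [← hadd]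
  linarith

end

end OpenASEP

namespace OpenASEP
open MeasureTheory Filter Topology Set

variable {F : ℝ → ℝ}

/-- The word `u` read at sites `i₀, i₀ + 1, …` stays within `D` of the profile `n F(·/n)`. -/
def Follows (F : ℝ → ℝ) (n i₀ : ℕ) (D : ℝ) (u : List Bool) : Prop :=
  ∀ i ≤ u.length, |(ht u i : ℝ) - (n * F ((i₀ + i : ℕ) / n) - n * F (i₀ / n))| ≤ D

lemma ht_drop (u : List Bool) (k : ℕ) : (u.drop k).count true + ht u k = ht u u.length := by
  have := List.count_append (a := true) (l₁ := u.take k) (l₂ := u.drop k)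
  rw [List.take_append_drop] at this
  rw [ht, ht, List.take_length]; omega

lemma follows_lower (hF : IsPath F) {δ : ℝ} (hδ : 0 < δ) (hδ1 : δ ≤ 1 / 2) :
    ∃ N₀ : ℕ, ∀ N ≥ N₀, ∀ n ≤ N, 0 < n → ∀ i₀ l, l ≤ n →
      Real.exp (-(∑ j ∈ Finset.range l, Hent (cslope δ F n (i₀ + j))) - δ * N) ≤
        wordSum l (fun u => if Follows F n i₀ (2 * δ * N) u then 1 else 0) := by
  obtain ⟨N₀, h⟩ := tube_lower hδ hδ
  refine ⟨N₀, fun N hN n hn hn0 i₀ l hl => ?_⟩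
  refine (h N hN l (hl.trans hn) (fun j => cslope δ F n (i₀ + j))
    (fun j => le_clamp δ _) (fun j => clamp_le hδ1)).trans (wordSum_mono fun u hu => ?_)
  split_ifs with h1 h2 h2
  · exact le_rfl
  · refine absurd (fun i hi => ?_) h2
    have a := h1 i (hu ▸ hi)
    have b := hF.abs_sum_cslope hδ.le hδ1 hn0 i₀ i
    have hiN : (i:ℝ) ≤ N := by exact_mod_cast (hi.trans (hu.le.trans (hl.trans hn)))
    have := mul_le_mul_of_nonneg_left hiN hδ.le
    rw [abs_le] at a b ⊢
    constructor <;> linarith [a.1, a.2, b.1, b.2]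
  · exact zero_le_one
  · exact le_rfl

lemma Follows.append {n i₀ : ℕ} {D D' : ℝ} {u v : List Bool} (hu : Follows F n i₀ D u)
    (hv : Follows F n (i₀ + u.length) D' v) (hD' : 0 ≤ D') : Follows F n i₀ (D + D') (u ++ v) := by
  intro i hi
  rcases le_total i u.length with h | h
  · have := hu i h
    rw [show ht (u ++ v) i = ht u i by simp [ht, List.take_append_of_le_length h]]
    linarith
  · obtain ⟨k, rfl⟩ := Nat.exists_eq_add_of_le h
    have a := hu _ le_rfl
    have b := hv k (by simpa using hi)
    rw [ht_append, Nat.add_sub_cancel_left, ht_of_length_le h, ← ht_of_length_le le_rfl, Nat.cast_add]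
    rw [add_assoc] at b
    rw [abs_le] at a b ⊢
    constructor <;> linarith [a.1, a.2, b.1, b.2]

lemma sublist_ht {u w : List Bool} (h : List.Sublist u w) (k : ℕ) (hk : k ≤ w.length) :
    ∃ k' ≤ u.length, k' ≤ k ∧ k + u.length ≤ k' + w.length ∧ ht u k' ≤ ht w k ∧
      ht w k + u.length ≤ ht u k' + w.length := by
  induction h generalizing k with
  | slnil => exact ⟨0, by simp, by simp, by simpa using hk, by simp [ht], by simp [ht]⟩
  | @cons l₁ l₂ x h ih =>
    cases k with
    | zero => exact ⟨0, by simp, by simp, by have := h.length_le; simp; omega, by simp [ht],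
        by have := h.length_le; simp [ht]; omega⟩
    | succ k =>
      obtain ⟨k', a, b, c, d, e⟩ := ih k (by simpa using hk)
      refine ⟨k', a, by omega, by simp; omega, ?_, ?_⟩ <;>
      cases x <;> simp only [ht_true, ht_false, List.length_cons] <;> omega
  | @cons_cons l₁ l₂ x h ih =>
    cases k with
    | zero => exact ⟨0, by simp, by simp, by have := h.length_le; simp; omega, by simp [ht],
        by have := h.length_le; simp [ht]; omega⟩
    | succ k =>
      obtain ⟨k', a, b, c, d, e⟩ := ih k (by simpa using hk)
      refine ⟨k' + 1, by simpa using a, by omega, by simp; omega, ?_, ?_⟩ <;>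
      cases x <;> simp only [ht_true, ht_false, List.length_cons] <;> omega

/-- Inserting few letters keeps a word close to the profile. -/
lemma Follows.near_of_sublist (hF : IsPath F) {n N K : ℕ} {D r : ℝ} {u w : List Bool}
    (hu : Follows F n 0 D u) (h : List.Sublist u w) (hn : u.length = n) (hw : w.length = N)
    (hn0 : 0 < n) (hK : N = n + K) (hr : D + 3 * K ≤ r * N) : Near F r N w := by
  intro k hk
  obtain ⟨k', h1, h2, h3, h4, h5⟩ := sublist_ht h k (hw ▸ hk)
  have a := hu k' h1
  subst hw
  rw [hn] at h1 h3 h5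
  simp only [zero_add, Nat.cast_zero, zero_div, hF.zero, mul_zero, sub_zero] at a
  have hn' : (0:ℝ) < n := by exact_mod_cast hn0
  have hN' : (0:ℝ) < w.length := by rw [hK]; push_cast; positivity
  have hK' : (w.length : ℝ) = n + K := by exact_mod_cast hK
  have h1' : (k':ℝ) ≤ n := by exact_mod_cast h1
  have h2' : (k':ℝ) ≤ k := by exact_mod_cast h2
  have hk' : (k:ℝ) ≤ w.length := by exact_mod_cast hk
  have h3' : (k:ℝ) + n ≤ k' + w.length := by exact_mod_cast h3
  have h4' : (ht u k':ℝ) ≤ ht w k := by exact_mod_cast h4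
  have h5' : (ht w k:ℝ) + n ≤ ht u k' + w.length := by exact_mod_cast h5
  have hK0 : (0:ℝ) ≤ K := by positivity
  have hx0 : (0:ℝ) ≤ k' / n := by positivity
  have hx1 : (k':ℝ) / n ≤ 1 := by rw [div_le_one hn']; exact h1'
  have f0 := hF.nonneg hx0
  have f1 := (hF.le_self hx0).trans hx1
  have g := hF.abs_sub_le (k'/n) (k/w.length)
  have e : |(w.length:ℝ) * (k'/n - k/w.length)| ≤ K := by
    have : (w.length:ℝ) * (k'/n - k/w.length) = K * (k'/n) - (k - k') := by
      field_simp; rw [hK']; ring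
    rw [this, abs_le]
    constructor <;> nlinarith
  rw [abs_mul, abs_of_pos hN'] at e
  have g' := (mul_le_mul_of_nonneg_left g hN'.le).trans e
  rw [← abs_of_pos hN', ← abs_mul, abs_of_pos hN', abs_le] at g'
  rw [abs_le] at a ⊢
  have e2 : (K:ℝ) * F (k'/n) ≤ K := by nlinarith
  have e3 : 0 ≤ (K:ℝ) * F (k'/n) := by positivity
  have e4 : (w.length:ℝ) * F (k'/n) = n * F (k'/n) + K * F (k'/n) := by rw [hK']; ring
  constructor <;> linarith [a.1, a.2, g'.1, g'.2]

end OpenASEP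

namespace OpenASEP
open MeasureTheory Filter Topology Set Par

variable {F : ℝ → ℝ}

lemma TouchAt.floor {k s : ℝ} (hs : TouchAt F k s) (n : ℕ) :
    ((⌊n * s⌋₊ : ℕ) : ℝ) ≤ n * s ∧ n * s < (⌊n * s⌋₊ : ℕ) + 1 ∧ ⌊n * s⌋₊ ≤ n := by
  have h0 : 0 ≤ n * s := mul_nonneg (by positivity) hs.1.1
  refine ⟨Nat.floor_le h0, Nat.lt_floor_add_one _, ?_⟩
  have : (n:ℝ) * s ≤ n := mul_le_of_le_one_right (by positivity) hs.1.2
  exact Nat.floor_le_of_le this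

/-- Scaled one-sided bounds at the rounding of a touching point. -/
lemma TouchAt.left_bound (hF : IsPath F) {ρ s : ℝ} (hs : TouchAt F ρ s) (hρ : 0 ≤ ρ)
    (hρ1 : ρ ≤ 1) {n : ℕ} (hn : 0 < n) {k : ℕ} (hk : k ≤ n) :
    n * F ((⌊n * s⌋₊ : ℕ) / n) - n * F (k / n) ≤ ρ * ((⌊n * s⌋₊ : ℕ) - k) + 1 := by
  obtain ⟨a, b, c⟩ := hs.floor n
  set p := ⌊n * s⌋₊
  have hn' : (0:ℝ) < n := by exact_mod_cast hn
  have hk' : (k:ℝ) ≤ n := by exact_mod_cast hk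
  have h := hs.2 (k/n) ⟨by positivity, by rw [div_le_one hn']; exact hk'⟩
  have m : F (p/n) ≤ F s := hF.mono (by rw [div_le_iff₀ hn']; linarith)
  have h2 := mul_le_mul_of_nonneg_left h hn'.le
  have m2 := mul_le_mul_of_nonneg_left m hn'.le
  have e : (n:ℝ) * (F (k/n) - ρ * (k/n)) = n * F (k/n) - ρ * k := by field_simp
  rw [e] at h2
  nlinarith

lemma TouchAt.right_bound (hF : IsPath F) {ρ s : ℝ} (hs : TouchAt F ρ s) (hρ : 0 ≤ ρ)
    (hρ1 : ρ ≤ 1) {n : ℕ} (hn : 0 < n) {k : ℕ} (hk : k ≤ n) :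
    ρ * (k - (⌊n * s⌋₊ : ℕ)) - 1 ≤ n * F (k / n) - n * F ((⌊n * s⌋₊ : ℕ) / n) := by
  have := hs.left_bound hF hρ hρ1 hn hk
  linarith

lemma TouchAt.env_floor (hF : IsPath F) {ρ s : ℝ} (hs : TouchAt F ρ s) {n : ℕ} (hn : 0 < n) :
    n * F ((⌊n * s⌋₊ : ℕ) / n) ≤ n * env F ((⌊n * s⌋₊ : ℕ) / n) + 1 := by
  obtain ⟨a, b, c⟩ := hs.floor n
  set p := ⌊n * s⌋₊
  have hn' : (0:ℝ) < n := by exact_mod_cast hn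
  have hps : (p:ℝ)/n ≤ s := by rw [div_le_iff₀ hn']; linarith
  have m : F (p/n) ≤ F s := hF.mono hps
  have m1 := hF.env.sub_le hps
  rw [hs.env_eq hF] at m1
  have m2 := mul_le_mul_of_nonneg_left m hn'.le
  have m3 := mul_le_mul_of_nonneg_left m1 hn'.le
  have e : (n:ℝ) * (s - p/n) = n * s - p := by field_simp
  linarith

lemma env_le_path (hF : IsPath F) {n k : ℕ} (hn : 0 < n) (hk : k ≤ n) :
    n * env F (k / n) ≤ n * F (k / n) := by
  have hn' : (0:ℝ) < n := by exact_mod_cast hn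
  have hk' : (k:ℝ) ≤ n := by exact_mod_cast hk
  exact mul_le_mul_of_nonneg_left (env_le hF ⟨by positivity, by rw [div_le_one hn']; exact hk'⟩)
    hn'.le

lemma count_suffix_of_follows (hF : IsPath F) {ρ s D : ℝ} (hs : TouchAt F ρ s) (hρ : 0 ≤ ρ)
    (hρ1 : ρ ≤ 1) {n : ℕ} (hn : 0 < n) {u : List Bool} (hu : Follows F n 0 D u)
    (hl : u.length = ⌊n * s⌋₊) (v : List Bool) (hv : v <:+ u) :
    (v.count true : ℝ) ≤ ρ * v.length + (2 * D + 1) := by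
  have hk : u.length - v.length ≤ u.length := Nat.sub_le _ _
  obtain ⟨a, b, c⟩ := hs.floor n
  have hd := List.suffix_iff_eq_drop.1 hv
  set k := u.length - v.length with hkd
  have hkl : v.length = u.length - k := by have := hv.length_le; omega
  have hc := ht_drop u k
  rw [← hd] at hc
  have hc' : (v.count true : ℝ) + ht u k = ht u u.length := by exact_mod_cast hc
  have h1 := hu k hk
  have h2 := hu _ le_rfl
  have h3 := hs.left_bound hF hρ hρ1 hn (k := k) (by omega)
  have hkl' : (v.length : ℝ) = ⌊n * s⌋₊ - k := by rw [hkl, Nat.cast_sub hk, hl]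
  rw [zero_add, abs_le] at h1 h2
  rw [hl] at h2 hc'
  rw [hkl']
  linarith [h1.1, h2.2]

lemma count_prefix_of_follows (hF : IsPath F) {ρ s D : ℝ} (hs : TouchAt F ρ s) (hρ : 0 ≤ ρ)
    (hρ1 : ρ ≤ 1) {n : ℕ} (hn : 0 < n) {u : List Bool} (hu : Follows F n ⌊n * s⌋₊ D u)
    (hl : ⌊n * s⌋₊ + u.length = n) (hD : 0 ≤ D) (v : List Bool) (hv : v <:+ rc u) :
    (v.count true : ℝ) ≤ (1 - ρ) * v.length + (2 * D + 1) := by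
  obtain ⟨p, hp⟩ := hv
  have hu' : u = rc v ++ rc p := by rw [← rc_append, hp, rc_rc]
  have hlen : (rc v).length ≤ u.length := by rw [hu']; simp
  have hh := hu (rc v).length hlen
  have hht : ht u (rc v).length = (rc v).count true := by
    rw [ht, hu', List.take_left']; rfl
  have h3 := hs.right_bound hF hρ hρ1 hn (k := ⌊n * s⌋₊ + (rc v).length) (by omega)
  have hcount : (rc v).count true + v.count true = v.length := by
    rw [rc_count, add_comm]
    exact List.count_add_count_not v true
  rw [hht] at hh
  have hcount' : ((rc v).count true : ℝ) + v.count true = v.length := by exact_mod_cast hcount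
  rw [abs_le] at hh
  rw [rc_length] at hh h3
  push_cast at h3 hh
  linarith [hh.1]

lemma core_cond_of_follows (hF : IsPath F) {ρ ρ' s t D : ℝ} (hs : TouchAt F ρ s)
    (ht' : TouchAt F ρ' t) {n m : ℕ} (hn : 0 < n) {u σ : List Bool}
    (hu : Follows F n ⌊n * s⌋₊ D u) (hσ : Follows (env F) n ⌊n * s⌋₊ D σ)
    (hlen : σ.length = u.length) (hl : ⌊n * s⌋₊ + u.length = ⌊n * t⌋₊) (hm : 2 * D + 1 ≤ m) :
    (∀ k ≤ u.length, ht σ k ≤ m + ht u k) ∧ ht u u.length ≤ m + ht σ u.length := by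
  obtain ⟨-, -, ct⟩ := ht'.floor n
  have e1 := hs.env_floor hF hn
  refine ⟨fun k hk => ?_, ?_⟩
  · have h1 := hu k hk
    have h2 := hσ k (hlen ▸ hk)
    have h3 := env_le_path hF hn (k := ⌊n * s⌋₊ + k) (by omega)
    rw [abs_le] at h1 h2
    have : (ht σ k : ℝ) ≤ m + ht u k := by linarith [h1.1, h2.2]
    exact_mod_cast this
  · have h1 := hu _ le_rfl
    have h2 := hσ _ hlen.ge
    rw [hl, abs_le] at h1 h2
    have e2 := ht'.env_floor hF hn
    have e3 := env_le_path hF hn (k := ⌊n * s⌋₊) (by omega)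
    have : (ht u u.length : ℝ) ≤ m + ht σ u.length := by linarith [h1.2, h2.1]
    exact_mod_cast this

lemma lwProd_eq {g : ℝ} (h0 : 0 < g) (h1 : g < 1) (u : List Bool) :
    lwProd g u = Real.exp (-(u.count true * Real.log g +
      (u.length - u.count true) * Real.log (1 - g))) := by
  have h1' : 0 < 1 - g := by linarith
  induction u with
  | nil => simp [lwProd]
  | cons x u ih =>
    rw [show x :: u = [x] ++ u from rfl, lwProd_append, ih]
    cases x
    · have : lwProd g [false] = Real.exp (-Real.log (1 - g)) := by
        rw [Real.exp_neg, Real.exp_log h1']; simp [lwProd, lw]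
      rw [this, ← Real.exp_add]; congr 1
      simp; ring
    · have : lwProd g [true] = Real.exp (-Real.log g) := by
        rw [Real.exp_neg, Real.exp_log h0]; simp [lwProd, lw]
      rw [this, ← Real.exp_add]; congr 1
      simp; ring

lemma lwProd_rc (g : ℝ) (u : List Bool) : lwProd (1 - g) (rc u) = lwProd g u := by
  induction u with
  | nil => rfl
  | cons x u ih =>
    rw [rc_cons, lwProd_append, ih, mul_comm, show x :: u = [x] ++ u from rfl, lwProd_append]
    congr 1
    cases x <;> simp [lwProd, lw]

/-- `lwProd` along a word following the profile. -/
lemma le_lwProd_of_follows {g D : ℝ} (hD : 0 ≤ D) {n i₀ : ℕ} {u : List Bool}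
    (hg : u = [] ∨ 0 < g ∧ g < 1) (hu : Follows F n i₀ D u) :
    Real.exp (-((n * F ((i₀ + u.length : ℕ) / n) - n * F (i₀ / n)) * Real.log g +
      (u.length - (n * F ((i₀ + u.length : ℕ) / n) - n * F (i₀ / n))) * Real.log (1 - g)) -
      D * (|Real.log g| + |Real.log (1 - g)|)) ≤ lwProd g u := by
  rcases hg with rfl | ⟨h0, h1⟩
  · simp only [List.length_nil, add_zero, sub_self, zero_mul, Nat.cast_zero, neg_zero, lwProd,
      List.map_nil, List.prod_nil, zero_sub]
    rw [Real.exp_le_one_iff, neg_nonpos]; positivity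
  rw [lwProd_eq h0 h1]
  have h := hu _ le_rfl
  rw [ht_of_length_le le_rfl] at h
  set X := n * F ((i₀ + u.length : ℕ) / n) - n * F (i₀ / n)
  refine Real.exp_le_exp.2 ?_
  have e1 : ((u.count true : ℝ) - X) * Real.log g ≤ D * |Real.log g| := by
    refine (le_abs_self _).trans ?_
    rw [abs_mul]; exact mul_le_mul_of_nonneg_right h (abs_nonneg _)
  have e2 : -(((u.count true : ℝ) - X) * Real.log (1 - g)) ≤ D * |Real.log (1 - g)| := by
    refine (neg_le_abs _).trans ?_
    rw [abs_mul]; exact mul_le_mul_of_nonneg_right h (abs_nonneg _)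
  nlinarith

end OpenASEP

namespace OpenASEP
open MeasureTheory Filter Topology Set Par

variable {F : ℝ → ℝ}

namespace Par
variable (P : Par)

lemma exists_left_lower : ∃ ε, 0 < ε ∧ ε ≤ 1 ∧ ∀ δ, 0 < δ → δ ≤ 1 → P.q * (1 + δ) ≤ 1 →
    ∀ (u : List Bool) (m : ℕ) (E : ℝ), (P.ρ = 0 → u = []) →
      (∀ v, v <:+ u → v.count true ≤ P.ρ * v.length + E) →
      2 * ((u.length + 1) * Real.exp (δ * E + δ ^ 2 * u.length)) ≤ (1 + δ) ^ m →
      ε ^ m * (lwProd P.ρ u / 2) ≤ P.leftPar.w (u ++ List.replicate m false) := by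
  rcases P.ha.eq_or_lt with h | h
  · obtain ⟨ε, h0, h1, hw⟩ := P.leftPar.exists_eps
    refine ⟨ε, h0, h1, fun δ _ _ _ u m E hu _ _ => ?_⟩
    have hρ : P.ρ = 0 := by rw [ρ, ← h, zero_div]
    rw [hu hρ]
    have := hw ([] ++ List.replicate m false)
    simp only [List.nil_append, List.length_replicate] at this ⊢
    refine le_trans ?_ this
    have : 0 < ε ^ m := by positivity
    simp only [lwProd, List.map_nil, List.prod_nil]; linarith
  · refine ⟨P.e0 * min 1 P.a, mul_pos P.e0_pos (lt_min one_pos h), ?_,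
      fun δ h0 h1 hq u m E _ hu hm => P.left_piece h h0 h1 hq u m hu hm⟩
    exact mul_le_one₀ P.e0_le_one (le_min zero_le_one h.le) (min_le_left _ _)

lemma swap_ρ : P.swap.ρ = 1 - P.ρ' := by
  have := P.hb
  rw [ρ, ρ']; change P.b / (1 + P.b) = _
  field_simp; ring

/-- Lower bound for the weight of a word built from three pieces following the profile. -/
theorem exists_word_lower : ∃ ε, 0 < ε ∧ ε ≤ 1 ∧ ∀ (F : ℝ → ℝ) (s t : ℝ), IsPath F →
    TouchAt F P.ρ s → (P.ρ = 0 → s = 0) → TouchAt F P.ρ' t → (P.ρ' = 1 → t = 1) →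
    ∀ (n m : ℕ) (δ D κ : ℝ), 0 < n → 0 < δ → δ ≤ 1 → P.q * (1 + δ) ≤ 1 → 0 ≤ D → 2 * D + 1 ≤ m →
    2 * ((n + 1) * Real.exp (δ * (2 * D + 1) + δ ^ 2 * n)) ≤ (1 + δ) ^ m →
    0 ≤ κ → κ ≤ 1 → κ ≤ 1 - P.q ^ m → ∀ uL v uR : List Bool,
    uL.length = ⌊n * s⌋₊ → v.length = ⌊n * t⌋₊ - ⌊n * s⌋₊ → uR.length = n - ⌊n * t⌋₊ →
    Follows F n 0 D uL → Follows F n ⌊n * s⌋₊ D v → Follows F n ⌊n * t⌋₊ D uR →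
    κ ^ (3 * n + 15 * m) * ε ^ (7 * m) / 4 * lwProd P.ρ uL * lwProd P.ρ' uR *
      wordSum v.length (fun σ => if Follows (env F) n ⌊n * s⌋₊ D σ then 1 else 0) ≤
    P.w (uL ++ List.replicate m false ++ (List.replicate m true ++
      (List.replicate (2 * m) true ++ v ++ List.replicate (3 * m) false) ++
      List.replicate m false ++ (List.replicate m true ++ uR))) := by
  obtain ⟨ε₁, a1, b1, c1⟩ := P.exists_left_lower
  obtain ⟨ε₂, a2, b2, c2⟩ := P.swap.exists_left_lower
  obtain ⟨ε₃, a3, b3, c3⟩ := P.exists_eps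
  obtain ⟨ε₄, a4, b4, c4⟩ := P.swap.leftPar.exists_eps
  have q0 : 0 < 1 - P.q := by linarith [P.hq1]
  have q1 : 1 - P.q ≤ 1 := by linarith [P.hq0]
  obtain ⟨ε, h0, h1, h2, h3, h4, h5⟩ : ∃ ε, 0 < ε ∧ ε ≤ ε₁ ∧ ε ≤ ε₂ ∧ ε ≤ ε₃ ∧ ε ≤ ε₄ ∧
      ε ≤ 1 - P.q := ⟨min ε₁ (min ε₂ (min ε₃ (min ε₄ (1 - P.q)))), by positivity, by simp,
        by simp, by simp, by simp, by simp⟩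
  refine ⟨ε, h0, h1.trans b1, ?_⟩
  intro F s t hF hs hs0 ht ht1 n m δ D κ hn hδ hδ1 hqδ hD hm hexp hκ0 hκ1 hκ uL v uR lL lv lR fL fv fR
  have hρ1 := P.ρ_lt_one
  have hρ0 := P.ρ_nonneg
  have hρ'0 := P.ρ'_pos
  have hρ'1 := P.ρ'_le_one
  obtain ⟨-, -, cs⟩ := hs.floor n
  obtain ⟨-, -, ct⟩ := ht.floor n
  have hst : ⌊n * s⌋₊ ≤ ⌊n * t⌋₊ :=
    Nat.floor_le_floor (mul_le_mul_of_nonneg_left (hs.le P.ρ_lt_ρ' ht) (by positivity))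
  have hm1 : 1 ≤ m := by
    have : (1:ℝ) ≤ m := by linarith
    exact_mod_cast this
  have hmono : ∀ l : ℕ, l ≤ n → 2 * (((l:ℝ) + 1) * Real.exp (δ * (2 * D + 1) + δ ^ 2 * l)) ≤
      (1 + δ) ^ m := fun l hl => by
    refine le_trans ?_ hexp
    have : (l:ℝ) ≤ n := by exact_mod_cast hl
    gcongr
  -- left piece
  have L : ε ^ m * (lwProd P.ρ uL / 2) ≤ P.leftPar.w (uL ++ List.replicate m false) := by
    have hu : P.ρ = 0 → uL = [] := fun h => by
      rw [← List.length_eq_zero_iff, lL, hs0 h]; simp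
    refine le_trans ?_ (c1 δ hδ hδ1 hqδ uL m (2 * D + 1) hu
      (count_suffix_of_follows hF hs hρ0 hρ1.le hn fL lL) (hmono _ (lL ▸ cs)))
    have : 0 ≤ lwProd P.ρ uL := by
      rcases hρ0.eq_or_lt with h | h
      · simp [hu h.symm, lwProd]
      · exact (lwProd_pos h hρ1 uL).le
    gcongr
  -- right piece
  have R : ε ^ m * (lwProd P.ρ' uR / 2) ≤ P.wR (List.replicate m true ++ uR) := by
    have hu : P.swap.ρ = 0 → uR = [] := fun h => by
      rw [swap_ρ] at h
      rw [← List.length_eq_zero_iff, lR, ht1 (by linarith)]; simp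
    have e : rc (List.replicate m true ++ uR) = rc uR ++ List.replicate m false := by
      rw [rc_append]; simp [rc]
    rw [wR, e]
    refine le_trans ?_ (c2 δ hδ hδ1 hqδ (rc uR) m (2 * D + 1) (fun h => by rw [hu h]; rfl) ?_ ?_)
    · rw [swap_ρ, lwProd_rc]
      have : 0 ≤ lwProd P.ρ' uR := by
        rcases hρ'1.eq_or_lt with h | h
        · simp [hu (by rw [swap_ρ]; linarith), lwProd]
        · exact (lwProd_pos hρ'0 h uR).le
      gcongr
    · rw [swap_ρ]
      exact count_prefix_of_follows hF ht hρ'0.le hρ'1 hn fR (by omega) hD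
    · rw [rc_length]; exact hmono _ (by omega)
  -- core
  have C : ε ^ (3 * m) * (κ ^ v.length *
      wordSum v.length (fun σ => if Follows (env F) n ⌊n * s⌋₊ D σ then 1 else 0)) ≤
      P.zeroPar.w (List.replicate (2 * m) true ++ v ++ List.replicate (3 * m) false) := by
    refine le_trans ?_ (P.core_piece v hm1 hκ0 hκ)
    have hS : wordSum v.length (fun σ => if Follows (env F) n ⌊n * s⌋₊ D σ then (1:ℝ) else 0) ≤
        wordSum v.length (fun σ => if (∀ k ≤ v.length, OpenASEP.ht σ k ≤ m + OpenASEP.ht v k) ∧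
          OpenASEP.ht v v.length ≤ m + OpenASEP.ht σ v.length then 1 else 0) := by
      refine wordSum_mono fun σ hσ => ?_
      split_ifs with x y y
      · exact le_rfl
      · exact absurd (core_cond_of_follows hF hs ht hn fv x hσ (by omega) hm) y
      · exact zero_le_one
      · exact le_rfl
    have : 0 ≤ wordSum v.length
        (fun σ => if Follows (env F) n ⌊n * s⌋₊ D σ then (1:ℝ) else 0) :=
      wordSum_nonneg fun σ _ => by split_ifs <;> norm_num
    gcongr
  have W1 : ε ^ m ≤ P.w (List.replicate m true) := by
    have := c3 (List.replicate m true)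
    rw [List.length_replicate] at this
    exact (pow_le_pow_left₀ h0.le h3 m).trans this
  have W2 : ε ^ m ≤ P.swap.leftPar.w (List.replicate m true) := by
    have := c4 (List.replicate m true)
    rw [List.length_replicate] at this
    exact (pow_le_pow_left₀ h0.le h4 m).trans this
  refine le_trans ?_ (P.glue_three uL _ uR m hκ0 hκ)
  set S := wordSum v.length (fun σ => if Follows (env F) n ⌊n * s⌋₊ D σ then (1:ℝ) else 0) with hSdef
  have hS0 : 0 ≤ S := wordSum_nonneg fun σ _ => by split_ifs <;> norm_num
  have hL0 : 0 ≤ lwProd P.ρ uL := by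
    rcases hρ0.eq_or_lt with h | h
    · have : uL = [] := by rw [← List.length_eq_zero_iff, lL, hs0 h.symm]; simp
      simp [this, lwProd]
    · exact (lwProd_pos h hρ1 uL).le
  have hR0 : 0 ≤ lwProd P.ρ' uR := by
    rcases hρ'1.eq_or_lt with h | h
    · have : uR = [] := by rw [← List.length_eq_zero_iff, lR, ht1 h]; simp
      simp [this, lwProd]
    · exact (lwProd_pos hρ'0 h uR).le
  have hκe : κ ^ (3 * n + 15 * m) ≤ κ ^ (uL.length +
      2 * (List.replicate (2 * m) true ++ v ++ List.replicate (3 * m) false).length + uR.length +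
      5 * m) * κ ^ v.length := by
    rw [← pow_add]
    refine pow_le_pow_of_le_one hκ0 hκ1 ?_
    simp only [List.length_append, List.length_replicate]
    omega
  set K := κ ^ (uL.length +
      2 * (List.replicate (2 * m) true ++ v ++ List.replicate (3 * m) false).length + uR.length +
      5 * m) with hK
  have hK0 : 0 ≤ K := pow_nonneg hκ0 _
  calc κ ^ (3 * n + 15 * m) * ε ^ (7 * m) / 4 * lwProd P.ρ uL * lwProd P.ρ' uR * S
      ≤ (K * κ ^ v.length) * ε ^ (7 * m) / 4 * lwProd P.ρ uL * lwProd P.ρ' uR * S := by gcongr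
    _ = K * ((ε ^ m * (lwProd P.ρ uL / 2)) * (ε ^ m * ε ^ m * (ε ^ (3 * m) * (κ ^ v.length * S))) *
          (ε ^ m * (lwProd P.ρ' uR / 2))) := by ring
    _ ≤ _ := by
      have n1 := (P.leftPar.w_pos (uL ++ List.replicate m false)).le
      have n2 := (P.w_pos (List.replicate m true)).le
      have n3 := (P.swap.leftPar.w_pos (List.replicate m true)).le
      have n4 := (P.zeroPar.w_pos
        (List.replicate (2 * m) true ++ v ++ List.replicate (3 * m) false)).le
      have n5 := mul_nonneg (mul_nonneg n2 n3) n4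
      have n6 := mul_nonneg n1 n5
      gcongr

end Par
end OpenASEP

namespace OpenASEP
open MeasureTheory Filter Topology Set Par

variable {F : ℝ → ℝ}

lemma wordSum_three {n₁ n₂ n₃ N : ℕ} (A B : List Bool) (f : List Bool → ℝ) (hf : ∀ u, 0 ≤ f u)
    (hN : N = n₁ + (A.length + (n₂ + (B.length + n₃)))) :
    wordSum n₁ (fun u => wordSum n₂ (fun v => wordSum n₃ (fun x => f (u ++ (A ++ (v ++ (B ++ x))))))) ≤
      wordSum N f := by
  rw [hN, wordSum_add]
  refine wordSum_mono fun u _ => ?_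
  rw [wordSum_add A.length]
  refine le_trans ?_ (le_wordSum A _ fun _ _ => wordSum_nonneg fun _ _ => hf _)
  rw [wordSum_add n₂]
  refine wordSum_mono fun v _ => ?_
  rw [wordSum_add B.length]
  exact le_wordSum B (fun b => wordSum n₃ fun x => f (u ++ (A ++ (v ++ (b ++ x)))))
    fun _ _ => wordSum_nonneg fun _ _ => hf _

lemma eventually_scales {q δ : ℝ} (hq0 : 0 ≤ q) (hq1 : q < 1) (hδ : 0 < δ) (hδ1 : δ ≤ 1) :
    ∀ᶠ N : ℕ in atTop, (⌈12 * δ * N⌉₊ : ℝ) ≤ 13 * δ * N ∧ 2 * (2 * δ * N) + 1 ≤ ⌈12 * δ * N⌉₊ ∧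
      (∀ n ≤ N, 2 * (((n:ℕ) + 1) * Real.exp (δ * (2 * (2 * δ * N) + 1) + δ ^ 2 * n)) ≤
        (1 + δ) ^ ⌈12 * δ * N⌉₊) ∧ Real.exp (-δ) ≤ 1 - q ^ ⌈12 * δ * N⌉₊ := by
  have t1 : Tendsto (fun N : ℕ => δ * N) atTop atTop :=
    tendsto_natCast_atTop_atTop.const_mul_atTop hδ
  have t12 : Tendsto (fun N : ℕ => 12 * δ * (N:ℝ)) atTop atTop :=
    tendsto_natCast_atTop_atTop.const_mul_atTop (by positivity)
  have t2 : Tendsto (fun N : ℕ => ⌈12 * δ * N⌉₊) atTop atTop :=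
    tendsto_nat_ceil_atTop.comp t12
  have t3 : Tendsto (fun N : ℕ => q ^ ⌈12 * δ * N⌉₊) atTop (𝓝 0) :=
    (tendsto_pow_atTop_nhds_zero_of_lt_one hq0 hq1).comp t2
  have hpos : 0 < 1 - Real.exp (-δ) := by
    have : Real.exp (-δ) < 1 := by rw [Real.exp_lt_one_iff]; linarith
    linarith
  have t4 : ∀ᶠ N : ℕ in atTop, 2 * ((N:ℝ) + 1) * Real.exp δ ≤ Real.exp (δ ^ 2 * N) := by
    have h2 : Tendsto (fun N : ℕ => δ ^ 2 * (N:ℝ)) atTop atTop :=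
      tendsto_natCast_atTop_atTop.const_mul_atTop (by positivity)
    have h3 := (Real.tendsto_exp_div_pow_atTop 1).comp h2
    filter_upwards [h3.eventually_ge_atTop (4 * Real.exp δ / δ ^ 2), eventually_ge_atTop 1]
      with N hN h1
    have h1' : (1:ℝ) ≤ N := by exact_mod_cast h1
    simp only [Function.comp, pow_one] at hN
    rw [div_le_div_iff₀ (by positivity) (by positivity)] at hN
    have hd : 0 < δ ^ 2 := by positivity
    have h4 : 4 * Real.exp δ * N ≤ Real.exp (δ ^ 2 * N) := by
      refine le_of_mul_le_mul_right ?_ hd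
      linarith
    nlinarith [Real.exp_pos δ]
  filter_upwards [t1.eventually_ge_atTop 1, t3.eventually_lt_const hpos, t4] with N a b c
  have hc := Nat.le_ceil (12 * δ * (N:ℝ))
  have hc' := Nat.ceil_lt_add_one (a := 12 * δ * (N:ℝ)) (by positivity)
  refine ⟨by linarith, by linarith, fun n hn => ?_, by linarith⟩
  have hnN : (n:ℝ) ≤ N := by exact_mod_cast hn
  have e1 : Real.exp (δ / 2) ≤ 1 + δ := by
    rw [← Real.le_log_iff_exp_le (by linarith)]
    refine le_trans ?_ (Real.one_sub_inv_le_log_of_pos (by linarith))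
    rw [inv_eq_one_div, le_sub_iff_add_le, ← le_sub_iff_add_le', div_le_iff₀ (by linarith)]
    nlinarith
  calc 2 * (((n:ℝ) + 1) * Real.exp (δ * (2 * (2 * δ * N) + 1) + δ ^ 2 * n))
      ≤ 2 * (((N:ℝ) + 1) * Real.exp (δ * (2 * (2 * δ * N) + 1) + δ ^ 2 * N)) := by gcongr
    _ = (2 * ((N:ℝ) + 1) * Real.exp δ) * Real.exp (5 * δ ^ 2 * N) := by
      rw [show δ * (2 * (2 * δ * N) + 1) + δ ^ 2 * N = δ + 5 * δ ^ 2 * N by ring, Real.exp_add]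
      ring
    _ ≤ Real.exp (δ ^ 2 * N) * Real.exp (5 * δ ^ 2 * N) := by gcongr
    _ = Real.exp ((12 * δ * N) * (δ / 2)) := by rw [← Real.exp_add]; congr 1; ring
    _ ≤ Real.exp (⌈12 * δ * N⌉₊ * (δ / 2)) := by gcongr
    _ = Real.exp (δ / 2) ^ ⌈12 * δ * N⌉₊ := by rw [← Real.exp_nat_mul]
    _ ≤ _ := by gcongr

end OpenASEP

namespace OpenASEP
open MeasureTheory Filter Topology Set Par

variable {F : ℝ → ℝ}

set_option maxHeartbeats 2000000 in
/-- Local lower large deviation bound for the unnormalised weights. -/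
theorem Par.lower_local (P : Par) (hF : IsPath F) {r ε : ℝ} (hr : 0 < r) (hε : 0 < ε) :
    ∃ N₀ : ℕ, ∀ N ≥ N₀, Real.exp (-(N * (rate P.ρ P.ρ' F + ε))) ≤
      ∑ τ : Fin N → Bool, if Near F r N (List.ofFn τ) then P.W N τ else 0 := by
  have hρ0 := P.ρ_nonneg
  have hρ1 := P.ρ_lt_one
  have hρ'0 := P.ρ'_pos
  have hρ'1 := P.ρ'_le_one
  obtain ⟨s, hs, hs0⟩ := hF.exists_touch_left P.ρ
  obtain ⟨t, ht, ht1⟩ := hF.exists_touch_right P.ρ'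
  obtain ⟨C, hC⟩ := energy_le hF hρ0 P.ρ_lt_ρ' hρ'1 hs hs0 ht ht1
  obtain ⟨ε₁, he0, he1, hword⟩ := P.exists_word_lower
  set R := rate P.ρ P.ρ' F with hR
  set K := -Real.log ε₁ with hK
  have hK0 : 0 ≤ K := by rw [hK, neg_nonneg]; exact Real.log_nonpos he0.le he1
  set Ka := |Real.log P.ρ| + |Real.log (1 - P.ρ)| with hKa
  set Kb := |Real.log P.ρ'| + |Real.log (1 - P.ρ')| with hKb
  have hKa0 : 0 ≤ Ka := by positivity
  have hKb0 : 0 ≤ Kb := by positivity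
  set T := 8 + 91 * K + 2 * Ka + 2 * Kb + 117 * |R| with hT
  have hT0 : 0 < T := by positivity
  have hq1 : 0 < 1 - P.q := by linarith [P.hq1]
  obtain ⟨δ, hδ, d1, d2, d3, d4⟩ : ∃ δ, 0 < δ ∧ δ ≤ 1 / 1000 ∧ δ ≤ 1 - P.q ∧ δ ≤ r / 357 ∧
      δ ≤ ε / (2 * T) :=
    ⟨min (1 / 1000) (min (1 - P.q) (min (r / 357) (ε / (2 * T)))), by positivity, by simp, by simp,
      by simp, by simp⟩
  have d4' : δ * T ≤ ε / 2 := by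
    have := mul_le_mul_of_nonneg_right d4 hT0.le
    rwa [show ε / (2 * T) * T = ε / 2 by field_simp] at this
  obtain ⟨Na, hNa⟩ := follows_lower hF hδ (by linarith)
  obtain ⟨Nb, hNb⟩ := follows_lower hF.env hδ (by linarith)
  have hev := eventually_scales P.hq0 P.hq1 hδ (by linarith)
  have hlin : ∀ᶠ N : ℕ in atTop, Real.log 4 + C ≤ ε / 2 * N :=
    (tendsto_natCast_atTop_atTop.const_mul_atTop (by positivity)).eventually_ge_atTop _
  obtain ⟨N₀, hN₀⟩ := eventually_atTop.1 (hev.and (hlin.and ((eventually_ge_atTop Na).and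
    ((eventually_ge_atTop Nb).and (eventually_ge_atTop 1)))))
  refine ⟨N₀, fun N hN => ?_⟩
  obtain ⟨⟨m1, m2, m3, m4⟩, hl, hNa', hNb', hN1⟩ := hN₀ N hN
  clear hN₀ hev hlin
  set m := ⌈12 * δ * N⌉₊ with hm
  have hNpos : (0:ℝ) < N := by exact_mod_cast hN1
  have hδN : δ * N ≤ N / 1000 := by
    have := mul_le_mul_of_nonneg_right d1 hNpos.le
    linarith
  obtain ⟨n, hn⟩ : ∃ n, N = n + 9 * m := by
    have : (9 * m : ℝ) ≤ N := by linarith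
    exact ⟨N - 9 * m, by have : 9 * m ≤ N := by exact_mod_cast this
                         omega⟩
  have hnR : (N:ℝ) = n + 9 * m := by exact_mod_cast hn
  have hn0 : 0 < n := by
    have : (0:ℝ) < n := by linarith
    exact_mod_cast this
  have hnN : n ≤ N := by omega
  set n₁ := ⌊n * s⌋₊ with hn₁
  set n₂ := ⌊n * t⌋₊ with hn₂
  set D := 2 * δ * N with hD
  have hD0 : 0 ≤ D := by positivity
  obtain ⟨-, -, cs⟩ := hs.floor n
  obtain ⟨-, -, ct⟩ := ht.floor n
  have hst : n₁ ≤ n₂ :=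
    Nat.floor_le_floor (mul_le_mul_of_nonneg_left (hs.le P.ρ_lt_ρ' ht) (by positivity))
  set κ := Real.exp (-δ) with hκ
  have hκ1 : κ ≤ 1 := by rw [hκ, Real.exp_le_one_iff]; linarith
  have t1 := hNa N hNa' n hnN hn0 0 n₁ cs
  have t2 := hNa N hNa' n hnN hn0 n₁ (n₂ - n₁) (by omega)
  have t3 := hNa N hNa' n hnN hn0 n₂ (n - n₂) (by omega)
  have t4 := hNb N hNb' n hnN hn0 n₁ (n₂ - n₁) (by omega)
  set X := n * F (n₁ / n) * Real.log P.ρ + (n₁ - n * F (n₁ / n)) * Real.log (1 - P.ρ) with hX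
  set Y := (n * F 1 - n * F (n₂ / n)) * Real.log P.ρ' +
    ((n - n₂) - (n * F 1 - n * F (n₂ / n))) * Real.log (1 - P.ρ') with hY
  set S := wordSum (n₂ - n₁) (fun σ => if Follows (env F) n n₁ D σ then (1:ℝ) else 0) with hS
  set c := κ ^ (3 * n + 15 * m) * ε₁ ^ (7 * m) / 4 * Real.exp (-X - D * Ka) *
    Real.exp (-Y - D * Kb) * S with hc
  have hS0 : 0 ≤ S := wordSum_nonneg fun σ _ => by split_ifs <;> norm_num
  set f : List Bool → ℝ := fun w => if Near F r N w then P.w w else 0 with hf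
  have hf0 : ∀ u, 0 ≤ f u := fun u => by
    simp only [hf]; split_ifs
    · exact (P.w_pos u).le
    · exact le_rfl
  have hqδ : P.q * (1 + δ) ≤ 1 := by
    have := mul_le_mul_of_nonneg_right P.hq1.le hδ.le
    linarith
  have key : ∀ uL v uR : List Bool, uL.length = n₁ → v.length = n₂ - n₁ → uR.length = n - n₂ →
      Follows F n 0 D uL → Follows F n n₁ D v → Follows F n n₂ D uR →
      c ≤ f (uL ++ ((List.replicate m false ++ (List.replicate m true ++
        List.replicate (2 * m) true)) ++ (v ++ ((List.replicate (3 * m) false ++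
        (List.replicate m false ++ List.replicate m true)) ++ uR)))) := by
    intro uL v uR lL lv lR fL fv fR
    have hw := hword F s t hF hs hs0 ht ht1 n m δ D κ hn0 hδ (by linarith)
      hqδ hD0 m2 (m3 n hnN) (Real.exp_pos _).le hκ1 m4 uL v uR lL lv lR
      fL fv fR
    have e : uL ++ List.replicate m false ++ (List.replicate m true ++
        (List.replicate (2 * m) true ++ v ++ List.replicate (3 * m) false) ++
        List.replicate m false ++ (List.replicate m true ++ uR)) =
        uL ++ ((List.replicate m false ++ (List.replicate m true ++
        List.replicate (2 * m) true)) ++ (v ++ ((List.replicate (3 * m) false ++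
        (List.replicate m false ++ List.replicate m true)) ++ uR))) := by
      simp only [List.append_assoc]
    rw [e] at hw
    have hsub : List.Sublist (uL ++ (v ++ uR)) (uL ++ ((List.replicate m false ++
        (List.replicate m true ++ List.replicate (2 * m) true)) ++ (v ++ ((List.replicate (3 * m)
        false ++ (List.replicate m false ++ List.replicate m true)) ++ uR)))) := by
      refine (List.Sublist.refl uL).append ?_
      refine List.Sublist.trans ?_ (List.sublist_append_right _ _)
      exact (List.Sublist.refl v).append (List.sublist_append_right _ _)
    have hfol : Follows F n 0 (D + (D + D)) (uL ++ (v ++ uR)) := by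
      refine fL.append (Follows.append ?_ ?_ hD0) (by positivity)
      · rw [lL, zero_add]; exact fv
      · rw [lL, zero_add, lv, Nat.add_sub_cancel' hst]; exact fR
    have hnear : Near F r N (uL ++ ((List.replicate m false ++ (List.replicate m true ++
        List.replicate (2 * m) true)) ++ (v ++ ((List.replicate (3 * m) false ++
        (List.replicate m false ++ List.replicate m true)) ++ uR)))) := by
      refine hfol.near_of_sublist hF hsub (n := n) (K := 9 * m) ?_ ?_ hn0 hn ?_
      · simp only [List.length_append]; omega
      · simp only [List.length_append, List.length_replicate]; omega
      · push_cast
        have : 357 * δ * N ≤ r * N := by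
          have : 357 * δ ≤ r := by linarith
          gcongr
        simp only [hD]; linarith
    simp only [hf, if_pos hnear]
    refine le_trans ?_ hw
    rw [hc, lv]
    have gL : uL = [] ∨ 0 < P.ρ ∧ P.ρ < 1 := by
      rcases hρ0.eq_or_lt with h | h
      · left; rw [← List.length_eq_zero_iff, lL, hn₁, hs0 h.symm]; simp
      · exact Or.inr ⟨h, hρ1⟩
    have gR : uR = [] ∨ 0 < P.ρ' ∧ P.ρ' < 1 := by
      rcases hρ'1.eq_or_lt with h | h
      · left; rw [← List.length_eq_zero_iff, lR, hn₂, ht1 h]; simp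
      · exact Or.inr ⟨hρ'0, h⟩
    have pL := le_lwProd_of_follows hD0 gL fL
    have pR := le_lwProd_of_follows hD0 gR fR
    rw [lL] at pL
    rw [lR, Nat.add_sub_cancel' ct, Nat.cast_sub ct, div_self (by positivity)] at pR
    simp only [zero_add, Nat.cast_zero, zero_div, hF.zero, mul_zero, sub_zero] at pL
    have hκ0 : 0 < κ := Real.exp_pos _
    have := (Real.exp_pos _).le.trans pL
    gcongr
  have hsum : c * (wordSum n₁ (fun u => if Follows F n 0 D u then 1 else 0) *
      (wordSum (n₂ - n₁) (fun u => if Follows F n n₁ D u then 1 else 0) *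
      wordSum (n - n₂) (fun u => if Follows F n n₂ D u then 1 else 0))) ≤ wordSum N f := by
    refine le_trans ?_ (wordSum_three (N := N) (f := f) (hf := hf0) (n₁ := n₁) (n₂ := n₂ - n₁) (n₃ := n - n₂)
      (A := List.replicate m false ++ (List.replicate m true ++ List.replicate (2 * m) true))
      (B := List.replicate (3 * m) false ++ (List.replicate m false ++ List.replicate m true))
      (by simp only [List.length_append, List.length_replicate]; omega))
    rw [← wordSum_mul_right, ← wordSum_mul_left]
    refine wordSum_mono fun u hu => ?_
    rw [← wordSum_mul_right, ← wordSum_mul_left, ← wordSum_mul_left]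
    refine wordSum_mono fun v hv => ?_
    rw [← wordSum_mul_left, ← wordSum_mul_left, ← wordSum_mul_left]
    refine wordSum_mono fun x hx => ?_
    by_cases h1 : Follows F n 0 D u
    · by_cases h2 : Follows F n n₁ D v
      · by_cases h3 : Follows F n n₂ D x
        · simp only [if_pos h1, if_pos h2, if_pos h3, mul_one]
          exact key u v x hu hv hx h1 h2 h3
        · simp only [if_neg h3, mul_zero]; exact hf0 _
      · simp only [if_neg h2, zero_mul, mul_zero]; exact hf0 _
    · simp only [if_neg h1, zero_mul, mul_zero]; exact hf0 _
  have hfinal : (∑ τ : Fin N → Bool, if Near F r N (List.ofFn τ) then P.W N τ else 0) =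
      wordSum N f := by
    rw [wordSum_eq_sum]; rfl
  rw [hfinal]
  refine le_trans ?_ hsum
  have hen := hC n hn0 δ hδ (by linarith) n₁ n₂ rfl rfl
  rw [← hX, ← hY] at hen
  set h1 := ∑ j ∈ Finset.range n₁, Hent (cslope δ F n (0 + j)) with hh1
  set h2 := ∑ j ∈ Finset.range (n₂ - n₁), Hent (cslope δ F n (n₁ + j)) with hh2
  set h3 := ∑ j ∈ Finset.range (n - n₂), Hent (cslope δ F n (n₂ + j)) with hh3
  set h4 := ∑ j ∈ Finset.range (n₂ - n₁), Hent (cslope δ (env F) n (n₁ + j)) with hh4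
  have hsplit : ∑ j ∈ Finset.range n, Hent (cslope δ F n j) = h1 + h2 + h3 := by
    have a := Finset.sum_range_add (fun j => Hent (cslope δ F n j)) n₂ (n - n₂)
    have b := Finset.sum_range_add (fun j => Hent (cslope δ F n j)) n₁ (n₂ - n₁)
    rw [Nat.add_sub_cancel' ct] at a
    rw [Nat.add_sub_cancel' hst] at b
    rw [a, b]; simp only [hh1, zero_add, hh2, hh3]
  have hκe : κ ^ (3 * n + 15 * m) = Real.exp (-(δ * (3 * n + 15 * m))) := by
    rw [hκ, ← Real.exp_nat_mul]; congr 1; push_cast; ring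
  have hεe : ε₁ ^ (7 * m) = Real.exp (-(7 * m * K)) := by
    rw [show -(7 * m * K) = ((7 * m : ℕ) : ℝ) * Real.log ε₁ by rw [hK]; push_cast; ring,
      Real.exp_nat_mul, Real.exp_log he0]
  have h4e : (1:ℝ) / 4 = Real.exp (-Real.log 4) := by
    rw [Real.exp_neg, Real.exp_log (by norm_num)]; norm_num
  calc Real.exp (-(N * (R + ε)))
      ≤ Real.exp (-(δ * (3 * n + 15 * m)) + (-(7 * m * K)) + (-Real.log 4) + (-X - D * Ka) +
          (-Y - D * Kb) + (-h4 - δ * N) + ((-h1 - δ * N) + ((-h2 - δ * N) + (-h3 - δ * N)))) := by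
        refine Real.exp_le_exp.2 ?_
        have hmN : (m:ℝ) ≤ 13 * δ * N := m1
        have e1 : δ * (3 * n + 15 * m) ≤ 4 * (δ * N) := by
          have : 3 * (n:ℝ) + 15 * m ≤ 4 * N := by linarith
          have := mul_le_mul_of_nonneg_left this hδ.le
          linarith
        have e2 : 7 * m * K ≤ 91 * (δ * N) * K := by
          have : 7 * (m:ℝ) ≤ 91 * (δ * N) := by linarith
          gcongr
        have e3 : n * R ≤ N * R + 117 * (δ * N) * |R| := by
          have : -(m:ℝ) * R ≤ m * |R| := by
            have := mul_le_mul_of_nonneg_left (neg_le_abs R) (Nat.cast_nonneg (α := ℝ) m)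
            linarith
          have h9 : (m:ℝ) * |R| ≤ 13 * δ * N * |R| := by gcongr
          have hNR : N * R = n * R + 9 * (m * R) := by rw [hnR]; ring
          linarith
        have e4 : (δ * N) * T ≤ ε / 2 * N := by
          have := mul_le_mul_of_nonneg_right d4' hNpos.le
          linarith
        simp only [hT] at e4
        simp only [hD]
        rw [hsplit] at hen
        linarith
    _ = Real.exp (-(δ * (3 * n + 15 * m))) * Real.exp (-(7 * m * K)) * Real.exp (-Real.log 4) *
          Real.exp (-X - D * Ka) * Real.exp (-Y - D * Kb) * Real.exp (-h4 - δ * N) *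
          (Real.exp (-h1 - δ * N) * (Real.exp (-h2 - δ * N) * Real.exp (-h3 - δ * N))) := by
        simp only [Real.exp_add]
    _ ≤ _ := by
        rw [hc, hκe, hεe, div_eq_mul_one_div _ (4:ℝ), h4e]
        have p1 := mul_le_mul t2 t3 (Real.exp_pos _).le ((Real.exp_pos _).le.trans t2)
        have p2 := mul_le_mul t1 p1 (mul_pos (Real.exp_pos _) (Real.exp_pos _)).le
          ((Real.exp_pos _).le.trans t1)
        exact mul_le_mul (mul_le_mul_of_nonneg_left t4 (by positivity)) p2 (by positivity)
          (mul_nonneg (by positivity) hS0)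

end OpenASEP

namespace OpenASEP
open MeasureTheory Filter Topology Set

lemma isPath_linear {p : ℝ} (h0 : 0 ≤ p) (h1 : p ≤ 1) : IsPath (fun x => p * x) where
  mono := fun x y h => mul_le_mul_of_nonneg_left h h0
  lip := LipschitzWith.of_dist_le_mul fun x y => by
    rw [Real.dist_eq, Real.dist_eq, ← mul_sub, abs_mul, abs_of_nonneg h0, NNReal.coe_one]
    exact mul_le_mul_of_nonneg_right h1 (abs_nonneg _)
  zero := mul_zero p

lemma env_linear {p : ℝ} (h0 : 0 ≤ p) (h1 : p ≤ 1) {x : ℝ} (hx : x ∈ Icc (0:ℝ) 1) :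
    env (fun x => p * x) x = p * x := by
  refine le_antisymm (env_le (isPath_linear h0 h1) hx) ?_
  rw [env_eq hx]
  have := affine_le_convEnv (F := fun x => p * x) (m := 0) (k := p) (fun t _ => by simp) hx
  linarith

lemma rate_linear {p : ℝ} (h0 : 0 ≤ p) (h1 : p ≤ 1) (ρ ρ' : ℝ) :
    rate ρ ρ' (fun x => p * x) = Hent p + Lfun ρ ρ' p := by
  have e1 : ∀ x : ℝ, deriv (fun x => p * x) x = p := fun x => by
    simp
  have e2 : ∀ x ∈ Ioo (0:ℝ) 1, deriv (env (fun x => p * x)) x = p := fun x hx => by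
    refine (Filter.EventuallyEq.deriv_eq ?_).trans (e1 x)
    filter_upwards [Ioo_mem_nhds hx.1 hx.2] with y hy
    exact env_linear h0 h1 ⟨hy.1.le, hy.2.le⟩
  have e3 : ∫ x in (0:ℝ)..1, Lfun ρ ρ' (deriv (env (fun x => p * x)) x) =
      ∫ x in (0:ℝ)..1, Lfun ρ ρ' p := by
    rw [intervalIntegral.integral_of_le zero_le_one, intervalIntegral.integral_of_le zero_le_one,
      integral_Ioc_eq_integral_Ioo, integral_Ioc_eq_integral_Ioo]
    exact setIntegral_congr_fun measurableSet_Ioo fun x hx => by simp only [e2 x hx]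
  rw [rate, e3]
  simp [e1]

namespace Par
variable (P : Par)

lemma Jfun_pos : 0 < Jfun P.a P.b := by
  unfold Jfun; split_ifs <;> positivity

/-- The minimising slope. -/
lemma exists_slope : ∃ p, 0 < p ∧ p < 1 ∧ P.Adm (1 - p) ∧ p * (1 - p) = Jfun P.a P.b ∧
    Hent p + Lfun P.ρ P.ρ' p = Real.log (Jfun P.a P.b) := by
  have hρ := P.ρ_lt_ρ'
  have ha := P.ha
  have hb := P.hb
  have log_mul : ∀ p : ℝ, 0 < p → p < 1 →
      Real.log (p * (1 - p)) = Real.log p + Real.log (1 - p) := fun p h0 h1 =>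
    Real.log_mul h0.ne' (by linarith)
  have fin : ∀ p : ℝ, 0 < p → p < 1 → P.ρ ≤ 1 - p → 1 - p ≤ P.ρ' → p * (1 - p) = Jfun P.a P.b →
      Lfun P.ρ P.ρ' p = p * Real.log (1 - p) + (1 - p) * Real.log p →
      ∃ p, 0 < p ∧ p < 1 ∧ P.Adm (1 - p) ∧ p * (1 - p) = Jfun P.a P.b ∧
        Hent p + Lfun P.ρ P.ρ' p = Real.log (Jfun P.a P.b) := by
    intro p h0 h1 h2 h3 h4 h5
    refine ⟨p, h0, h1, P.adm_of_mem (by linarith) (by linarith) h2 h3, h4, ?_⟩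
    rw [← h4, log_mul p h0 h1, h5, Hent]; ring
  by_cases h1 : 1 < P.a
  · have hr : P.ρ = P.a / (1 + P.a) := rfl
    have hr2 : 1 / 2 < P.ρ := by rw [hr, lt_div_iff₀ (by linarith)]; linarith
    refine fin (1 - P.ρ) (by linarith [P.ρ_lt_one]) (by linarith) (by linarith) (by linarith) ?_ ?_
    · rw [Jfun, if_pos h1, hr]; field_simp; ring
    · rw [Lfun_of_le hρ.le (by linarith)]; simp
  · by_cases h2 : 1 < P.b
    · have hr : P.ρ' = 1 / (1 + P.b) := rfl
      have hr2 : P.ρ' < 1 / 2 := by rw [hr, div_lt_div_iff₀ (by linarith) (by norm_num)]; linarith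
      refine fin (1 - P.ρ') (by linarith) (by linarith [P.ρ'_pos]) (by linarith) (by linarith) ?_ ?_
      · rw [Jfun, if_neg h1, if_pos h2, hr]; field_simp; ring
      · rw [Lfun_of_ge hρ.le (by linarith)]; simp
    · have e1 : P.ρ ≤ 1 / 2 := by rw [ρ, div_le_div_iff₀ (by linarith) (by norm_num)]; linarith
      have e2 : 1 / 2 ≤ P.ρ' := by rw [ρ', div_le_div_iff₀ (by norm_num) (by linarith)]; linarith
      refine fin (1 / 2) (by norm_num) (by norm_num) (by linarith) (by linarith) ?_ ?_
      · rw [Jfun, if_neg h1, if_neg h2]; norm_num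
      · rw [Lfun_of_mem e1 e2, Hent]; norm_num

/-- Total weight. -/
noncomputable def Z (N : ℕ) : ℝ := ∑ τ : Fin N → Bool, P.W N τ

lemma Z_pos (N : ℕ) : 0 < P.Z N :=
  Finset.sum_pos (fun _ _ => P.w_pos _) Finset.univ_nonempty

lemma Z_le (N : ℕ) : P.Z N ≤ Real.exp (-(N * Real.log (Jfun P.a P.b))) := by
  obtain ⟨p, h0, h1, hadm, hJ, -⟩ := P.exists_slope
  calc P.Z N ≤ ∑ τ : Fin N → Bool, ∏ i, lw (1 - p) (τ i) :=
        Finset.sum_le_sum fun τ _ => P.W_le_prod τ (fun _ => 1 - p) (fun _ _ _ => le_rfl)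
          fun _ => hadm
    _ = (∑ x : Bool, lw (1 - p) x) ^ N := by
        rw [← Fin.prod_const, Finset.prod_univ_sum, Fintype.piFinset_univ]
    _ = (Jfun P.a P.b)⁻¹ ^ N := by
        congr 1
        have : 0 < 1 - p := by linarith
        simp only [Fintype.sum_bool, lw, ← hJ]
        simp; field_simp; ring
    _ = _ := by
        rw [← Real.exp_log (inv_pos.2 P.Jfun_pos), ← Real.exp_nat_mul, Real.log_inv]
        congr 1; ring

lemma le_Z {ε : ℝ} (hε : 0 < ε) : ∃ N₀ : ℕ, ∀ N ≥ N₀,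
    Real.exp (-(N * (Real.log (Jfun P.a P.b) + ε))) ≤ P.Z N := by
  obtain ⟨p, h0, h1, -, -, hL⟩ := P.exists_slope
  obtain ⟨N₀, h⟩ := P.lower_local (isPath_linear h0.le h1.le) one_pos hε
  refine ⟨N₀, fun N hN => ?_⟩
  have := h N hN
  rw [rate_linear h0.le h1.le, hL] at this
  refine this.trans (Finset.sum_le_sum fun τ _ => ?_)
  split_ifs
  · exact le_rfl
  · exact (P.w_pos _).le

/-- Limiting exponential rate of a path under the normalised weights. -/
noncomputable def nrate (F : ℝ → ℝ) : ℝ := rate P.ρ P.ρ' F - Real.log (Jfun P.a P.b)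

variable {F : ℝ → ℝ}

theorem prob_upper (hF : IsPath F) {ε : ℝ} (hε : 0 < ε) : ∃ r, 0 < r ∧ ∃ N₀ : ℕ, ∀ N ≥ N₀,
    (∑ τ : Fin N → Bool, if Near F r N (List.ofFn τ) then P.W N τ / P.Z N else 0) ≤
      Real.exp (-(N * (P.nrate F - ε))) := by
  obtain ⟨r, hr, N₁, h1⟩ := P.upper_local hF (half_pos hε)
  obtain ⟨N₂, h2⟩ := P.le_Z (half_pos hε)
  refine ⟨r, hr, max N₁ N₂, fun N hN => ?_⟩
  have a := h1 N (le_of_max_le_left hN)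
  have b := h2 N (le_of_max_le_right hN)
  have e : (∑ τ : Fin N → Bool, if Near F r N (List.ofFn τ) then P.W N τ / P.Z N else 0) =
      (∑ τ : Fin N → Bool, if Near F r N (List.ofFn τ) then P.W N τ else 0) / P.Z N := by
    rw [Finset.sum_div]; exact Finset.sum_congr rfl fun τ _ => by split_ifs <;> simp
  rw [e, div_le_iff₀ (P.Z_pos N)]
  refine a.trans (le_trans ?_ (mul_le_mul_of_nonneg_left b (Real.exp_pos _).le))
  rw [← Real.exp_add, nrate]
  refine Real.exp_le_exp.2 (le_of_eq ?_); ring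

theorem prob_lower (hF : IsPath F) {r ε : ℝ} (hr : 0 < r) (hε : 0 < ε) : ∃ N₀ : ℕ, ∀ N ≥ N₀,
    Real.exp (-(N * (P.nrate F + ε))) ≤
      ∑ τ : Fin N → Bool, if Near F r N (List.ofFn τ) then P.W N τ / P.Z N else 0 := by
  obtain ⟨N₁, h1⟩ := P.lower_local hF hr hε
  refine ⟨N₁, fun N hN => ?_⟩
  have a := h1 N hN
  have b := P.Z_le N
  have e : (∑ τ : Fin N → Bool, if Near F r N (List.ofFn τ) then P.W N τ / P.Z N else 0) =
      (∑ τ : Fin N → Bool, if Near F r N (List.ofFn τ) then P.W N τ else 0) / P.Z N := by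
    rw [Finset.sum_div]; exact Finset.sum_congr rfl fun τ _ => by split_ifs <;> simp
  rw [e, le_div_iff₀ (P.Z_pos N)]
  refine le_trans (le_trans (mul_le_mul_of_nonneg_left b (Real.exp_pos _).le) ?_) a
  rw [← Real.exp_add, nrate]
  refine Real.exp_le_exp.2 (le_of_eq ?_); ring

end Par

section Phi
variable {q x y : ℝ}

lemma phi_spec (hx : 0 < x) (hy : 0 ≤ y) (hq1 : q < 1) :
    0 ≤ phiPlus q x y ∧ -1 < phiMinus q x y ∧ phiMinus q x y ≤ 0 ∧
      y = x * -(phiPlus q x y * phiMinus q x y) ∧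
      1 - q = x * ((1 + phiPlus q x y) * (1 + phiMinus q x y)) := by
  set u := 1 - q - x + y with hu
  set s := Real.sqrt (u ^ 2 + 4 * x * y) with hs
  have hxy : 0 ≤ 4 * x * y := by positivity
  have h0 : 0 ≤ u ^ 2 + 4 * x * y := by positivity
  have hss : s ^ 2 = u ^ 2 + 4 * x * y := Real.sq_sqrt h0
  have hs0 : 0 ≤ s := Real.sqrt_nonneg _
  have hsu : |u| ≤ s := Real.abs_le_sqrt (by linarith)
  have hsu' := abs_le.1 hsu
  have hp : phiPlus q x y = (u + s) / (2 * x) := by rw [phiPlus, ← hu, ← hs]; ring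
  have hm : phiMinus q x y = (u - s) / (2 * x) := by rw [phiMinus, ← hu, ← hs]; ring
  rw [hp, hm]
  refine ⟨div_nonneg (by linarith) (by linarith), ?_,
    div_nonpos_of_nonpos_of_nonneg (by linarith) (by linarith), ?_, ?_⟩
  · rw [lt_div_iff₀ (by linarith)]
    have : s < u + 2 * x := by
      refine lt_of_pow_lt_pow_left₀ 2 (by simp only [hu]; linarith) ?_
      rw [hss]; nlinarith
    linarith
  · field_simp; linarith
  · field_simp; nlinarith

end Phi
end OpenASEP

namespace OpenASEP
open MeasureTheory Filter Topology Set

lemma inv_mul_elog_le {N : ℕ} (hN : 1 ≤ N) {x y : ℝ} (h : x ≤ Real.exp (N * y)) :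
    (((N : ℝ)⁻¹ : ℝ) : EReal) * elog x ≤ y := by
  have hN' : (0:ℝ) < N := by exact_mod_cast hN
  unfold elog
  split_ifs with hx
  · rw [EReal.coe_mul_bot_of_pos (inv_pos.2 hN')]; exact bot_le
  · rw [← EReal.coe_mul, EReal.coe_le_coe_iff, inv_mul_le_iff₀ hN',
      Real.log_le_iff_le_exp (not_le.1 hx)]
    exact h

lemma le_inv_mul_elog {N : ℕ} (hN : 1 ≤ N) {x y : ℝ} (h : Real.exp (N * y) ≤ x) :
    (y : EReal) ≤ (((N : ℝ)⁻¹ : ℝ) : EReal) * elog x := by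
  have hN' : (0:ℝ) < N := by exact_mod_cast hN
  have hx : 0 < x := (Real.exp_pos _).trans_le h
  rw [elog, if_neg hx.not_ge, ← EReal.coe_mul, EReal.coe_le_coe_iff, le_inv_mul_iff₀ hN',
    Real.le_log_iff_exp_le hx]
  exact h

/-- A large deviation principle from local estimates on a compact set carrying all the mass. -/
theorem ldp_of_local {X : Type*} [TopologicalSpace X] {Λ : Set X} (hΛ : IsCompact Λ)
    (hΛc : IsClosed Λ) {I : X → EReal} {J : X → ℝ} (hI : ∀ f ∈ Λ, I f = (J f : EReal))
    (hI' : ∀ f ∉ Λ, I f = ⊤) {Ω : ℕ → Type*} [∀ N, Fintype (Ω N)] {μ : ∀ N, Ω N → ℝ}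
    {h : ∀ N, Ω N → X} (hμ : ∀ N, 1 ≤ N → ∀ τ, 0 ≤ μ N τ) (hh : ∀ N, 1 ≤ N → ∀ τ, h N τ ∈ Λ)
    (hU : ∀ f ∈ Λ, ∀ ε > 0, ∃ O, IsOpen O ∧ f ∈ O ∧ ∀ᶠ N : ℕ in atTop,
      (∑ τ, if h N τ ∈ O then μ N τ else 0) ≤ Real.exp (-(N * (J f - ε))))
    (hL : ∀ f ∈ Λ, ∀ O, IsOpen O → f ∈ O → ∀ ε > 0, ∀ᶠ N : ℕ in atTop,
      Real.exp (-(N * (J f + ε))) ≤ ∑ τ, if h N τ ∈ O then μ N τ else 0) :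
    LowerSemicontinuous I ∧ (∀ t : ℝ, 0 ≤ t → IsCompact {f | I f ≤ (t : EReal)}) ∧
    (∀ C : Set X, IsClosed C → limsup (fun N : ℕ => (((N : ℝ)⁻¹ : ℝ) : EReal) *
      elog (∑ τ, if h N τ ∈ C then μ N τ else 0)) atTop ≤ -(⨅ f ∈ C, I f)) ∧
    (∀ U : Set X, IsOpen U → -(⨅ f ∈ U, I f) ≤ liminf (fun N : ℕ => (((N : ℝ)⁻¹ : ℝ) : EReal) *
      elog (∑ τ, if h N τ ∈ U then μ N τ else 0)) atTop) := by
  have hlsc : LowerSemicontinuous I := by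
    intro f y hy
    by_cases hf : f ∈ Λ
    · rw [hI f hf] at hy
      obtain ⟨z, hyz, hz⟩ := EReal.lt_iff_exists_real_btwn.1 hy
      rw [EReal.coe_lt_coe_iff] at hz
      obtain ⟨O, hO, hfO, hO'⟩ := hU f hf ((J f - z) / 2) (by linarith)
      filter_upwards [hO.mem_nhds hfO] with g hg
      by_cases hgΛ : g ∈ Λ
      · rw [hI g hgΛ]
        refine hyz.trans ?_
        rw [EReal.coe_lt_coe_iff]
        by_contra! hcon
        obtain ⟨N, ⟨h1, h2⟩, h3⟩ := ((hO'.and (hL g hgΛ O hO hg ((J f - z) / 4)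
          (by linarith))).and (eventually_ge_atTop 1)).exists
        have h4 := Real.exp_le_exp.1 (h2.trans h1)
        have hN : (1:ℝ) ≤ N := by exact_mod_cast h3
        nlinarith
      · rw [hI' g hgΛ]; exact hyz.trans (EReal.coe_lt_top z)
    · filter_upwards [hΛc.isOpen_compl.mem_nhds hf] with g hg
      rw [hI' g hg]
      rw [hI' f hf] at hy; exact hy
  refine ⟨hlsc, fun t _ => ?_, fun C hC => ?_, fun U hU' => ?_⟩
  · refine hΛ.of_isClosed_subset (hlsc.isClosed_preimage (t : EReal)) fun f hf => ?_
    by_contra hfΛ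
    rw [mem_ofPred_eq, hI' f hfΛ, top_le_iff] at hf
    exact EReal.coe_ne_top t hf
  · by_contra! hcon
    obtain ⟨y', h1, h2⟩ := EReal.lt_iff_exists_real_btwn.1 hcon
    obtain ⟨y, h3, h4⟩ := EReal.lt_iff_exists_real_btwn.1 h2
    rw [EReal.coe_lt_coe_iff] at h3
    have hJ : ∀ f ∈ C ∩ Λ, -y' < J f := fun f hf => by
      have h5 : -(y' : EReal) < ⨅ f ∈ C, I f := EReal.neg_lt_comm.1 h1
      have h6 := h5.trans_le (iInf₂_le f hf.1)
      rw [hI f hf.2, ← EReal.coe_neg, EReal.coe_lt_coe_iff] at h6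
      exact h6
    choose! O hO hfO hO' using hU
    set V : X → Set X := fun f => O f (J f + y') with hV
    obtain ⟨s, hcov⟩ := (hΛ.inter_left hC).elim_nhds_subcover' (fun f _ => V f)
      (fun f hf => (hO f hf.2 _ (by linarith [hJ f hf])).mem_nhds
        (hfO f hf.2 _ (by linarith [hJ f hf])))
    have hle : ∀ᶠ N : ℕ in atTop, (∑ τ, if h N τ ∈ C then μ N τ else 0) ≤ Real.exp (N * y) := by
      have h5 : ∀ᶠ N : ℕ in atTop, ∀ f ∈ s, (∑ τ, if h N τ ∈ V f then μ N τ else 0) ≤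
          Real.exp (N * y') := by
        rw [Filter.eventually_all_finset]
        intro f _
        filter_upwards [hO' f f.2.2 (J f + y') (by linarith [hJ f f.2])] with N hN
        refine hN.trans (le_of_eq ?_)
        congr 1; ring
      have h6 : ∀ᶠ N : ℕ in atTop, Real.log (s.card + 1) ≤ (y - y') * N :=
        (tendsto_natCast_atTop_atTop.const_mul_atTop (by linarith)).eventually_ge_atTop _
      filter_upwards [h5, h6, eventually_ge_atTop 1] with N h5 h6 hN
      calc (∑ τ, if h N τ ∈ C then μ N τ else 0)
          ≤ ∑ τ, ∑ f ∈ s, if h N τ ∈ V f then μ N τ else 0 := by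
            refine Finset.sum_le_sum fun τ _ => ?_
            have hn : ∀ f ∈ s, 0 ≤ if h N τ ∈ V f then μ N τ else 0 := fun f _ => by
              split_ifs
              · exact hμ N hN τ
              · exact le_rfl
            split_ifs with hτ
            · obtain ⟨f, hf, hf'⟩ := mem_iUnion₂.1 (hcov ⟨hτ, hh N hN τ⟩)
              refine le_trans (le_of_eq ?_) (Finset.single_le_sum hn hf)
              rw [if_pos hf']
            · exact Finset.sum_nonneg hn
        _ = ∑ f ∈ s, ∑ τ, if h N τ ∈ V f then μ N τ else 0 := Finset.sum_comm
        _ ≤ ∑ f ∈ s, Real.exp (N * y') := Finset.sum_le_sum h5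
        _ = s.card * Real.exp (N * y') := by rw [Finset.sum_const, nsmul_eq_mul]
        _ ≤ Real.exp (Real.log (s.card + 1)) * Real.exp (N * y') := by
            rw [Real.exp_log (by positivity)]
            gcongr; linarith
        _ ≤ Real.exp (N * y) := by
            rw [← Real.exp_add]
            exact Real.exp_le_exp.2 (by linarith)
    refine absurd h4 (not_lt.2 (limsup_le_of_le (h := ?_)))
    filter_upwards [hle, eventually_ge_atTop 1] with N h1 h2
    exact inv_mul_elog_le h2 h1
  · by_contra! hcon
    obtain ⟨y, h1, h2⟩ := EReal.lt_iff_exists_real_btwn.1 hcon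
    have h3 : (⨅ f ∈ U, I f) < -(y : EReal) := EReal.lt_neg_comm.1 h2
    simp only [iInf_lt_iff] at h3
    obtain ⟨f, hfU, hf⟩ := h3
    have hfΛ : f ∈ Λ := by
      by_contra hc
      rw [hI' f hc] at hf
      exact not_top_lt hf
    rw [hI f hfΛ, ← EReal.coe_neg, EReal.coe_lt_coe_iff] at hf
    refine absurd h1 (not_lt.2 (le_liminf_of_le (h := ?_)))
    filter_upwards [hL f hfΛ U hU' hfU (-y - J f) (by linarith), eventually_ge_atTop 1] with N h4 h5
    refine le_inv_mul_elog h5 (le_trans (le_of_eq ?_) h4)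
    congr 1; ring

end OpenASEP

namespace OpenASEP
open MeasureTheory Filter Topology Set

/-- The unit interval as a type. -/
abbrev UI : Type := Icc (0:ℝ) 1

/-- Nondecreasing `1`-Lipschitz functions in `C₀([0,1],ℝ)`. -/
def pathSet : Set C0Sp := {f | ∀ x y : UI, x ≤ y → f.val x ≤ f.val y ∧ f.val y - f.val x ≤ y - x}

lemma extendF_coe (f : C0Sp) (x : UI) : extendF f.val x = f.val x := by
  unfold extendF; rw [projIcc_val]

lemma isPath_of_mem {f : C0Sp} (hf : f ∈ pathSet) : IsPath (extendF f.val) where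
  mono := fun x y h => (hf _ _ (monotone_projIcc _ h)).1
  lip := by
    refine LipschitzWith.of_le_add fun x y => ?_
    rcases le_total x y with h | h
    · have := (hf _ _ (monotone_projIcc (zero_le_one' ℝ) h)).1
      unfold extendF
      linarith [dist_nonneg (x := x) (y := y)]
    · have h1 := (hf _ _ (monotone_projIcc (zero_le_one' ℝ) h)).2
      have h2 := (le_abs_self _).trans (abs_projIcc_sub_projIcc (zero_le_one' ℝ) (c := x) (d := y))
      rw [Real.dist_eq]
      unfold extendF
      linarith
  zero := by
    unfold extendF
    rw [projIcc_left]; exact f.2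

lemma mem_pathSet_iff (f : C0Sp) : f ∈ pathSet ↔
    MonotoneOn (extendF f.val) (Icc (0:ℝ) 1) ∧ LipschitzOnWith 1 (extendF f.val) (Icc (0:ℝ) 1) := by
  refine ⟨fun h => ⟨(isPath_of_mem h).mono.monotoneOn _, (isPath_of_mem h).lip.lipschitzOnWith⟩,
    fun ⟨h1, h2⟩ x y hxy => ?_⟩
  have h3 := h1 x.2 y.2 hxy
  have h4 := h2.dist_le_mul y y.2 x x.2
  rw [Real.dist_eq, Real.dist_eq, abs_of_nonneg (sub_nonneg.2 h3),
    abs_of_nonneg (sub_nonneg.2 (Subtype.coe_le_coe.2 hxy)), NNReal.coe_one, one_mul] at h4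
  rw [extendF_coe, extendF_coe] at h3 h4
  exact ⟨h3, h4⟩

lemma isClosed_pathSet : IsClosed pathSet := by
  have hc : ∀ x : UI, Continuous fun f : C0Sp => f.val x := fun x =>
    (continuous_eval_const x).comp continuous_subtype_val
  simp only [pathSet, ofPred_forall]
  refine isClosed_iInter fun x => isClosed_iInter fun y => isClosed_iInter fun _ => ?_
  exact (isClosed_le (hc x) (hc y)).inter (isClosed_le ((hc y).sub (hc x)) continuous_const)

lemma isCompact_pathSet : IsCompact pathSet := by
  rw [Subtype.isCompact_iff]
  have hdist : ∀ f ∈ pathSet, LipschitzWith 1 (f.val : UI → ℝ) := fun f hf => by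
    have := (isPath_of_mem hf).lip.comp (LipschitzWith.subtype_val (Icc (0:ℝ) 1))
    have e : extendF f.val ∘ Subtype.val = (f.val : UI → ℝ) := funext fun x => extendF_coe f x
    rwa [one_mul, e] at this
  refine ArzelaAscoli.isCompact_of_equicontinuous _ ?_ ?_
  · set T : Set (UI → ℝ) := {g | g ⟨0, left_mem_Icc.mpr zero_le_one⟩ = 0 ∧
      ∀ x y : UI, x ≤ y → g x ≤ g y ∧ g y - g x ≤ y - x} with hT
    have hTc : IsClosed T := by
      have hc : ∀ x : UI, Continuous fun g : UI → ℝ => g x := fun x => continuous_apply x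
      have e : T = {g | g ⟨0, left_mem_Icc.mpr zero_le_one⟩ = 0} ∩
          ⋂ x : UI, ⋂ y : UI, ⋂ _ : x ≤ y, {g | g x ≤ g y ∧ g y - g x ≤ (y:ℝ) - x} := by
        ext g; simp only [hT, mem_inter_iff, mem_iInter, mem_ofPred_eq]
      rw [e]
      refine (isClosed_eq (hc _) continuous_const).inter ?_
      refine isClosed_iInter fun x => isClosed_iInter fun y => isClosed_iInter fun _ => ?_
      exact (isClosed_le (hc x) (hc y)).inter (isClosed_le ((hc y).sub (hc x)) continuous_const)
    have hsub : T ⊆ Set.pi univ fun _ => Icc (0:ℝ) 1 := by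
      intro g hg x _
      have h1 := hg.2 ⟨0, left_mem_Icc.mpr zero_le_one⟩ x x.2.1
      rw [hg.1] at h1
      simp only [sub_zero] at h1
      exact ⟨h1.1, h1.2.trans x.2.2⟩
    have hTK : IsCompact T :=
      (isCompact_univ_pi fun _ => isCompact_Icc).of_isClosed_subset hTc hsub
    convert hTK using 1
    ext g
    constructor
    · rintro ⟨_, ⟨f, hf, rfl⟩, rfl⟩
      exact ⟨f.2, hf⟩
    · rintro ⟨h0, h1⟩
      have hlip : LipschitzWith 1 g := by
        refine LipschitzWith.of_le_add fun x y => ?_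
        rw [Subtype.dist_eq, Real.dist_eq]
        rcases le_total x y with h | h
        · linarith [(h1 x y h).1, abs_nonneg ((x:ℝ) - y)]
        · linarith [(h1 y x h).2, le_abs_self ((x:ℝ) - y)]
      exact ⟨⟨g, hlip.continuous⟩, ⟨⟨⟨g, hlip.continuous⟩, h0⟩, h1, rfl⟩, rfl⟩
  · refine (LipschitzWith.uniformEquicontinuous _ 1 ?_).equicontinuous
    rintro ⟨_, f, hf, rfl⟩
    exact hdist f hf

section Height

lemma sum_clamp {t : ℝ} (ht : 0 ≤ t) (n : ℕ) :
    ∑ k ∈ Finset.range n, min 1 (max 0 (t - k)) = min (n : ℝ) t := by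
  induction n with
  | zero => simp [ht]
  | succ n ih =>
    rw [Finset.sum_range_succ, ih]
    push_cast
    rcases le_total t n with h | h
    · rw [min_eq_right h, max_eq_left (by linarith), min_eq_right zero_le_one,
        min_eq_right (by linarith), add_zero]
    · rw [min_eq_left h, max_eq_right (by linarith)]
      rcases le_total t (n + 1) with h' | h'
      · rw [min_eq_right (by linarith), min_eq_right h']; ring
      · rw [min_eq_left (by linarith), min_eq_left h']

variable {N : ℕ}

lemma heightC0_apply (τ : Fin N → Bool) (x : UI) : (heightC0 N τ).val x = (N : ℝ)⁻¹ * ∑ k : Fin N,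
    (if τ k = true then (1 : ℝ) else 0) * min 1 (max 0 ((N : ℝ) * (x : ℝ) - (k : ℕ))) := rfl

lemma heightC0_mem (hN : 1 ≤ N) (τ : Fin N → Bool) : heightC0 N τ ∈ pathSet := by
  intro x y hxy
  have hN' : (0:ℝ) < N := by exact_mod_cast hN
  have hxy' : (x:ℝ) ≤ y := hxy
  have hm : ∀ k : Fin N, min 1 (max 0 ((N : ℝ) * (x : ℝ) - (k : ℕ))) ≤
      min 1 (max 0 ((N : ℝ) * (y : ℝ) - (k : ℕ))) := fun k => by gcongr
  rw [heightC0_apply, heightC0_apply]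
  constructor
  · gcongr with k
  · rw [← mul_sub, ← Finset.sum_sub_distrib, inv_mul_le_iff₀ hN']
    have hs : ∀ z : UI, ∑ k : Fin N, min 1 (max 0 ((N : ℝ) * (z : ℝ) - (k : ℕ))) = N * z := by
      intro z
      rw [Fin.sum_univ_eq_sum_range (fun k => min 1 (max 0 ((N : ℝ) * (z : ℝ) - (k : ℕ)))) N,
        sum_clamp (mul_nonneg hN'.le z.2.1), min_eq_right]
      exact mul_le_of_le_one_right hN'.le z.2.2
    rw [show (N:ℝ) * (y - x) = N * y - N * x by ring]
    refine le_of_le_of_eq ?_ (congrArg₂ (· - ·) (hs y) (hs x))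
    rw [← Finset.sum_sub_distrib]
    refine Finset.sum_le_sum fun k _ => ?_
    rw [← mul_sub]
    have := hm k
    split_ifs <;> linarith

lemma extendF_heightC0 (τ : Fin N → Bool) {k : ℕ} (hN : 1 ≤ N) (hk : k ≤ N) :
    N * extendF (heightC0 N τ).val (k / N) = ht (List.ofFn τ) k := by
  have hN' : (0:ℝ) < N := by exact_mod_cast hN
  have hmem : (k / N : ℝ) ∈ Icc (0:ℝ) 1 :=
    ⟨by positivity, by rw [div_le_one hN']; exact_mod_cast hk⟩
  rw [extendF_coe (heightC0 N τ) ⟨_, hmem⟩, heightC0_apply, mul_inv_cancel_left₀ hN'.ne']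
  simp only [mul_div_cancel₀ _ hN'.ne']
  clear hmem
  induction k with
  | zero =>
    rw [ht_zero, Nat.cast_zero]
    refine Finset.sum_eq_zero fun i _ => ?_
    rw [max_eq_left (by simp), min_eq_right zero_le_one, mul_zero]
  | succ k ih =>
    have hk' : k < N := hk
    rw [ht_ofFn_succ τ ⟨k, hk'⟩, ← ih hk'.le, ← sub_eq_iff_eq_add', ← Finset.sum_sub_distrib,
      Finset.sum_eq_single ⟨k, hk'⟩]
    · rw [← mul_sub]; simp
    · intro i _ hi
      have hi' : (i:ℕ) ≠ k := fun h => hi (Fin.ext h)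
      rw [← mul_sub]
      push_cast
      rcases lt_or_gt_of_ne hi' with h | h
      · have : (i:ℝ) + 1 ≤ k := by exact_mod_cast h
        rw [min_eq_left (le_max_of_le_right (by linarith)),
          min_eq_left (le_max_of_le_right (by linarith)), sub_self, mul_zero]
      · have : (k:ℝ) + 1 ≤ i := by exact_mod_cast h
        rw [max_eq_left (by linarith), max_eq_left (by linarith), sub_self, mul_zero]
    · simp

lemma near_of_dist_lt {f : C0Sp} {r : ℝ} (hN : 1 ≤ N) (τ : Fin N → Bool)
    (h : dist (heightC0 N τ) f < r) : Near (extendF f.val) r N (List.ofFn τ) := by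
  intro k hk
  have hN' : (0:ℝ) < N := by exact_mod_cast hN
  rw [← extendF_heightC0 τ hN hk, ← mul_sub, abs_mul, abs_of_pos hN', mul_comm]
  refine mul_le_mul_of_nonneg_right (le_trans ?_ h.le) hN'.le
  rw [← Real.dist_eq]
  exact ContinuousMap.dist_apply_le_dist _

lemma dist_le_of_near {f : C0Sp} {r : ℝ} (hN : 1 ≤ N) (hf : f ∈ pathSet) (hr : 0 ≤ r)
    (τ : Fin N → Bool) (h : Near (extendF f.val) r N (List.ofFn τ)) :
    dist (heightC0 N τ) f ≤ r + 2 / N := by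
  have hN' : (0:ℝ) < N := by exact_mod_cast hN
  rw [Subtype.dist_eq, ContinuousMap.dist_le (by positivity)]
  intro x
  set k := ⌊N * (x:ℝ)⌋₊ with hk
  have hx0 : 0 ≤ N * (x:ℝ) := mul_nonneg hN'.le x.2.1
  have h1 : (k:ℝ) ≤ N * x := Nat.floor_le hx0
  have h2 : N * (x:ℝ) < k + 1 := Nat.lt_floor_add_one _
  have hkN : k ≤ N := by
    have : (k:ℝ) ≤ N := h1.trans (mul_le_of_le_one_right hN'.le x.2.2)
    exact_mod_cast this
  have hxk : |(x:ℝ) - k / N| ≤ 1 / N := by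
    rw [abs_of_nonneg (sub_nonneg.2 ((div_le_iff₀ hN').2 (by linarith))), sub_le_iff_le_add,
      ← add_div, le_div_iff₀ hN']
    linarith
  have h3 := h k hkN
  rw [← extendF_heightC0 τ hN hkN, ← mul_sub, abs_mul, abs_of_pos hN', mul_comm] at h3
  have h4 := le_of_mul_le_mul_right h3 hN'
  have h5 := ((isPath_of_mem (heightC0_mem hN τ)).abs_sub_le x (k / N)).trans hxk
  have h6 := ((isPath_of_mem hf).abs_sub_le x (k / N)).trans hxk
  rw [extendF_coe] at h5 h6
  rw [Real.dist_eq]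
  have e : (2:ℝ) / N = 1 / N + 1 / N := by ring
  rw [e]
  rw [abs_le] at *
  constructor <;> linarith [h4.1, h4.2, h5.1, h5.2, h6.1, h6.2]

end Height
end OpenASEP

/-- Theorem 1.2 (main theorem): in the fan region `ab < 1`, the height profiles of the open
ASEP stationary measures satisfy the large deviation principle in `C₀([0,1],ℝ)` with the good
rate function `I^{(a,b)}`. -/
theorem stmt0 (α β γ δ q : ℝ)
    (hα : 0 < α) (hβ : 0 < β) (hγ : 0 ≤ γ) (hδ : 0 ≤ δ) (hq0 : 0 ≤ q) (hq1 : q < 1)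
    (a b c d : ℝ)
    (ha : a = phiPlus q α γ) (hb : b = phiPlus q β δ)
    (hc : c = phiMinus q α γ) (hd : d = phiMinus q β δ)
    (hab : a * b < 1)
    (μ : (N : ℕ) → (Fin N → Bool) → ℝ)
    (hμ : ∀ N : ℕ, 1 ≤ N →
      (∀ τ, 0 ≤ μ N τ) ∧ (∑ τ : Fin N → Bool, μ N τ = 1) ∧
        IsStationaryASEP N α β γ δ q (μ N)) :
    LowerSemicontinuous (rateI a b) ∧
    (∀ t : ℝ, 0 ≤ t → IsCompact {f : C0Sp | rateI a b f ≤ (t : EReal)}) ∧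
    (∀ C : Set C0Sp, IsClosed C →
      Filter.limsup
          (fun N : ℕ => (((N : ℝ)⁻¹ : ℝ) : EReal) *
            elog (∑ τ : Fin N → Bool, if heightC0 N τ ∈ C then μ N τ else 0))
          Filter.atTop ≤
        -(⨅ f ∈ C, rateI a b f)) ∧
    (∀ U : Set C0Sp, IsOpen U →
      -(⨅ f ∈ U, rateI a b f) ≤
        Filter.liminf
          (fun N : ℕ => (((N : ℝ)⁻¹ : ℝ) : EReal) *
            elog (∑ τ : Fin N → Bool, if heightC0 N τ ∈ U then μ N τ else 0))
          Filter.atTop) := by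
  obtain ⟨ha0, hc1, hc0, hγ', hA⟩ := OpenASEP.phi_spec hα hγ hq1
  obtain ⟨hb0, hd1, hd0, hδ', hB⟩ := OpenASEP.phi_spec hβ hδ hq1
  rw [← ha, ← hc] at hγ' hA
  rw [← hb, ← hd] at hδ' hB
  rw [← ha] at ha0
  rw [← hb] at hb0
  rw [← hc] at hc1 hc0
  rw [← hd] at hd1 hd0
  let P : OpenASEP.Par := ⟨q, a, b, c, d, hq0, hq1, ha0, hb0, hc1, hc0, hd1, hd0, hab⟩
  have hw : ∀ N, 1 ≤ N → ∀ τ, μ N τ = P.W N τ / P.Z N := by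
    intro N hN τ
    obtain ⟨m, rfl⟩ := Nat.exists_eq_add_of_le' hN
    exact P.stationary_eq hα hβ hγ hδ hγ' hA hδ' hB m (hμ _ hN).2.1 (hμ _ hN).2.2 τ
  refine OpenASEP.ldp_of_local OpenASEP.isCompact_pathSet OpenASEP.isClosed_pathSet (J := fun f => P.nrate (extendF f.val))
    (fun f hf => ?_) (fun f hf => if_neg fun h => hf ((OpenASEP.mem_pathSet_iff f).2 h))
    (fun N hN => (hμ N hN).1) (fun N hN τ => OpenASEP.heightC0_mem hN τ) (fun f hf ε hε => ?_)
    (fun f hf O hO hfO ε hε => ?_)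
  · refine (if_pos ((OpenASEP.mem_pathSet_iff f).1 hf)).trans ?_
    rw [OpenASEP.rate_eq P.ρ_lt_ρ'.le]
    rfl
  · obtain ⟨r, hr, N₀, h⟩ := P.prob_upper (OpenASEP.isPath_of_mem hf) hε
    refine ⟨Metric.ball f r, Metric.isOpen_ball, Metric.mem_ball_self hr, ?_⟩
    filter_upwards [Filter.eventually_ge_atTop N₀, Filter.eventually_ge_atTop 1] with N h1 hN
    refine le_trans (Finset.sum_le_sum fun τ _ => ?_) (h N h1)
    rw [← hw N hN]
    split_ifs with h2 h3 h3
    · exact le_rfl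
    · exact absurd (OpenASEP.near_of_dist_lt hN τ h2) h3
    · exact (hμ N hN).1 τ
    · exact le_rfl
  · obtain ⟨η, hη, hball⟩ := Metric.isOpen_iff.1 hO f hfO
    obtain ⟨N₀, h⟩ := P.prob_lower (OpenASEP.isPath_of_mem hf) (half_pos hη) hε
    have ht : ∀ᶠ N : ℕ in Filter.atTop, (2:ℝ) / N < η / 2 :=
      (tendsto_const_div_atTop_nhds_zero_nat 2).eventually_lt_const (half_pos hη)
    filter_upwards [Filter.eventually_ge_atTop N₀, Filter.eventually_ge_atTop 1, ht] with N h1 hN ht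
    refine le_trans (h N h1) (Finset.sum_le_sum fun τ _ => ?_)
    rw [← hw N hN]
    split_ifs with h2 h3 h3
    · exact le_rfl
    · refine absurd (hball ?_) h3
      rw [Metric.mem_ball]
      linarith [OpenASEP.dist_le_of_near hN hf (half_pos hη).le τ h2]
    · exact (hμ N hN).1 τ
    · exact le_rfl
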